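/- Let d ≥ 2 and 2 ≤ k < ℓ be integers with k and ℓ relatively prime. Every commutative ℝ-algebra A whose complexification A ⊗_ℝ ℂ is isomorphic as a ℂ-algebra to ℂ[x,y,z,t]/(x^d·y + z^k + x + t^ℓ) is isomorphic as an ℝ-algebra to ℝ[x,y,z,t]/(x^d·y + z^k + x + t^ℓ). In other words, every real form of the Koras-Russell threefold X_{d,k,ℓ} = Spec(ℂ[x,y,z,t]/(x^d y + z^k + x + t^ℓ)) is isomorphic to Spec(ℝ[x,y,z,t]/(x^d y + z^k + x + t^ℓ)). -/

import Mathlib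

section
open MvPolynomial
open scoped TensorProduct

/-- The defining polynomial `x^d*y + z^k + x + t^ℓ` of a Koras-Russell threefold of the
first kind, over an arbitrary commutative ring. -/
noncomputable def krPoly (K : Type) [CommRing K] (d k l : ℕ) : MvPolynomial (Fin 4) K :=
  X 0 ^ d * X 1 + X 2 ^ k + X 0 + X 3 ^ l
end

namespace KR

section Nil
variable {κ L : Type*} [CommRing κ] [CommRing L] [Algebra κ L] (D : Derivation κ L L)

/-- last nonvanishing derivative at order `n`. -/
def IsDeg (a : L) (n : ℕ) : Prop := D^[n] a ≠ 0 ∧ D^[n+1] a = 0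

def Nil (a : L) : Prop := ∃ n, D^[n] a = 0

lemma iter_zero (n : ℕ) : D^[n] (0 : L) = 0 := by
  induction n with
  | zero => rfl
  | succ n ih => rw [Function.iterate_succ_apply, map_zero, ih]

lemma iter_add (n : ℕ) (a b : L) : D^[n] (a + b) = D^[n] a + D^[n] b := by
  induction n generalizing a b with
  | zero => rfl
  | succ n ih => simp only [Function.iterate_succ_apply, map_add, ih]

lemma iter_smul (n : ℕ) (c : κ) (a : L) : D^[n] (c • a) = c • D^[n] a := by
  induction n generalizing a with
  | zero => rfl
  | succ n ih => simp only [Function.iterate_succ_apply, Derivation.map_smul, ih]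

lemma iter_neg (n : ℕ) (a : L) : D^[n] (-a) = - D^[n] a := by
  induction n generalizing a with
  | zero => rfl
  | succ n ih => simp only [Function.iterate_succ_apply, map_neg, ih]

lemma iter_mono {m n : ℕ} (h : m ≤ n) {a : L} (ha : D^[m] a = 0) : D^[n] a = 0 := by
  obtain ⟨k, rfl⟩ := Nat.exists_eq_add_of_le' h
  rw [Function.iterate_add_apply, ha, iter_zero]

lemma iter_mul_aux (m : ℕ) : ∀ (n : ℕ) (a b : L), D^[m+1] a = 0 → D^[n+1] b = 0 →
    D^[m+n] (a*b) = ((m+n).choose m : L) * (D^[m] a * D^[n] b) ∧ D^[m+n+1] (a*b) = 0 := by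
  induction m with
  | zero =>
    intro n
    induction n with
    | zero =>
      intro a b ha hb
      simp only [zero_add, Function.iterate_one] at ha hb
      simp [ha, hb]
    | succ n ih =>
      intro a b ha hb
      simp only [zero_add, Function.iterate_one] at ha
      have h1 : D (a*b) = a * D b := by simp [ha]
      obtain ⟨h2, h3⟩ := ih a (D b) (by simpa using ha) (by
        rw [← Function.iterate_succ_apply]; exact hb)
      constructor
      · rw [← add_assoc, Function.iterate_succ_apply, h1, h2]; simp
      · rw [← add_assoc, Function.iterate_succ_apply, h1, h3]
  | succ m ihm =>
    intro n
    induction n with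
    | zero =>
      intro a b ha hb
      simp only [zero_add, Function.iterate_one] at hb
      have h1 : D (a*b) = D a * b := by simp [hb, mul_comm]
      obtain ⟨h2, h3⟩ := ihm 0 (D a) b (by
        rw [← Function.iterate_succ_apply]; exact ha) (by simpa using hb)
      constructor
      · rw [add_zero, Function.iterate_succ_apply, h1]
        rw [add_zero] at h2; rw [h2]; simp
      · rw [add_zero, Function.iterate_succ_apply, h1]; exact h3
    | succ n ihn =>
      intro a b ha hb
      have h1 : D (a*b) = D a * b + a * D b := by simp [mul_comm, add_comm]
      have ha' : D^[m+1] (D a) = 0 := by rw [← Function.iterate_succ_apply]; exact ha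
      have hb' : D^[n+1] (D b) = 0 := by rw [← Function.iterate_succ_apply]; exact hb
      obtain ⟨h2, h3⟩ := ihm (n+1) (D a) b ha' hb
      obtain ⟨h4, h5⟩ := ihn a (D b) ha hb'
      have e1 : m + 1 + (n + 1) = (m + (n+1)) + 1 := by ring
      have e2 : m + 1 + n = m + (n+1) := by ring
      constructor
      · rw [e1, Function.iterate_succ_apply, h1, iter_add, h2, ← e2, h4, e2,
          ← Function.iterate_succ_apply, ← Function.iterate_succ_apply,
          Nat.choose_succ_succ]
        push_cast; ring
      · rw [e1, Function.iterate_succ_apply, h1, iter_add, h3, ← e2, h5, add_zero]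

lemma Nil.add {a b : L} (ha : Nil D a) (hb : Nil D b) : Nil D (a+b) := by
  obtain ⟨m, hm⟩ := ha; obtain ⟨n, hn⟩ := hb
  refine ⟨max m n, ?_⟩
  rw [iter_add, iter_mono D (le_max_left _ _) hm, iter_mono D (le_max_right _ _) hn, add_zero]

lemma Nil.neg {a : L} (ha : Nil D a) : Nil D (-a) := by
  obtain ⟨m, hm⟩ := ha
  exact ⟨m, by rw [iter_neg, hm, neg_zero]⟩

lemma Nil.sub {a b : L} (ha : Nil D a) (hb : Nil D b) : Nil D (a-b) := by
  rw [sub_eq_add_neg]; exact ha.add D (hb.neg D)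

lemma Nil.mul {a b : L} (ha : Nil D a) (hb : Nil D b) : Nil D (a*b) := by
  obtain ⟨m, hm⟩ := ha; obtain ⟨n, hn⟩ := hb
  exact ⟨_, (iter_mul_aux D m n a b (iter_mono D (Nat.le_succ _) hm)
    (iter_mono D (Nat.le_succ _) hn)).2⟩

lemma Nil.of_ker {a : L} (ha : D a = 0) : Nil D a := ⟨1, ha⟩

lemma Nil.pow {a : L} (ha : Nil D a) (n : ℕ) : Nil D (a^n) := by
  induction n with
  | zero => exact Nil.of_ker D (by simp)
  | succ n ih => rw [pow_succ]; exact ih.mul D ha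

lemma Nil.der {a : L} (ha : Nil D a) : Nil D (D a) := by
  obtain ⟨m, hm⟩ := ha
  exact ⟨m, by rw [← Function.iterate_succ_apply]; exact iter_mono D (Nat.le_succ _) hm⟩

/-- The nil elements form a subalgebra. -/
def nilSub : Subalgebra κ L where
  carrier := {a | Nil D a}
  mul_mem' := fun ha hb => Nil.mul D ha hb
  add_mem' := fun ha hb => Nil.add D ha hb
  algebraMap_mem' := fun r => Nil.of_ker D (by simp)

lemma mem_nilSub {a : L} : a ∈ nilSub D ↔ Nil D a := Iff.rfl

lemma Nil.exists_isDeg {a : L} (h : Nil D a) (ha : a ≠ 0) : ∃ n, IsDeg D a n := by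
  classical
  have h' : ∃ n, D^[n] a = 0 := h
  have h0 : Nat.find h' ≠ 0 := by
    intro h0
    have := Nat.find_spec h'
    rw [h0] at this
    exact ha this
  obtain ⟨n, hn⟩ := Nat.exists_eq_succ_of_ne_zero h0
  exact ⟨n, Nat.find_min h' (by omega), by have := Nat.find_spec h'; rwa [hn] at this⟩

lemma IsDeg.unique {a : L} {m n : ℕ} (h1 : IsDeg D a m) (h2 : IsDeg D a n) : m = n := by
  rcases lt_trichotomy m n with h | h | h
  · exact absurd (iter_mono D h h1.2) h2.1
  · exact h
  · exact absurd (iter_mono D h h2.2) h1.1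

lemma isDeg_zero_iff {a : L} (ha : a ≠ 0) : IsDeg D a 0 ↔ D a = 0 := by
  simp [IsDeg, ha]

lemma IsDeg.ne_zero {a : L} {n : ℕ} (h : IsDeg D a n) : a ≠ 0 := by
  rintro rfl; exact h.1 (iter_zero D n)

lemma IsDeg.der {a : L} {n : ℕ} (h : IsDeg D a (n+1)) : IsDeg D (D a) n :=
  ⟨by rw [← Function.iterate_succ_apply]; exact h.1,
   by rw [← Function.iterate_succ_apply]; exact h.2⟩

lemma IsDeg.nil {a : L} {n : ℕ} (h : IsDeg D a n) : Nil D a := ⟨_, h.2⟩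

variable [IsDomain L] [CharZero L]

lemma IsDeg.mul {a b : L} {m n : ℕ} (ha : IsDeg D a m) (hb : IsDeg D b n) :
    IsDeg D (a*b) (m+n) := by
  obtain ⟨h1, h2⟩ := iter_mul_aux D m n a b ha.2 hb.2
  refine ⟨?_, h2⟩
  rw [h1]
  exact mul_ne_zero (by exact_mod_cast (Nat.choose_pos (Nat.le_add_right m n)).ne')
    (mul_ne_zero ha.1 hb.1)

lemma IsDeg.pow {a : L} {m : ℕ} (ha : IsDeg D a m) (n : ℕ) : IsDeg D (a^n) (n*m) := by
  induction n with
  | zero => simp [IsDeg]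
  | succ n ih => rw [pow_succ, Nat.succ_mul]; exact ih.mul D ha

/-- factorial closedness of the kernel -/
lemma ker_of_mul {a b : L} (ha : Nil D a) (hb : Nil D b) (h : D (a*b) = 0) (hab : a*b ≠ 0) :
    D a = 0 ∧ D b = 0 := by
  have ha0 := left_ne_zero_of_mul hab
  have hb0 := right_ne_zero_of_mul hab
  obtain ⟨m, hm⟩ := ha.exists_isDeg D ha0
  obtain ⟨n, hn⟩ := hb.exists_isDeg D hb0
  have := (hm.mul D hn).unique D ((isDeg_zero_iff D hab).2 h)
  obtain ⟨rfl, rfl⟩ : m = 0 ∧ n = 0 := by omega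
  exact ⟨(isDeg_zero_iff D ha0).1 hm, (isDeg_zero_iff D hb0).1 hn⟩

lemma ker_of_pow {a : L} (ha : Nil D a) {n : ℕ} (hn : n ≠ 0) (h : D (a^n) = 0) : D a = 0 := by
  by_cases ha0 : a = 0
  · simp [ha0]
  obtain ⟨m, rfl⟩ := Nat.exists_eq_succ_of_ne_zero hn
  rw [pow_succ] at h
  exact (ker_of_mul D (ha.pow D m) ha h (by positivity)).2

lemma mason_aux {a b α β γ : L} {p q m : ℕ} (ha : Nil D a) (hb : Nil D b)
    (hα : D α = 0) (hβ : D β = 0) (hγ : D γ = 0) (hβ0 : β ≠ 0) (hγ0 : γ ≠ 0)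
    (hp : 2 ≤ p) (hq : 2 ≤ q) (h : α * a^p + β * b^q = γ) (hm : IsDeg D a (m+1))
    (hb0 : b ≠ 0) :
    ∃ n, IsDeg D b n ∧ n ≤ m := by
  obtain ⟨n, hn⟩ := hb.exists_isDeg D hb0
  refine ⟨n, hn, ?_⟩
  have hD := congrArg D h
  simp only [map_add, Derivation.leibniz, Derivation.leibniz_pow, hα, hβ, hγ, smul_eq_mul,
    mul_zero, add_zero, nsmul_eq_mul] at hD
  obtain ⟨p, rfl⟩ := Nat.exists_eq_add_of_le' (show 1 ≤ p by omega)
  obtain ⟨q, rfl⟩ := Nat.exists_eq_add_of_le' (show 1 ≤ q by omega)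
  simp only [Nat.add_sub_cancel] at hD
  have key : (((p+1 : ℕ) : L) * γ) * D a =
      β * b^q * (((p+1 : ℕ) : L) * b * D a - ((q+1 : ℕ) : L) * a * D b) := by
    rw [← h]
    linear_combination a * hD
  have hne : (((p+1 : ℕ) : L) * γ) * D a ≠ 0 :=
    mul_ne_zero (mul_ne_zero (by exact_mod_cast Nat.succ_ne_zero p) hγ0) (hm.der D).ne_zero
  have hk1 : IsDeg D (((p+1 : ℕ) : L) * γ) 0 :=
    (isDeg_zero_iff D (left_ne_zero_of_mul hne)).2 (by simp [hγ])
  have hβ1 : IsDeg D β 0 := (isDeg_zero_iff D hβ0).2 hβ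
  have hcne := right_ne_zero_of_mul (key ▸ hne)
  have hcnil : Nil D (((p+1 : ℕ) : L) * b * D a - ((q+1 : ℕ) : L) * a * D b) := by
    refine Nil.sub D (((Nil.of_ker D (by simp)).mul D hb).mul D (ha.der D))
      (((Nil.of_ker D (by simp)).mul D ha).mul D (hb.der D))
  obtain ⟨r, hr⟩ := hcnil.exists_isDeg D hcne
  have e := (hk1.mul D (hm.der D)).unique D (key ▸ ((hβ1.mul D (hn.pow D q)).mul D hr))
  have : 1 * n ≤ q * n := Nat.mul_le_mul_right _ (by omega)
  omega

/-- the "Mason-lite" lemma -/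
lemma mason {a b α β γ : L} {p q : ℕ} (ha : Nil D a) (hb : Nil D b)
    (hα : D α = 0) (hβ : D β = 0) (hγ : D γ = 0) (hα0 : α ≠ 0) (hβ0 : β ≠ 0) (hγ0 : γ ≠ 0)
    (hp : 2 ≤ p) (hq : 2 ≤ q) (h : α * a^p + β * b^q = γ) : D a = 0 ∧ D b = 0 := by
  have key : ∀ (c : L) (e : ℕ) (x : L), 2 ≤ e → Nil D x → D c = 0 → c * x^e = γ → D x = 0 := by
    intro c e x he hx hc hh
    have h1 : x^e ≠ 0 := right_ne_zero_of_mul (hh ▸ hγ0)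
    exact ker_of_pow D hx (by omega)
      (ker_of_mul D (Nil.of_ker D hc) (hx.pow D e) (by rw [hh, hγ]) (by rw [hh]; exact hγ0)).2
  by_cases ha0 : a = 0
  · subst ha0
    rw [zero_pow (by omega), mul_zero, zero_add] at h
    exact ⟨by simp, key β q b hq hb hβ h⟩
  by_cases hb0 : b = 0
  · subst hb0
    rw [zero_pow (by omega), mul_zero, add_zero] at h
    exact ⟨key α p a hp ha hα h, by simp⟩
  have hDr : D a = 0 → D b = 0 := by
    intro hDa
    have h2 : D (β * b^q) = 0 := by
      have : β * b^q = γ - α * a^p := by rw [← h]; ring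
      rw [this]; simp [hγ, hα, hDa]
    exact ker_of_pow D hb (by omega)
      (ker_of_mul D (Nil.of_ker D hβ) (hb.pow D q) h2
        (mul_ne_zero hβ0 (pow_ne_zero _ hb0))).2
  by_cases hDa : D a = 0
  · exact ⟨hDa, hDr hDa⟩
  exfalso
  obtain ⟨m, hm⟩ := ha.exists_isDeg D ha0
  obtain ⟨m, rfl⟩ : ∃ m', m = m' + 1 := Nat.exists_eq_succ_of_ne_zero (by
    rintro rfl; exact hDa ((isDeg_zero_iff D ha0).1 hm))
  obtain ⟨n, hn, hnm⟩ := mason_aux D ha hb hα hβ hγ hβ0 hγ0 hp hq h hm hb0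
  obtain ⟨n, rfl⟩ | rfl : (∃ n', n = n' + 1) ∨ n = 0 := by
    rcases n with _ | n
    · right; rfl
    · left; exact ⟨n, rfl⟩
  · obtain ⟨m', hm', hm''⟩ := mason_aux D hb ha hβ hα hγ hα0 hγ0 hq hp
      (by rw [add_comm]; exact h) hn ha0
    have := hm.unique D hm'
    omega
  · -- b in the kernel
    have hDb := (isDeg_zero_iff D hb0).1 hn
    have h2 : D (α * a^p) = 0 := by
      have : α * a^p = γ - β * b^q := by rw [← h]; ring
      rw [this]; simp [hγ, hβ, hDb]
    exact hDa (ker_of_pow D ha (by omega)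
      (ker_of_mul D (Nil.of_ker D hα) (ha.pow D p) h2
        (mul_ne_zero hα0 (pow_ne_zero _ ha0))).2)

end Nil
end KR

set_option linter.unusedSectionVars false

namespace KR
open AddMonoidAlgebra

section Grade
variable {κ G Γ : Type*} [Field κ] [AddCommGroup G] [AddCommGroup Γ] [LinearOrder Γ]
  [IsOrderedAddMonoid Γ] (w : G →+ Γ)

/-- weight at most `γ` -/
def LE (γ : Γ) : Submodule κ (AddMonoidAlgebra κ G) where
  carrier := {f | ∀ g, f.coeff g ≠ 0 → w g ≤ γ}
  zero_mem' := fun g hg => absurd rfl hg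
  add_mem' := by
    intro a b ha hb g hg
    by_cases h : a.coeff g = 0
    · apply hb; intro h'; apply hg; simp [h, h']
    · exact ha g h
  smul_mem' := by
    intro c a ha g hg
    apply ha; intro h; apply hg; simp [h]

lemma single_mem_LE {γ : Γ} {g : G} (r : κ) (h : w g ≤ γ) : single g r ∈ LE (κ := κ) w γ := by
  classical
  intro g' hg'
  rw [coeff_single, Finsupp.single_apply] at hg'
  split_ifs at hg' with h1
  · rw [← h1]; exact h
  · exact absurd rfl hg'

lemma LE_mono {γ γ' : Γ} (h : γ ≤ γ') : LE (κ := κ) w γ ≤ LE w γ' :=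
  fun _ hf g hg => (hf g hg).trans h

lemma LE_induction {γ : Γ} {p : AddMonoidAlgebra κ G → Prop} (h0 : p 0)
    (ha : ∀ a b, p a → p b → p (a + b)) (hs : ∀ g r, w g ≤ γ → p (single g r))
    {f : AddMonoidAlgebra κ G} (hf : f ∈ LE w γ) : p f := by
  rw [← sum_coeff_single f]
  exact Finset.sum_induction _ p ha h0
    (fun g hg => hs g _ (hf g (Finsupp.mem_support_iff.1 hg)))

open Classical in
/-- weight component -/
noncomputable def comp (γ : Γ) : AddMonoidAlgebra κ G →ₗ[κ] AddMonoidAlgebra κ G where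
  toFun f := ofCoeff (f.coeff.filter (fun g => w g = γ))
  map_add' := by intro f g; ext a; simp [Finsupp.filter_apply]
  map_smul' := by intro c f; ext a; simp [Finsupp.filter_apply]

open Classical in
lemma coeff_comp (γ : Γ) (f : AddMonoidAlgebra κ G) (g : G) :
    (comp w γ f).coeff g = if w g = γ then f.coeff g else 0 := by
  simp [comp, Finsupp.filter_apply]

open Classical in
lemma comp_single (γ : Γ) (g : G) (r : κ) :
    comp w γ (single g r) = if w g = γ then single g r else 0 := by
  ext a
  rw [coeff_comp]
  by_cases h : g = a
  · subst h; split_ifs <;> simp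
  · have h' : (single g r).coeff a = 0 := by
      rw [coeff_single, Finsupp.single_eq_of_ne' h]
    rw [h']
    split_ifs <;> first | exact h'.symm | rfl

lemma comp_single_eq {γ : Γ} {g : G} (h : w g = γ) (r : κ) :
    comp w γ (single g r) = single g r := by rw [comp_single, if_pos h]

lemma comp_single_ne {γ : Γ} {g : G} (h : w g ≠ γ) (r : κ) :
    comp w γ (single g r) = 0 := by rw [comp_single, if_neg h]

lemma comp_mem_LE (γ : Γ) (f : AddMonoidAlgebra κ G) : comp w γ f ∈ LE w γ := by
  classical
  intro g hg
  rw [coeff_comp] at hg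
  split_ifs at hg with h
  · exact h.le
  · exact absurd rfl hg

lemma comp_of_lt {γ γ' : Γ} (h : γ' < γ) {f : AddMonoidAlgebra κ G} (hf : f ∈ LE w γ') :
    comp w γ f = 0 := by
  classical
  ext g
  rw [coeff_comp]
  split_ifs with h1
  · by_contra h2
    exact absurd (hf g h2) (by rw [h1]; exact not_le.2 h)
  · rfl

lemma mul_mem_LE {γ₁ γ₂ : Γ} {f g : AddMonoidAlgebra κ G} (hf : f ∈ LE w γ₁) (hg : g ∈ LE w γ₂) :
    f * g ∈ LE w (γ₁ + γ₂) := by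
  revert hf
  apply LE_induction w (p := fun f => f * g ∈ LE w (γ₁ + γ₂))
  · simp
  · intro a b ha hb; rw [add_mul]; exact add_mem ha hb
  · intro a r ha
    revert hg
    apply LE_induction w (p := fun g => single a r * g ∈ LE w (γ₁ + γ₂))
    · simp
    · intro a b ha hb; rw [mul_add]; exact add_mem ha hb
    · intro b s hb
      rw [single_mul_single]
      exact single_mem_LE w _ (by rw [map_add]; exact add_le_add ha hb)

lemma comp_mul {γ₁ γ₂ : Γ} {f g : AddMonoidAlgebra κ G} (hf : f ∈ LE w γ₁) (hg : g ∈ LE w γ₂) :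
    comp w (γ₁ + γ₂) (f * g) = comp w γ₁ f * comp w γ₂ g := by
  revert hf
  apply LE_induction w (p := fun f => comp w (γ₁ + γ₂) (f * g) = comp w γ₁ f * comp w γ₂ g)
  · simp
  · intro a b ha hb; simp only [add_mul, map_add, ha, hb]
  · intro a r ha
    revert hg
    apply LE_induction w (p := fun g => comp w (γ₁ + γ₂) (single a r * g) =
      comp w γ₁ (single a r) * comp w γ₂ g)
    · simp
    · intro a b ha hb; simp only [mul_add, map_add, ha, hb]
    · intro b s hb
      rw [single_mul_single]
      rcases ha.lt_or_eq with h1 | h1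
      · rw [comp_single_ne w h1.ne, zero_mul, comp_single_ne]
        rw [map_add]; exact (add_lt_add_of_lt_of_le h1 hb).ne
      · rcases hb.lt_or_eq with h2 | h2
        · rw [comp_single_ne w h2.ne, mul_zero, comp_single_ne]
          rw [map_add]; exact (add_lt_add_of_le_of_lt ha h2).ne
        · rw [comp_single_eq w h1, comp_single_eq w h2, comp_single_eq, single_mul_single]
          rw [map_add, h1, h2]

/-- top degree -/
lemma exists_top {f : AddMonoidAlgebra κ G} (hf : f ≠ 0) :
    ∃ γ, f ∈ LE w γ ∧ comp w γ f ≠ 0 := by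
  classical
  have hs : f.coeff.support.Nonempty := by
    rw [Finsupp.support_nonempty_iff]; simpa using hf
  obtain ⟨g, hg, hmax⟩ := Finset.exists_max_image f.coeff.support w hs
  refine ⟨w g, fun g' hg' => hmax g' (Finsupp.mem_support_iff.2 hg'), ?_⟩
  intro h
  have := coeff_comp w (w g) f g
  rw [h, if_pos rfl] at this
  exact Finsupp.mem_support_iff.1 hg this.symm

lemma exists_LE_finset {ι : Type*} (s : Finset ι)
    (F : ι → AddMonoidAlgebra κ G) (hne : ∃ i ∈ s, F i ≠ 0) :
    ∃ γ, (∀ i ∈ s, F i ∈ LE w γ) ∧ ∃ i ∈ s, comp w γ (F i) ≠ 0 := by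
  classical
  let s' := s.filter (fun i => F i ≠ 0)
  have hs' : s'.Nonempty := by
    obtain ⟨i, hi, hi'⟩ := hne
    exact ⟨i, Finset.mem_filter.2 ⟨hi, hi'⟩⟩
  have hch : ∀ i, ∃ γ, F i ≠ 0 → F i ∈ LE w γ ∧ comp w γ (F i) ≠ 0 := by
    intro i
    by_cases h : F i = 0
    · exact ⟨0, fun h' => absurd h h'⟩
    · obtain ⟨γ, hγ⟩ := exists_top w h
      exact ⟨γ, fun _ => hγ⟩
  choose γ hγ using hch
  obtain ⟨i, hi, hmax⟩ := Finset.exists_max_image s' γ hs'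
  obtain ⟨hi1, hi2⟩ := Finset.mem_filter.1 hi
  refine ⟨γ i, ?_, i, hi1, (hγ i hi2).2⟩
  intro j hj
  by_cases h : F j = 0
  · rw [h]; exact zero_mem _
  · exact LE_mono w (hmax j (Finset.mem_filter.2 ⟨hj, h⟩)) (hγ j h).1

section Der

/-- derivation attached to an additive map. -/
noncomputable def derOf (μ : G →+ AddMonoidAlgebra κ G) :
    Derivation κ (AddMonoidAlgebra κ G) (AddMonoidAlgebra κ G) :=
  Derivation.mk'
    ((Finsupp.lsum κ (fun g => (LinearMap.mulRight κ (μ g)).comp (lsingle (R := κ) g))).comp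
      (coeffLinearEquiv κ).toLinearMap) (by
    intro a b
    induction a using AddMonoidAlgebra.induction_linear with
    | zero => simp
    | add f g hf hg => simp only [add_mul, map_add, hf, hg, add_smul, smul_add]; abel
    | single g r =>
      induction b using AddMonoidAlgebra.induction_linear with
      | zero => simp
      | add f g hf hg => simp only [mul_add, map_add, hf, hg, add_smul, smul_add]; abel
      | single h s =>
        simp only [single_mul_single, LinearMap.coe_comp, LinearEquiv.coe_coe,
          Function.comp_apply, coeffLinearEquiv_apply, coeff_single, Finsupp.lsum_single,
          lsingle_apply, LinearMap.mulRight_apply, map_add, smul_eq_mul]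
        rw [← single_mul_single]
        ring)

lemma derOf_single (μ : G →+ AddMonoidAlgebra κ G) (g : G) (r : κ) :
    derOf μ (single g r) = single g r * μ g := by
  simp [derOf]

variable {w}
/-- compatibility of `derOf` with the grading. -/
lemma derOf_mem {μ : G →+ AddMonoidAlgebra κ G} {δ : Γ} (hμ : ∀ g, μ g ∈ LE w δ) {γ : Γ}
    {f : AddMonoidAlgebra κ G} (hf : f ∈ LE w γ) : derOf μ f ∈ LE w (γ + δ) := by
  revert hf
  apply LE_induction w (p := fun f => derOf μ f ∈ LE w (γ + δ))
  · simp
  · intro a b ha hb; rw [map_add]; exact add_mem ha hb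
  · intro g r hg
    rw [derOf_single]
    exact mul_mem_LE w (single_mem_LE w r hg) (hμ g)

lemma comp_derOf {μ : G →+ AddMonoidAlgebra κ G} {δ : Γ} (hμ : ∀ g, μ g ∈ LE w δ) {γ : Γ}
    {f : AddMonoidAlgebra κ G} (hf : f ∈ LE w γ) :
    comp w (γ + δ) (derOf μ f) = derOf ((comp w δ).toAddMonoidHom.comp μ) (comp w γ f) := by
  revert hf
  apply LE_induction w (p := fun f => comp w (γ + δ) (derOf μ f) =
    derOf ((comp w δ).toAddMonoidHom.comp μ) (comp w γ f))
  · simp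
  · intro a b ha hb; simp only [map_add, ha, hb]
  · intro g r hg
    rw [derOf_single, comp_mul w (single_mem_LE w r hg) (hμ g)]
    rcases hg.lt_or_eq with h1 | h1
    · rw [comp_single_ne w h1.ne]; simp
    · rw [comp_single_eq w h1, derOf_single]; rfl

lemma iter_derOf {μ : G →+ AddMonoidAlgebra κ G} {δ : Γ} (hμ : ∀ g, μ g ∈ LE w δ) (n : ℕ) {γ : Γ}
    {f : AddMonoidAlgebra κ G} (hf : f ∈ LE w γ) :
    (derOf μ)^[n] f ∈ LE w (γ + n • δ) ∧
    comp w (γ + n • δ) ((derOf μ)^[n] f) =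
      (derOf ((comp w δ).toAddMonoidHom.comp μ))^[n] (comp w γ f) := by
  induction n with
  | zero => simpa using hf
  | succ n ih =>
    have e : γ + (n+1) • δ = (γ + n • δ) + δ := by rw [succ_nsmul]; abel
    rw [Function.iterate_succ_apply', Function.iterate_succ_apply', e]
    exact ⟨derOf_mem hμ ih.1, by rw [comp_derOf hμ ih.1, ih.2]⟩

end Der

/-- The additive map with values `F i` on the basis. -/
noncomputable def mulOf {n : ℕ} (F : Fin n → AddMonoidAlgebra κ (Fin n → ℤ)) :
    (Fin n → ℤ) →+ AddMonoidAlgebra κ (Fin n → ℤ) where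
  toFun g := ∑ i, g i • F i
  map_zero' := by simp
  map_add' := by intro a b; simp [add_smul, Finset.sum_add_distrib]

/-- Main statement: initial derivations. -/
lemma exists_initial {n : ℕ} (w : (Fin n → ℤ) →+ Γ) (F : Fin n → AddMonoidAlgebra κ (Fin n → ℤ))
    (hF : ∃ i, F i ≠ 0) :
    ∃ (δ : Γ) (D' : Derivation κ (AddMonoidAlgebra κ (Fin n → ℤ)) (AddMonoidAlgebra κ (Fin n → ℤ))),
      (∃ i, D' (single (Pi.single i 1) 1) ≠ 0) ∧
      ∀ (m : ℕ) (γ : Γ) (f : AddMonoidAlgebra κ (Fin n → ℤ)), f ∈ LE w γ →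
        (derOf (mulOf F))^[m] f ∈ LE w (γ + m • δ) ∧
        comp w (γ + m • δ) ((derOf (mulOf F))^[m] f) = D'^[m] (comp w γ f) := by
  obtain ⟨i0, hi0⟩ := hF
  obtain ⟨δ, h1, i, -, h2⟩ := exists_LE_finset w Finset.univ F
    ⟨i0, Finset.mem_univ _, hi0⟩
  have hμ : ∀ g, mulOf F g ∈ LE w δ := by
    intro g
    exact Submodule.sum_mem _ (fun i hi => Submodule.smul_of_tower_mem _ (g i) (h1 i hi))
  refine ⟨δ, derOf ((comp w δ).toAddMonoidHom.comp (mulOf F)), ⟨i, ?_⟩,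
    fun m γ f hf => iter_derOf hμ m hf⟩
  rw [derOf_single]
  have : mulOf F (Pi.single i 1) = F i := by
    classical
    simp [mulOf, Pi.single_apply]
  intro h
  have h3 : single (Pi.single i (1:ℤ)) (1:κ) * comp w δ (F i) = 0 := by
    rw [← this]; exact h
  apply h2
  have h4 := congrArg (fun x => single (-(Pi.single i (1:ℤ))) (1:κ) * x) h3
  simp only [← mul_assoc, single_mul_single, mul_zero, neg_add_cancel, mul_one] at h4
  rwa [← one_def, one_mul] at h4

lemma derOf_X {n : ℕ} (F : Fin n → AddMonoidAlgebra κ (Fin n → ℤ)) (i : Fin n) :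
    derOf (mulOf F) (single (Pi.single i 1) 1) = single (Pi.single i 1) 1 * F i := by
  classical
  rw [derOf_single]
  congr 1
  simp [mulOf, Pi.single_apply]

end Grade
end KR

set_option linter.unusedSectionVars false

namespace KR

section W
variable {κ L : Type*} [Field κ] [CommRing L] [Algebra κ L]

/-- homogenization evaluated at `(a,b)` -/
noncomputable def hom (a b : L) (K : ℕ) (f : Polynomial κ) : L :=
  ∑ k ∈ Finset.range (K+1), f.coeff k • (a^k * b^(K-k))

lemma hom_succ (a b : L) (K : ℕ) (μ : κ) (f : Polynomial κ) (hf : f.natDegree ≤ K) :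
    hom a b (K+1) ((Polynomial.X - Polynomial.C μ) * f) = (a - μ • b) * hom a b K f := by
  have h1 : hom a b (K+1) (Polynomial.X * f) = a * hom a b K f := by
    unfold hom
    rw [Finset.sum_range_succ', Finset.mul_sum]
    simp only [Polynomial.coeff_X_mul, Polynomial.coeff_X_mul_zero, zero_smul, add_zero]
    refine Finset.sum_congr rfl fun k hk => ?_
    rw [mul_smul_comm, Nat.add_sub_add_right, pow_succ]
    congr 1; ring
  have h2 : hom a b (K+1) (Polynomial.C μ * f) = (μ • b) * hom a b K f := by
    unfold hom
    rw [Finset.sum_range_succ, Finset.mul_sum]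
    simp only [Polynomial.coeff_C_mul]
    rw [Polynomial.coeff_eq_zero_of_natDegree_lt (show f.natDegree < K+1 by omega), mul_zero,
      zero_smul, add_zero]
    refine Finset.sum_congr rfl fun k hk => ?_
    have : K + 1 - k = (K - k) + 1 := by have := Finset.mem_range.1 hk; omega
    rw [mul_smul_comm, smul_mul_assoc, smul_smul, this, pow_succ, mul_comm]
    congr 1; ring
  have h3 : hom a b (K+1) ((Polynomial.X - Polynomial.C μ) * f) =
      hom a b (K+1) (Polynomial.X * f) - hom a b (K+1) (Polynomial.C μ * f) := by
    unfold hom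
    rw [← Finset.sum_sub_distrib]
    refine Finset.sum_congr rfl fun k hk => ?_
    rw [sub_mul, Polynomial.coeff_sub, sub_smul]
  rw [h3, h1, h2, sub_mul]

lemma hom_prod (a b : L) (S : Multiset κ) :
    hom a b S.card ((S.map (fun μ => Polynomial.X - Polynomial.C μ)).prod) =
      (S.map (fun μ => a - μ • b)).prod := by
  induction S using Multiset.induction_on with
  | empty => simp [hom]
  | cons μ S ih =>
    rw [Multiset.map_cons, Multiset.prod_cons, Multiset.map_cons, Multiset.prod_cons,
      Multiset.card_cons, hom_succ, ih]
    rw [Polynomial.natDegree_multiset_prod_X_sub_C_eq_card]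

lemma hom_factor [IsAlgClosed κ] (a b : L) (f : Polynomial κ) :
    hom a b f.natDegree f = f.leadingCoeff • (f.roots.map (fun μ => a - μ • b)).prod := by
  have hs := IsAlgClosed.splits f
  rw [← hom_prod, ← hs.natDegree_eq_card_roots]
  unfold hom
  rw [Finset.smul_sum]
  refine Finset.sum_congr rfl fun k hk => ?_
  have : f.coeff k = f.leadingCoeff *
      ((f.roots.map (fun μ => Polynomial.X - Polynomial.C μ)).prod).coeff k := by
    conv_lhs => rw [hs.eq_prod_roots]
    rw [Polynomial.coeff_C_mul]
  rw [this, mul_smul]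

/-- Factorisation of weighted homogeneous sums. -/
lemma lemW [IsAlgClosed κ] {ι : Type*} (S : Finset ι) (hS : S.Nonempty) (c : ι → κ)
    (hc : ∀ m ∈ S, c m ≠ 0) (e0 e1 : ι → ℕ) (hinj : Set.InjOn e0 S) {p q N : ℕ}
    (hpq : Nat.Coprime p q) (hp : 0 < p)
    (hN : ∀ m ∈ S, q * e0 m + p * e1 m = N) :
    ∃ (i j : ℕ) (c0 : κ) (T : Multiset κ), c0 ≠ 0 ∧ (∀ μ ∈ T, μ ≠ 0) ∧
      (∀ m ∈ S, i ≤ e0 m ∧ j ≤ e1 m) ∧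
      (∃ m ∈ S, e0 m = i ∧ e1 m = j + q * T.card) ∧ (∃ m ∈ S, e1 m = j ∧ e0 m = i + p * T.card) ∧
      ∀ u v : L, ∑ m ∈ S, c m • (u^(e0 m) * v^(e1 m)) =
        c0 • (u^i * v^j * (T.map (fun μ => u^p - μ • v^q)).prod) := by
  classical
  obtain ⟨m1, hm1, hmin⟩ := Finset.exists_min_image S e0 hS
  obtain ⟨m2, hm2, hmax⟩ := Finset.exists_max_image S e0 hS
  have hk : ∀ m ∈ S, ∃ k, e0 m = e0 m1 + p * k := by
    intro m hm
    have h1 := hN m hm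
    have h2 := hN m1 hm1
    have h3 := hmin m hm
    have h4 : p ∣ q * (e0 m - e0 m1) := by
      refine ⟨e1 m1 - e1 m, ?_⟩
      have : e1 m ≤ e1 m1 := by
        by_contra hlt
        have : p * e1 m1 < p * e1 m := Nat.mul_lt_mul_of_pos_left (not_le.1 hlt) hp
        have := Nat.mul_le_mul_left q h3
        omega
      zify [h3, this] at *
      linarith
    obtain ⟨k, hk⟩ := hpq.dvd_of_dvd_mul_left h4
    exact ⟨k, by omega⟩
  choose! k hk using hk
  set K := k m2
  have hkK : ∀ m ∈ S, k m ≤ K := by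
    intro m hm
    have := hmax m hm
    rw [hk m hm, hk m2 hm2] at this
    exact Nat.le_of_mul_le_mul_left (Nat.le_of_add_le_add_left this) hp
  have he1 : ∀ m ∈ S, e1 m = e1 m2 + q * (K - k m) := by
    intro m hm
    have h1 := hN m hm
    have h2 := hN m2 hm2
    rw [hk m hm] at h1
    rw [hk m2 hm2] at h2
    have h3 := hkK m hm
    apply Nat.eq_of_mul_eq_mul_left hp
    change q * (e0 m1 + p * K) + _ = _ at h2
    zify [h3] at *
    linarith
  have hkinj : Set.InjOn k S := by
    intro a ha b hb hab
    apply hinj ha hb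
    rw [hk a ha, hk b hb, hab]
  let f : Polynomial κ := ∑ m ∈ S, Polynomial.monomial (k m) (c m)
  have hfc : ∀ m ∈ S, f.coeff (k m) = c m := by
    intro m hm
    simp only [f, Polynomial.finsetSum_coeff, Polynomial.coeff_monomial]
    rw [Finset.sum_eq_single m]
    · simp
    · intro b hb hbm
      rw [if_neg]
      intro h; exact hbm (hkinj hb hm h)
    · intro h; exact absurd hm h
  have hfd : f.natDegree = K := by
    apply le_antisymm
    · apply Polynomial.natDegree_sum_le_of_forall_le
      intro m hm
      exact (Polynomial.natDegree_monomial_le _).trans (hkK m hm)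
    · apply Polynomial.le_natDegree_of_ne_zero
      rw [hfc m2 hm2]; exact hc _ hm2
  have hk1 : k m1 = 0 := by
    have := hk m1 hm1
    have : p * k m1 = 0 := by omega
    rcases Nat.mul_eq_zero.1 this with h | h
    · omega
    · exact h
  have hf0 : f ≠ 0 := by
    intro h
    have := hfc m2 hm2
    rw [h, Polynomial.coeff_zero] at this
    exact hc _ hm2 this.symm
  have hcard : f.roots.card = K := by
    rw [← hfd]; exact ((IsAlgClosed.splits f).natDegree_eq_card_roots).symm
  refine ⟨e0 m1, e1 m2, f.leadingCoeff, f.roots, Polynomial.leadingCoeff_ne_zero.2 hf0, ?_,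
    fun m hm => ⟨hmin m hm, by rw [he1 m hm]; omega⟩, ⟨m1, hm1, rfl, ?_⟩, ⟨m2, hm2, rfl, ?_⟩, ?_⟩
  · rintro μ hμ rfl
    have := (Polynomial.mem_roots hf0).1 hμ
    rw [Polynomial.IsRoot.def, ← Polynomial.coeff_zero_eq_eval_zero, ← hk1, hfc m1 hm1] at this
    exact hc _ hm1 this
  · rw [hcard, he1 m1 hm1, hk1, Nat.sub_zero]
  · rw [hcard]; exact hk m2 hm2
  · intro u v
    have h := hom_factor (u^p) (v^q) f
    have h2 : hom (u^p) (v^q) f.natDegree f =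
        ∑ m ∈ S, c m • ((u^p)^(k m) * (v^q)^(K - k m)) := by
      unfold hom
      rw [hfd]
      simp only [f, Polynomial.finsetSum_coeff, Polynomial.coeff_monomial, Finset.sum_smul]
      rw [Finset.sum_comm]
      refine Finset.sum_congr rfl fun m hm => ?_
      rw [Finset.sum_eq_single (k m)]
      · simp
      · intro b hb hbm
        rw [if_neg (Ne.symm hbm), zero_smul]
      · intro h
        exact absurd (Finset.mem_range.2 (Nat.lt_succ_of_le (hkK m hm))) h
    rw [← mul_smul_comm, ← h, h2, Finset.mul_sum]
    refine Finset.sum_congr rfl fun m hm => ?_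
    rw [mul_smul_comm]
    congr 1
    rw [he1 m hm, hk m hm, pow_add, pow_add, pow_mul, pow_mul]
    ring

end W
end KR

set_option linter.unusedSectionVars false

namespace KR
open AddMonoidAlgebra

section Transport
variable {κ Γ : Type*} [Field κ] [AddCommGroup Γ] [LinearOrder Γ] [IsOrderedAddMonoid Γ]

/-- Laurent polynomials -/
abbrev Lau (κ : Type*) [Field κ] (n : ℕ) := AddMonoidAlgebra κ (Fin n → ℤ)

/-- Laurent monomial -/
noncomputable def mon (κ : Type*) [Field κ] {n : ℕ} (g : Fin n → ℤ) : Lau κ n := single g 1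

lemma mon_add {n : ℕ} (g h : Fin n → ℤ) : mon κ (g + h) = mon κ g * mon κ h := by
  simp [mon, single_mul_single]

lemma mon_zero {n : ℕ} : mon κ (0 : Fin n → ℤ) = 1 := rfl

lemma mon_nsmul {n : ℕ} (a : ℕ) (g : Fin n → ℤ) : mon κ (a • g) = mon κ g ^ a := by
  induction a with
  | zero => rw [zero_smul, mon_zero, pow_zero]
  | succ a ih => rw [succ_nsmul, mon_add, ih, pow_succ]

lemma mon_ne_zero {n : ℕ} (g : Fin n → ℤ) : mon κ g ≠ 0 := by
  intro h
  have := congrArg (fun x => x.coeff g) h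
  simp [mon] at this

lemma mon_neg_mul {n : ℕ} (g : Fin n → ℤ) : mon κ (-g) * mon κ g = 1 := by
  rw [← mon_add, neg_add_cancel, mon_zero]

/-- variables -/
noncomputable def lx (κ : Type*) [Field κ] {n : ℕ} (i : Fin n) : Lau κ n := mon κ (Pi.single i 1)

lemma comp_mon (w : (Fin n → ℤ) →+ Γ) (g : Fin n → ℤ) : comp w (w g) (mon κ g) = mon κ g :=
  comp_single_eq w rfl 1

lemma mon_mem (w : (Fin n → ℤ) →+ Γ) (g : Fin n → ℤ) : mon κ g ∈ LE w (w g) :=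
  single_mem_LE w 1 le_rfl

instance (n : ℕ) : IsDomain (Lau κ n) := by
  have : NoZeroDivisors (Lau κ n) := inferInstance
  exact NoZeroDivisors.to_isDomain _

/-- logarithmic coefficients of a derivation -/
noncomputable def logF {n : ℕ} {T : Type*} [CommRing T] [Algebra κ T] (ι : T →ₐ[κ] Lau κ n)
    (tt : Fin n → T) (D : Derivation κ T T) (i : Fin n) : Lau κ n :=
  mon κ (-(Pi.single i 1)) * ι (D (tt i))

lemma derOf_tt {n : ℕ} {T : Type*} [CommRing T] [Algebra κ T] (ι : T →ₐ[κ] Lau κ n)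
    (tt : Fin n → T) (D : Derivation κ T T) (htt : ∀ i, ι (tt i) = lx κ i) (i : Fin n) :
    derOf (mulOf (logF ι tt D)) (ι (tt i)) = ι (D (tt i)) := by
  rw [htt, lx, mon, derOf_X, logF, ← mul_assoc]
  change mon κ _ * mon κ _ * _ = _
  rw [mul_comm (mon κ _), mon_neg_mul, one_mul]

lemma derOf_comm_adjoin {n : ℕ} {T : Type*} [CommRing T] [Algebra κ T] (ι : T →ₐ[κ] Lau κ n)
    (D : Derivation κ T T) (E : Derivation κ (Lau κ n) (Lau κ n)) (s : Set T)
    (h : ∀ a ∈ s, E (ι a) = ι (D a)) {b : T} (hb : b ∈ Algebra.adjoin κ s) :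
    E (ι b) = ι (D b) := by
  induction hb using Algebra.adjoin_induction with
  | mem x hx => exact h x hx
  | algebraMap r => rw [AlgHom.commutes, Derivation.map_algebraMap, Derivation.map_algebraMap, map_zero]
  | add x y _ _ hx hy => simp [hx, hy]
  | mul x y _ _ hx hy => simp [hx, hy]

lemma transport {n : ℕ} {T : Type*} [CommRing T] [Algebra κ T] (ι : T →ₐ[κ] Lau κ n)
    (hι : Function.Injective ι)
    (tt : Fin n → T) (D : Derivation κ T T) (hne : ∃ i, D (tt i) ≠ 0)
    (hcomm : ∀ b, derOf (mulOf (logF ι tt D)) (ι b) = ι (D b)) (w : (Fin n → ℤ) →+ Γ) :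
    ∃ (δ : Γ) (D' : Derivation κ (Lau κ n) (Lau κ n)), (∃ i, D' (lx κ i) ≠ 0) ∧
      ∀ (m : ℕ) (γ : Γ) (b : T), ι b ∈ LE w γ →
        ι (D^[m] b) ∈ LE w (γ + m • δ) ∧ comp w (γ + m • δ) (ι (D^[m] b)) = D'^[m] (comp w γ (ι b)) := by
  obtain ⟨i, hi⟩ := hne
  obtain ⟨δ, D', h1, h2⟩ := exists_initial w (logF ι tt D) ⟨i, by
    rw [logF]
    exact mul_ne_zero (mon_ne_zero _) (by rwa [Ne, map_eq_zero_iff ι hι])⟩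
  refine ⟨δ, D', h1, fun m γ b hb => ?_⟩
  have : ι (D^[m] b) = (derOf (mulOf (logF ι tt D)))^[m] (ι b) := by
    clear hb
    induction m with
    | zero => rfl
    | succ m ih => rw [Function.iterate_succ_apply', Function.iterate_succ_apply', ← ih, hcomm]
  rw [this]
  exact h2 m γ (ι b) hb

/-- the embedding of polynomials -/
noncomputable def lau (κ : Type*) [Field κ] (n : ℕ) : MvPolynomial (Fin n) κ →ₐ[κ] Lau κ n :=
  MvPolynomial.aeval (lx κ)

/-- exponent vector -/
def zexp {n : ℕ} (s : Fin n →₀ ℕ) : Fin n → ℤ := fun i => (s i : ℤ)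

lemma zexp_inj {n : ℕ} : Function.Injective (zexp (n := n)) := by
  intro s t h
  ext i
  have := congrFun h i
  simpa [zexp] using this

lemma prod_lx {n : ℕ} (s : Fin n →₀ ℕ) : (∏ i, lx κ i ^ s i) = mon κ (zexp s) := by
  classical
  have : zexp s = ∑ i, s i • (Pi.single i (1:ℤ) : Fin n → ℤ) := by
    ext j
    simp [zexp, Finset.sum_apply, Pi.single_apply]
  rw [this]
  have h : ∀ S : Finset (Fin n), ∏ i ∈ S, lx κ i ^ s i =
      mon κ (∑ i ∈ S, s i • (Pi.single i (1:ℤ) : Fin n → ℤ)) := by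
    intro S
    induction S using Finset.induction_on with
    | empty => simp [mon_zero]
    | insert a S ha ih => rw [Finset.prod_insert ha, Finset.sum_insert ha, mon_add, ih, mon_nsmul]; rfl
  exact h _

lemma lau_eq_sum {n : ℕ} (f : MvPolynomial (Fin n) κ) :
    lau κ n f = ∑ s ∈ f.support, f.coeff s • mon κ (zexp s) := by
  rw [lau, MvPolynomial.aeval_def, MvPolynomial.eval₂_eq']
  refine Finset.sum_congr rfl fun s _ => ?_
  rw [prod_lx, Algebra.smul_def]

lemma lau_coeff {n : ℕ} (f : MvPolynomial (Fin n) κ) (s : Fin n →₀ ℕ) :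
    (lau κ n f).coeff (zexp s) = f.coeff s := by
  classical
  rw [lau_eq_sum, coeff_sum, Finsupp.finsetSum_apply]
  simp only [coeff_smul, Finsupp.smul_apply, mon, coeff_single, Finsupp.single_apply,
    zexp_inj.eq_iff, smul_eq_mul, mul_ite, mul_one, mul_zero]
  rw [Finset.sum_ite_eq']
  split_ifs with h
  · rfl
  · exact (MvPolynomial.notMem_support_iff.1 h).symm

lemma lau_injective (κ : Type*) [Field κ] (n : ℕ) : Function.Injective (lau κ n) := by
  rw [injective_iff_map_eq_zero]
  intro f hf
  ext s
  rw [← lau_coeff, hf]; simp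

lemma lau_mem_LE {n : ℕ} (w : (Fin n → ℤ) →+ Γ) (f : MvPolynomial (Fin n) κ) (γ : Γ) :
    lau κ n f ∈ LE w γ ↔ ∀ s ∈ f.support, w (zexp s) ≤ γ := by
  constructor
  · intro h s hs
    apply h
    rw [lau_coeff]; exact MvPolynomial.mem_support_iff.1 hs
  · intro h
    rw [lau_eq_sum]
    exact Submodule.sum_mem _ fun s hs => Submodule.smul_mem _ _ (single_mem_LE w 1 (h s hs))

open Classical in
lemma comp_lau {n : ℕ} (w : (Fin n → ℤ) →+ Γ) (f : MvPolynomial (Fin n) κ) (γ : Γ) :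
    comp w γ (lau κ n f) =
      ∑ s ∈ f.support.filter (fun s => w (zexp s) = γ), f.coeff s • mon κ (zexp s) := by
  rw [lau_eq_sum, map_sum, Finset.sum_filter]
  refine Finset.sum_congr rfl fun s _ => ?_
  rw [map_smul, mon, comp_single]
  split_ifs <;> simp

lemma transport_poly {n : ℕ} (D : Derivation κ (MvPolynomial (Fin n) κ) (MvPolynomial (Fin n) κ))
    (hne : D ≠ 0) (w : (Fin n → ℤ) →+ Γ) :
    ∃ (δ : Γ) (D' : Derivation κ (Lau κ n) (Lau κ n)), (∃ i, D' (lx κ i) ≠ 0) ∧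
      ∀ (m : ℕ) (γ : Γ) (b : MvPolynomial (Fin n) κ), lau κ n b ∈ LE w γ →
        lau κ n (D^[m] b) ∈ LE w (γ + m • δ) ∧
        comp w (γ + m • δ) (lau κ n (D^[m] b)) = D'^[m] (comp w γ (lau κ n b)) := by
  apply transport (lau κ n) (lau_injective κ n) MvPolynomial.X D
  · by_contra! h
    apply hne
    apply MvPolynomial.derivation_ext
    simpa using h
  · intro b
    apply derOf_comm_adjoin (s := Set.range MvPolynomial.X)
    · rintro _ ⟨i, rfl⟩
      exact derOf_tt _ _ _ (by simp [lau]) i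
    · rw [MvPolynomial.adjoin_range_X]; trivial

end Transport
end KR

set_option linter.unusedSectionVars false

namespace KR
open MvPolynomial

section Jac
variable {R : Type*} [CommRing R]

/-- the jacobian derivation -/
noncomputable def jacD (f : MvPolynomial (Fin 2) R) :
    Derivation R (MvPolynomial (Fin 2) R) (MvPolynomial (Fin 2) R) :=
  pderiv 0 f • pderiv 1 - pderiv 1 f • pderiv 0

lemma jacD_apply (f g : MvPolynomial (Fin 2) R) :
    jacD f g = pderiv 0 f * pderiv 1 g - pderiv 1 f * pderiv 0 g := rfl

lemma jacD_self (f : MvPolynomial (Fin 2) R) : jacD f f = 0 := by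
  rw [jacD_apply]; ring

lemma jacD_X0 (f : MvPolynomial (Fin 2) R) : jacD f (X 0) = - pderiv 1 f := by
  rw [jacD_apply, pderiv_X_self, pderiv_X_of_ne (by decide)]; ring

lemma jacD_X1 (f : MvPolynomial (Fin 2) R) : jacD f (X 1) = pderiv 0 f := by
  rw [jacD_apply, pderiv_X_self, pderiv_X_of_ne (by decide)]; ring

/-- local nilpotence -/
def LNJ (f : MvPolynomial (Fin 2) R) : Prop := ∀ i, Nil (jacD f) (X i)

lemma LNJ.nil {f : MvPolynomial (Fin 2) R} (h : LNJ f) (g : MvPolynomial (Fin 2) R) :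
    Nil (jacD f) g := by
  rw [← mem_nilSub]
  have : (⊤ : Subalgebra R (MvPolynomial (Fin 2) R)) ≤ nilSub (jacD f) := by
    rw [← MvPolynomial.adjoin_range_X]
    apply Algebra.adjoin_le
    rintro _ ⟨i, rfl⟩
    exact h i
  exact this trivial

lemma pderiv_eq_zero_iff [IsDomain R] [CharZero R] {f : MvPolynomial (Fin 2) R} {i : Fin 2} :
    pderiv i f = 0 ↔ ∀ s ∈ f.support, s i = 0 := by
  constructor
  · intro h s hs
    by_contra h0
    have h1 := coeff_pderiv (i := i) f (s - Finsupp.single i 1)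
    rw [h, coeff_zero] at h1
    have h2 : s - Finsupp.single i 1 + Finsupp.single i 1 = s := by
      ext j
      by_cases hj : i = j
      · subst hj; simp; omega
      · simp [hj]
    rw [h2] at h1
    have h3 := mem_support_iff.1 hs
    rcases mul_eq_zero.1 h1.symm with h4 | h4
    · exact h3 h4
    · exact Nat.cast_add_one_ne_zero _ h4
  · intro h
    apply pderiv_eq_zero_of_notMem_vars
    intro hi
    obtain ⟨s, hs, hs'⟩ := (mem_vars_iff_mem_support i).1 hi
    exact (Finsupp.mem_support_iff.1 hs') (h s hs)

variable {S : Type*} [CommRing S] (φ : R →+* S)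

lemma jacD_map (f g : MvPolynomial (Fin 2) R) :
    jacD (map φ f) (map φ g) = map φ (jacD f g) := by
  simp [jacD_apply, pderiv_map]

lemma jacD_map_iter (f g : MvPolynomial (Fin 2) R) (n : ℕ) :
    (jacD (map φ f))^[n] (map φ g) = map φ ((jacD f)^[n] g) := by
  induction n with
  | zero => rfl
  | succ n ih => rw [Function.iterate_succ_apply', Function.iterate_succ_apply', ih, jacD_map]

lemma LNJ.map {f : MvPolynomial (Fin 2) R} (h : LNJ f) : LNJ (MvPolynomial.map φ f) := by
  intro i
  obtain ⟨n, hn⟩ := h i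
  refine ⟨n, ?_⟩
  rw [← map_X φ i, jacD_map_iter, hn, map_zero]

end Jac

section LemJ
variable {κ : Type*} [Field κ]

/-- `P = c (X0 - μ X1^s)^n +` lower terms. -/
def Form (P : MvPolynomial (Fin 2) κ) (n s : ℕ) (c μ : κ) : Prop :=
  ∀ e ∈ (P - C c * (X 0 - C μ * X 1 ^ s)^n).support, s * e 0 + e 1 < s * n

/-- swap of variables -/
noncomputable def swp (R : Type*) [CommRing R] :
    MvPolynomial (Fin 2) R ≃ₐ[R] MvPolynomial (Fin 2) R :=
  renameEquiv R (Equiv.swap 0 1)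

/-- the weight -/
def wt2 (a b : ℕ) : (Fin 2 → ℤ) →+ ℤ where
  toFun g := a * g 0 + b * g 1
  map_zero' := by simp
  map_add' := by intro x y; simp; ring

lemma wt2_zexp (a b : ℕ) (s : Fin 2 →₀ ℕ) : wt2 a b (zexp s) = ((a * s 0 + b * s 1 : ℕ) : ℤ) := by
  simp [wt2, zexp]

lemma mon_two (s : Fin 2 →₀ ℕ) : mon κ (zexp s) = lx κ 0 ^ s 0 * lx κ 1 ^ s 1 := by
  rw [← prod_lx]; simp [Fin.prod_univ_two]

lemma exists_deg_mon (P : MvPolynomial (Fin 2) κ) (i : Fin 2) (h : 1 ≤ degreeOf i P) :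
    ∃ s ∈ P.support, s i = degreeOf i P := by
  have hne : P.support.Nonempty := by
    rw [Finset.nonempty_iff_ne_empty]
    intro h0
    rw [support_eq_empty.1 h0] at h
    simp at h
  obtain ⟨s, hs, hs'⟩ := Finset.exists_mem_eq_sup P.support hne (fun m => m i)
  exact ⟨s, hs, by rw [degreeOf_eq_sup]; exact hs'.symm⟩

lemma lemJ_closed [IsAlgClosed κ] [CharZero κ] (P : MvPolynomial (Fin 2) κ) (hP : LNJ P)
    (hn : 1 ≤ degreeOf 0 P) (hm : 1 ≤ degreeOf 1 P) :
    ∃ (s : ℕ) (c μ : κ), 1 ≤ s ∧ c ≠ 0 ∧ μ ≠ 0 ∧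
      ((Form P (degreeOf 0 P) s c μ ∧ degreeOf 1 P = s * degreeOf 0 P) ∨
        (2 ≤ s ∧ Form (swp κ P) (degreeOf 1 P) s c μ ∧ degreeOf 0 P = s * degreeOf 1 P)) := by
  classical
  set n := degreeOf 0 P with hndef
  set m := degreeOf 1 P with hmdef
  obtain ⟨s0, hs0, hs0n⟩ := exists_deg_mon P 0 hn
  obtain ⟨s1, hs1, hs1m⟩ := exists_deg_mon P 1 hm
  rw [← hndef] at hs0n
  rw [← hmdef] at hs1m
  have hle0 : ∀ s ∈ P.support, s 0 ≤ n := fun s hs => monomial_le_degreeOf 0 hs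
  have hle1 : ∀ s ∈ P.support, s 1 ≤ m := fun s hs => monomial_le_degreeOf 1 hs
  have hP0 : P ≠ 0 := by rintro rfl; simp at hs0
  have hD : jacD P ≠ 0 := by
    intro h
    have h1 : pderiv 0 P = 0 := by rw [← jacD_X1, h]; rfl
    have := pderiv_eq_zero_iff.1 h1 s0 hs0
    omega
  let w := wt2 m n
  obtain ⟨δ, D', hD', htr⟩ := transport_poly (jacD P) hD w
  have hnil : ∀ i, Nil D' (lx κ i) := by
    intro i
    obtain ⟨N, hN⟩ := hP i
    have := (htr N (w (Pi.single i 1)) (X i) (by simp only [lau, aeval_X]; exact mon_mem w _)).2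
    rw [hN] at this
    refine ⟨N, ?_⟩
    simp only [lau, aeval_X] at this
    rw [lx, comp_mon] at this
    rw [lx, ← this]; simp
  obtain ⟨γ, hγ, hγ0⟩ := exists_top w (f := lau κ 2 P)
    (by rwa [Ne, map_eq_zero_iff _ (lau_injective κ 2)])
  have hker : D' (comp w γ (lau κ 2 P)) = 0 := by
    have := (htr 1 γ P hγ).2
    rw [Function.iterate_one, jacD_self, map_zero, map_zero] at this
    exact this.symm
  rw [comp_lau] at hγ0 hker
  set S := P.support.filter (fun s => w (zexp s) = γ) with hSdef
  have hSne : S.Nonempty := by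
    rw [Finset.nonempty_iff_ne_empty]; intro h; rw [h] at hγ0; simp at hγ0
  have hγle := (lau_mem_LE w P γ).1 hγ
  obtain ⟨N, rfl⟩ : ∃ N : ℕ, γ = N := by
    obtain ⟨s, hs⟩ := hSne
    have := (Finset.mem_filter.1 hs).2
    exact ⟨_, by rw [← this]; exact wt2_zexp m n s⟩
  have hle : ∀ s ∈ P.support, m * s 0 + n * s 1 ≤ N := by
    intro s hs
    have := hγle s hs
    rw [wt2_zexp] at this
    exact_mod_cast this
  have hSmem : ∀ s, s ∈ S ↔ s ∈ P.support ∧ m * s 0 + n * s 1 = N := by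
    intro s
    rw [hSdef, Finset.mem_filter, wt2_zexp]
    norm_cast
  have hNge : m * n ≤ N := by
    have := hle s0 hs0
    rw [hs0n] at this
    omega
  -- reduced exponents
  obtain ⟨g, p, q, hg, hpq, hnp, hmq⟩ : ∃ g p q, 0 < g ∧ Nat.Coprime p q ∧ n = g * p ∧ m = g * q := by
    refine ⟨Nat.gcd n m, n / Nat.gcd n m, m / Nat.gcd n m, Nat.gcd_pos_of_pos_left _ hn,
      Nat.coprime_div_gcd_div_gcd (Nat.gcd_pos_of_pos_left _ hn),
      (Nat.mul_div_cancel' (Nat.gcd_dvd_left _ _)).symm,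
      (Nat.mul_div_cancel' (Nat.gcd_dvd_right _ _)).symm⟩
  have hp0 : 0 < p := Nat.pos_of_ne_zero (by rintro rfl; omega)
  have hq0 : 0 < q := Nat.pos_of_ne_zero (by rintro rfl; omega)
  have hSN : ∀ s ∈ S, q * s 0 + p * s 1 = N / g := by
    intro s hs
    have h1 := ((hSmem s).1 hs).2
    rw [← h1, hnp, hmq]
    rw [show g * q * s 0 + g * p * s 1 = g * (q * s 0 + p * s 1) by ring, Nat.mul_div_cancel_left _ hg]
  have hinj : Set.InjOn (fun s : Fin 2 →₀ ℕ => s 0) S := by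
    intro a ha b hb hab
    have h1 := hSN a ha
    have h2 := hSN b hb
    simp only at hab
    rw [hab] at h1
    have h3 : a 1 = b 1 := Nat.eq_of_mul_eq_mul_left hp0 (by omega)
    ext i
    fin_cases i
    · exact hab
    · exact h3
  obtain ⟨i, j, c0, T, hc0, hT0, hij, ⟨t0, ht0, ht0i, ht0j⟩, ⟨t1, ht1, ht1j, ht1i⟩, hfac⟩ :=
    lemW (L := Lau κ 2) S hSne (fun s => P.coeff s)
    (fun s hs => mem_support_iff.1 ((hSmem s).1 hs).1) (fun s => s 0) (fun s => s 1) hinj hpq hp0 hSN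
  have hsum : ∑ s ∈ S, P.coeff s • mon κ (zexp s) = c0 • (lx κ 0 ^ i * lx κ 1 ^ j *
      (T.map (fun μ => lx κ 0 ^ p - μ • lx κ 1 ^ q)).prod) := by
    rw [← hfac]
    exact Finset.sum_congr rfl fun s _ => by rw [mon_two]
  have hx0 : lx κ (0 : Fin 2) ≠ 0 := mon_ne_zero _
  have hx1 : lx κ (1 : Fin 2) ≠ 0 := mon_ne_zero _
  have hnot : ¬ (D' (lx κ 0) = 0 ∧ D' (lx κ 1) = 0) := by
    rintro ⟨h0, h1⟩
    obtain ⟨i, hi⟩ := hD'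
    fin_cases i
    · exact hi h0
    · exact hi h1
  rw [hsum] at hker hγ0
  set Q := (T.map (fun μ => lx κ (0 : Fin 2) ^ p - μ • lx κ 1 ^ q)).prod with hQ
  have hcharL : CharZero (Lau κ 2) := charZero_of_injective_algebraMap
    (FaithfulSMul.algebraMap_injective κ (Lau κ 2))
  have hsm : ∀ (μ : κ) (a : Lau κ 2), Nil D' a → Nil D' (μ • a) := by
    intro μ a ha
    obtain ⟨N, hN⟩ := ha
    exact ⟨N, by rw [iter_smul, hN, smul_zero]⟩
  have hfnil : ∀ μ : κ, Nil D' (lx κ 0 ^ p - μ • lx κ 1 ^ q) := fun μ =>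
    ((hnil 0).pow D' p).sub D' (hsm _ _ ((hnil 1).pow D' q))
  have hprodnil : ∀ T : Multiset κ,
      Nil D' ((T.map (fun μ => lx κ (0 : Fin 2) ^ p - μ • lx κ 1 ^ q)).prod) := by
    intro T
    induction T using Multiset.induction_on with
    | empty => exact Nil.of_ker D' (by simp)
    | cons a T ih => rw [Multiset.map_cons, Multiset.prod_cons]; exact (hfnil a).mul D' ih
  have hne' : lx κ 0 ^ i * lx κ 1 ^ j * Q ≠ 0 := fun h => hγ0 (by rw [h, smul_zero])
  have hker' : D' (lx κ 0 ^ i * lx κ 1 ^ j * Q) = 0 := by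
    rw [Derivation.map_smul] at hker
    exact (smul_eq_zero.1 hker).resolve_left hc0
  obtain ⟨hk1, hkQ⟩ := ker_of_mul D' (((hnil 0).pow D' i).mul D' ((hnil 1).pow D' j))
    (hprodnil T) hker' hne'
  obtain ⟨hk2, hk3⟩ := ker_of_mul D' ((hnil 0).pow D' i) ((hnil 1).pow D' j) hk1
    (left_ne_zero_of_mul hne')
  have hNeq : N = m * n := by
    by_contra hN
    have hlt : m * n < N := lt_of_le_of_ne hNge (Ne.symm hN)
    have hi1 : i ≠ 0 := by
      intro hi
      rw [hi] at ht0i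
      have h1 := ((hSmem t0).1 ht0)
      have h2 := hle1 t0 h1.1
      have h3 := Nat.mul_le_mul_left n h2
      have h4 := h1.2
      rw [ht0i, mul_comm m n] at *
      omega
    have hj1 : j ≠ 0 := by
      intro hj
      rw [hj] at ht1j
      have h1 := ((hSmem t1).1 ht1)
      have h2 := hle0 t1 h1.1
      have h3 := Nat.mul_le_mul_left m h2
      have h4 := h1.2
      rw [ht1j] at h4
      omega
    exact hnot ⟨ker_of_pow D' (hnil 0) hi1 hk2, ker_of_pow D' (hnil 1) hj1 hk3⟩
  have hs0S : s0 ∈ S ∧ s0 1 = 0 := by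
    have h1 := hle s0 hs0
    rw [hs0n, hNeq] at h1
    have h2 : n * s0 1 = 0 := by omega
    have h3 : s0 1 = 0 := (Nat.mul_eq_zero.1 h2).resolve_left (by omega)
    exact ⟨(hSmem _).2 ⟨hs0, by rw [hs0n, h3, hNeq]; omega⟩, h3⟩
  have hs1S : s1 ∈ S ∧ s1 0 = 0 := by
    have h1 := hle s1 hs1
    rw [hs1m, hNeq, mul_comm n m] at h1
    have h2 : m * s1 0 = 0 := by omega
    have h3 : s1 0 = 0 := (Nat.mul_eq_zero.1 h2).resolve_left (by omega)
    exact ⟨(hSmem _).2 ⟨hs1, by rw [hs1m, h3, hNeq, mul_comm n m]; omega⟩, h3⟩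
  have hi0 : i = 0 := by have := (hij s1 hs1S.1).1; have := hs1S.2; omega
  have hj0 : j = 0 := by have := (hij s0 hs0S.1).2; have := hs0S.2; omega
  subst hi0 hj0
  have hnT : n = p * T.card := by
    have h1 := ((hSmem t1).1 ht1).2
    rw [ht1j, ht1i, hNeq] at h1
    exact Nat.eq_of_mul_eq_mul_left hm (by linarith)
  have hmT : m = q * T.card := by
    have h1 := ((hSmem t0).1 ht0).2
    rw [ht0j, ht0i, hNeq, mul_comm m n] at h1
    exact Nat.eq_of_mul_eq_mul_left hn (by linarith)
  have hTk : ∀ μ ∈ T, D' (lx κ 0 ^ p - μ • lx κ 1 ^ q) = 0 := by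
    intro μ hμ
    obtain ⟨T', hT'⟩ := Multiset.exists_cons_of_mem hμ
    have hQ0 : Q ≠ 0 := right_ne_zero_of_mul hne'
    rw [hT', Multiset.map_cons, Multiset.prod_cons] at hQ
    rw [hT', Multiset.map_cons, Multiset.prod_cons] at hkQ
    have := hQ ▸ hQ0
    exact (ker_of_mul D' (hfnil μ) (hprodnil T') hkQ this).1
  have hTne : T ≠ 0 := by
    rintro rfl
    simp at hnT; omega
  obtain ⟨μ, hμ⟩ := Multiset.exists_mem_of_ne_zero hTne
  have hμ0 := hT0 μ hμ
  have hTall : ∀ ν ∈ T, ν = μ := by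
    intro ν hν
    by_contra hne
    have h1 := hTk μ hμ
    have h2 := hTk ν hν
    rw [map_sub, Derivation.map_smul] at h1 h2
    have h3 : (ν - μ) • D' (lx κ 1 ^ q) = 0 := by
      rw [sub_smul]; linear_combination h1 - h2
    have h4 := (smul_eq_zero.1 h3).resolve_left (sub_ne_zero.2 hne)
    rw [h4, smul_zero, sub_zero] at h1
    exact hnot ⟨ker_of_pow D' (hnil 0) hp0.ne' h1, ker_of_pow D' (hnil 1) hq0.ne' h4⟩
  have hTrep : T = Multiset.replicate T.card μ := Multiset.eq_replicate_card.2 hTall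
  have hpq1 : p = 1 ∨ q = 1 := by
    by_contra! hcon
    apply hnot
    apply mason D' (hnil 0) (hnil 1) (α := 1) (β := algebraMap κ _ (-μ))
      (γ := lx κ 0 ^ p - μ • lx κ 1 ^ q) (p := p) (q := q) (by simp)
      (Derivation.map_algebraMap _ _) (hTk μ hμ) one_ne_zero
    · rw [Ne, map_eq_zero_iff _ (FaithfulSMul.algebraMap_injective κ (Lau κ 2))]; simpa using hμ0
    · intro h0
      have : Q ≠ 0 := right_ne_zero_of_mul hne'
      apply this
      rw [hQ]
      exact Multiset.prod_eq_zero (Multiset.mem_map.2 ⟨μ, hμ, h0⟩)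
    · omega
    · omega
    · rw [← Algebra.smul_def, neg_smul]; ring
  have hQ' : Q = (lx κ 0 ^ p - μ • lx κ 1 ^ q) ^ T.card := by
    rw [hQ]; conv_lhs => rw [hTrep]
    rw [Multiset.map_replicate, Multiset.prod_replicate]
  -- remainder
  have hrem : ∀ e ∈ (P - C c0 * (X 0 ^ p - C μ * X 1 ^ q)^T.card).support,
      m * e 0 + n * e 1 < m * n := by
    have h1 : lau κ 2 (C c0 * (X 0 ^ p - C μ * X 1 ^ q)^T.card) = comp w (N : ℤ) (lau κ 2 P) := by
      rw [comp_lau, ← hSdef, hsum, hQ']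
      simp only [pow_zero, one_mul]
      simp [lau, Algebra.smul_def, MvPolynomial.algebraMap_eq]
    intro e he
    have h2 := lau_coeff (P - C c0 * (X 0 ^ p - C μ * X 1 ^ q)^T.card) e
    rw [map_sub, h1, AddMonoidAlgebra.coeff_sub, Finsupp.sub_apply, coeff_comp] at h2
    have h3 := mem_support_iff.1 he
    rw [← h2] at h3
    rw [wt2_zexp] at h3
    by_cases h4 : m * e 0 + n * e 1 = N
    · rw [if_pos (by exact_mod_cast h4)] at h3
      simp at h3
    · rw [if_neg (by exact_mod_cast h4), sub_zero, lau_coeff] at h3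
      have := hle e (mem_support_iff.2 h3)
      omega
  rcases hpq1 with rfl | rfl
  · refine ⟨q, c0, μ, hq0, hc0, hμ0, Or.inl ⟨?_, by rw [hnT, hmT]; ring⟩⟩
    intro e he
    rw [hnT, one_mul, ← pow_one (X 0)] at he
    have h1 := hrem e he
    rw [hnT, hmT] at h1
    rw [hnT]
    have : T.card * (q * e 0 + e 1) < T.card * (q * (1 * T.card)) := by linarith
    exact lt_of_mul_lt_mul_left this (Nat.zero_le _)
  · rcases Nat.lt_or_ge p 2 with hp2 | hp2
    · have : p = 1 := by omega
      subst this
      refine ⟨1, c0, μ, le_rfl, hc0, hμ0, Or.inl ⟨?_, by rw [hnT, hmT]; ring⟩⟩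
      intro e he
      rw [hnT, one_mul, ← pow_one (X 0)] at he
      have h1 := hrem e he
      rw [hnT, hmT] at h1
      rw [hnT]
      have : T.card * (1 * e 0 + e 1) < T.card * (1 * (1 * T.card)) := by linarith
      exact lt_of_mul_lt_mul_left this (Nat.zero_le _)
    · refine ⟨p, c0 * (-μ)^T.card, μ⁻¹, by omega, mul_ne_zero hc0 (pow_ne_zero _ (neg_ne_zero.2 hμ0)),
        inv_ne_zero hμ0, Or.inr ⟨hp2, ?_, by rw [hnT, hmT]; ring⟩⟩
      intro e he
      rw [hmT, one_mul] at he
      have heq : swp κ P - C (c0 * (-μ)^T.card) * (X 0 - C μ⁻¹ * X 1 ^ p)^T.card =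
          rename (Equiv.swap 0 1) (P - C c0 * (X 0 ^ p - C μ * X 1 ^ 1)^T.card) := by
        simp only [swp, renameEquiv_apply, map_sub, map_mul, map_pow, rename_C, rename_X,
          Equiv.swap_apply_left, Equiv.swap_apply_right, C_mul, C_pow, pow_one]
        rw [mul_assoc, ← mul_pow, mul_sub, ← mul_assoc, ← C_mul, neg_mul, mul_inv_cancel₀ hμ0]
        simp only [map_neg, map_one]
        congr 3
        ring
      rw [heq] at he
      have he2 := support_rename_of_injective (Equiv.swap (0 : Fin 2) 1).injective
        (p := P - C c0 * (X 0 ^ p - C μ * X 1 ^ 1)^T.card)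
      rw [he2] at he
      obtain ⟨e', he', rfl⟩ := Finset.mem_image.1 he
      have h1 := hrem e' he'
      have ha : Finsupp.mapDomain (Equiv.swap (0 : Fin 2) 1) e' 0 = e' 1 := by
        have := Finsupp.mapDomain_apply (Equiv.swap (0 : Fin 2) 1).injective e' 1
        simpa using this
      have hb : Finsupp.mapDomain (Equiv.swap (0 : Fin 2) 1) e' 1 = e' 0 := by
        have := Finsupp.mapDomain_apply (Equiv.swap (0 : Fin 2) 1).injective e' 0
        simpa using this
      rw [ha, hb, hmT]
      rw [hnT, hmT] at h1
      have : T.card * (p * e' 1 + e' 0) < T.card * (p * (1 * T.card)) := by linarith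
      exact lt_of_mul_lt_mul_left this (Nat.zero_le _)

lemma coeff_pow_form (n s : ℕ) (μ : κ) (hs : 1 ≤ s) (e : Fin 2 →₀ ℕ) (k : ℕ) (hk : k ≤ n)
    (he0 : e 0 = k) (he1 : e 1 = s * (n - k)) :
    coeff e ((X 0 - C μ * X 1 ^ s : MvPolynomial (Fin 2) κ)^n) = (-μ)^(n-k) * (n.choose k : κ) := by
  classical
  rw [sub_eq_add_neg, add_pow, coeff_sum]
  have hterm : ∀ j, (X 0 ^ j * (-(C μ * X 1 ^ s)) ^ (n-j) * (n.choose j : MvPolynomial (Fin 2) κ)) =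
      monomial (Finsupp.single 0 j + Finsupp.single 1 (s * (n-j))) ((-μ)^(n-j) * (n.choose j : κ)) := by
    intro j
    rw [← neg_mul, ← C_neg, mul_pow, ← C_pow, ← pow_mul]
    rw [show (n.choose j : MvPolynomial (Fin 2) κ) = C (n.choose j : κ) by simp]
    rw [X_pow_eq_monomial, X_pow_eq_monomial, C_apply, C_apply, monomial_mul, monomial_mul,
      monomial_mul]
    congr 1
    · simp
    · ring
  simp only [hterm, coeff_monomial]
  rw [Finset.sum_eq_single k]
  · rw [if_pos]
    ext i
    fin_cases i
    · simp [he0]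
    · simp [he1]
  · intro j _ hjk
    rw [if_neg]
    rintro rfl
    apply hjk
    rw [← he0]; simp
  · intro h; exact absurd (Finset.mem_range.2 (by omega)) h

lemma form_coeff {P : MvPolynomial (Fin 2) κ} {n s : ℕ} {c μ : κ} (h : Form P n s c μ)
    (hs : 1 ≤ s) (e : Fin 2 →₀ ℕ) (k : ℕ) (hk : k ≤ n)
    (he0 : e 0 = k) (he1 : e 1 = s * (n - k)) :
    coeff e P = c * ((-μ)^(n-k) * (n.choose k : κ)) := by
  have h1 : coeff e (P - C c * (X 0 - C μ * X 1 ^ s)^n) = 0 := by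
    by_contra h0
    have := h e (mem_support_iff.2 h0)
    rw [he0, he1, ← mul_add] at this
    rw [Nat.add_sub_cancel' hk] at this
    exact lt_irrefl _ this
  rw [coeff_sub, coeff_C_mul, coeff_pow_form n s μ hs e k hk he0 he1, sub_eq_zero] at h1
  exact h1

lemma form_descend {K : Type*} [Field K] [CharZero K] (φ : K →+* κ) {P : MvPolynomial (Fin 2) K}
    {n s : ℕ} {c μ : κ} (h : Form (map φ P) n s c μ) (hs : 1 ≤ s) (hn : 1 ≤ n) (hc : c ≠ 0)
    (hμ : μ ≠ 0) : ∃ c' μ' : K, c' ≠ 0 ∧ μ' ≠ 0 ∧ Form P n s c' μ' := by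
  have hinj : Function.Injective φ := φ.injective
  have h1 := form_coeff h hs (Finsupp.single 0 n) n le_rfl (by simp) (by simp)
  have h2 := form_coeff h hs (Finsupp.single 0 (n-1) + Finsupp.single 1 s) (n-1) (by omega)
    (by simp) (by simp; rw [show n - (n-1) = 1 by omega, mul_one])
  rw [coeff_map] at h1 h2
  simp only [Nat.sub_self, pow_zero, Nat.choose_self, Nat.cast_one, mul_one] at h1
  rw [show n - (n-1) = 1 by omega, pow_one, Nat.choose_symm (by omega), Nat.choose_one_right] at h2
  set a := coeff (Finsupp.single 0 n) P
  set b := coeff (Finsupp.single 0 (n-1) + Finsupp.single 1 s) P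
  have ha : a ≠ 0 := by intro h; rw [h, map_zero] at h1; exact hc h1.symm
  have hnK : (n : K) ≠ 0 := by exact_mod_cast (by omega : n ≠ 0)
  have hnk : (n : κ) ≠ 0 := by rw [← map_natCast φ, Ne, map_eq_zero]; exact hnK
  have hμ' : φ (-b / (a * n)) = μ := by
    rw [map_div₀, map_neg, map_mul, h1, h2, map_natCast]
    field_simp
  refine ⟨a, -b / (a * n), ha, ?_, ?_⟩
  · intro h0; rw [h0, map_zero] at hμ'; exact hμ hμ'.symm
  · intro e he
    apply h e
    rw [mem_support_iff] at he ⊢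
    have : map φ (P - C a * (X 0 - C (-b / (a * n)) * X 1 ^ s)^n) =
        map φ P - C c * (X 0 - C μ * X 1 ^ s)^n := by
      simp only [map_sub, map_mul, map_pow, map_C, map_X, hμ', h1]
    rw [← this, coeff_map]
    exact (map_ne_zero φ).2 he

lemma swp_map {R S : Type*} [CommRing R] [CommRing S] (φ : R →+* S) (P : MvPolynomial (Fin 2) R) :
    swp S (map φ P) = map φ (swp R P) := by
  simp only [swp, renameEquiv_apply, map_rename]

lemma degreeOf_map {R S : Type*} [CommRing R] [CommRing S] (φ : R →+* S)
    (hφ : Function.Injective φ) (P : MvPolynomial (Fin 2) R) (i : Fin 2) :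
    degreeOf i (map φ P) = degreeOf i P := by
  rw [degreeOf_eq_sup, degreeOf_eq_sup, support_map_of_injective _ hφ]

lemma lemJ [CharZero κ] (P : MvPolynomial (Fin 2) κ) (hP : LNJ P)
    (hn : 1 ≤ degreeOf 0 P) (hm : 1 ≤ degreeOf 1 P) :
    ∃ (s : ℕ) (c μ : κ), 1 ≤ s ∧ c ≠ 0 ∧ μ ≠ 0 ∧
      ((Form P (degreeOf 0 P) s c μ ∧ degreeOf 1 P = s * degreeOf 0 P) ∨
        (2 ≤ s ∧ Form (swp κ P) (degreeOf 1 P) s c μ ∧ degreeOf 0 P = s * degreeOf 1 P)) := by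
  let φ := algebraMap κ (AlgebraicClosure κ)
  have hφ : Function.Injective φ := φ.injective
  have : CharZero (AlgebraicClosure κ) := charZero_of_injective_algebraMap hφ
  obtain ⟨s, c, μ, hs, hc, hμ, h⟩ := lemJ_closed (map φ P) (hP.map φ)
    (by rwa [degreeOf_map φ hφ]) (by rwa [degreeOf_map φ hφ])
  rw [degreeOf_map φ hφ, degreeOf_map φ hφ] at h
  rcases h with ⟨h1, h2⟩ | ⟨h0, h1, h2⟩
  · obtain ⟨c', μ', h3, h4, h5⟩ := form_descend φ h1 hs hn hc hμ
    exact ⟨s, c', μ', hs, h3, h4, Or.inl ⟨h5, h2⟩⟩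
  · rw [swp_map] at h1
    obtain ⟨c', μ', h3, h4, h5⟩ := form_descend φ h1 hs hm hc hμ
    exact ⟨s, c', μ', hs, h3, h4, Or.inr ⟨h0, h5, h2⟩⟩

end LemJ
end KR

set_option linter.unusedSectionVars false

namespace KR
open MvPolynomial

section Chain
variable {R : Type*} [CommRing R]

/-- abbreviation for the polynomial ring -/
abbrev P2 (R : Type*) [CommRing R] := MvPolynomial (Fin 2) R

lemma pderiv_chain (φ : P2 R →ₐ[R] P2 R) (i : Fin 2) (f : P2 R) :
    pderiv i (φ f) = φ (pderiv 0 f) * pderiv i (φ (X 0)) + φ (pderiv 1 f) * pderiv i (φ (X 1)) := by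
  induction f using MvPolynomial.induction_on with
  | C a => simp [← MvPolynomial.algebraMap_eq]
  | add p q hp hq => simp only [map_add, hp, hq]; ring
  | mul_X p j hp =>
    simp only [map_mul, Derivation.leibniz, smul_eq_mul, map_add, hp]
    fin_cases j
    · simp only [Fin.zero_eta, pderiv_X_self, pderiv_X_of_ne (show (0 : Fin 2) ≠ 1 by decide), map_one,
        map_zero]; ring
    · simp only [Fin.mk_one, pderiv_X_self, pderiv_X_of_ne (show (1 : Fin 2) ≠ 0 by decide), map_one,
        map_zero]; ring

lemma jac_chain (φ : P2 R →ₐ[R] P2 R) (f g : P2 R) :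
    jacD (φ f) (φ g) = φ (jacD f g) * jacD (φ (X 0)) (φ (X 1)) := by
  simp only [jacD_apply, pderiv_chain φ _ f, pderiv_chain φ _ g, map_sub, map_mul]
  ring

lemma jac_XX : jacD (X 0 : P2 R) (X 1) = 1 := by
  rw [jacD_X1, pderiv_X_self]

lemma jac_unit (φ : P2 R ≃ₐ[R] P2 R) : IsUnit (jacD (φ (X 0)) (φ (X 1))) := by
  have h : jacD (φ (φ.symm (X 0))) (φ (φ.symm (X 1))) = _ :=
    jac_chain φ.toAlgHom (φ.symm (X 0)) (φ.symm (X 1))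
  rw [AlgEquiv.apply_symm_apply, AlgEquiv.apply_symm_apply, jac_XX] at h
  exact IsUnit.of_mul_eq_one_right _ h.symm

lemma jacD_swap (f g : P2 R) : jacD g f = - jacD f g := by
  simp only [jacD_apply]; ring

/-- coordinates are locally nilpotent -/
lemma LNJ_of_unit (φ : P2 R ≃ₐ[R] P2 R) (J : R) (hJ : jacD (φ (X 0)) (φ (X 1)) = C J) :
    LNJ (φ (X 1)) := by
  have key : ∀ (n : ℕ) (h : P2 R), (jacD (φ (X 1)))^[n] (φ h) =
      C ((-J)^n) * φ ((pderiv 0)^[n] h) := by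
    intro n
    induction n with
    | zero => intro h; simp
    | succ n ih =>
      intro h
      have h1 : jacD (φ (X 1)) (φ h) = C (-J) * φ (pderiv 0 h) := by
        have h0 : jacD (φ (X 1)) (φ h) = φ (jacD (X 1) h) * jacD (φ (X 0)) (φ (X 1)) :=
          jac_chain φ.toAlgHom (X 1) h
        rw [h0, hJ]
        have h2 : jacD (X 1 : P2 R) h = - pderiv 0 h := by
          rw [jacD_swap, jacD_X1]
        rw [h2, map_neg, C_neg]; ring
      have h3 : φ (C (-J) * pderiv 0 h) = C (-J) * φ (pderiv 0 h) := by
        rw [map_mul]; congr 1; exact φ.commutes _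
      rw [Function.iterate_succ_apply, h1, ← h3, ih, Function.iterate_succ_apply]
      have h4 : ∀ g : P2 R, (pderiv (R := R) (0 : Fin 2))^[n] (C (-J) * g) = C (-J) * (pderiv 0)^[n] g := by
        intro g
        rw [C_mul', C_mul', iter_smul]
      rw [h4, map_mul, pow_succ, C_mul, mul_assoc]
      congr 2
      exact φ.commutes _
  intro i
  have hp : ∀ h : P2 R, Nil (pderiv (R := R) (0 : Fin 2)) h := by
    intro h
    rw [← mem_nilSub]
    have : (⊤ : Subalgebra R (P2 R)) ≤ nilSub (pderiv (R := R) (0 : Fin 2)) := by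
      rw [← MvPolynomial.adjoin_range_X]
      apply Algebra.adjoin_le
      rintro _ ⟨i, rfl⟩
      refine ⟨2, ?_⟩
      rw [Function.iterate_succ_apply, Function.iterate_one]
      fin_cases i
      · simp [pderiv_X_self]
      · simp [pderiv_X_of_ne (show (1 : Fin 2) ≠ 0 by decide)]
    exact this trivial
  obtain ⟨n, hn⟩ := hp (φ.symm (X i))
  refine ⟨n, ?_⟩
  have := key n (φ.symm (X i))
  rw [AlgEquiv.apply_symm_apply, hn, map_zero, mul_zero] at this
  exact this

/-- surjective endomorphisms of Noetherian rings -/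
lemma noeth_inj {S : Type*} [CommRing S] [IsNoetherianRing S] (f : S →+* S)
    (hf : Function.Surjective f) : Function.Injective f := by
  have hm : Monotone (fun n : ℕ => RingHom.ker (f ^ n)) := by
    apply monotone_nat_of_le_succ
    intro n x hx
    rw [RingHom.mem_ker] at hx ⊢
    rw [pow_succ', RingHom.mul_def, RingHom.comp_apply, hx, map_zero]
  obtain ⟨n, hn⟩ := monotone_stabilizes_iff_noetherian.2 (inferInstance : IsNoetherian S S)
    ⟨fun n : ℕ => RingHom.ker (f ^ n), hm⟩
  have hn1 : RingHom.ker (f ^ n) = RingHom.ker (f ^ (n+1)) := hn (n+1) (by omega)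
  rw [injective_iff_map_eq_zero]
  intro a ha
  have hsn : Function.Surjective (f ^ n : S →+* S) := by
    rw [RingHom.coe_pow]; exact hf.iterate n
  obtain ⟨b, rfl⟩ := hsn a
  have : b ∈ RingHom.ker (f ^ (n+1)) := by
    rw [RingHom.mem_ker, pow_succ', RingHom.mul_def, RingHom.comp_apply, ha]
  rw [← hn1] at this
  exact this

/-- automorphism from generators -/
lemma exists_equiv [IsNoetherianRing R] (u v : P2 R)
    (h0 : X 0 ∈ Algebra.adjoin R {u, v}) (h1 : X 1 ∈ Algebra.adjoin R {u, v}) :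
    ∃ φ : P2 R ≃ₐ[R] P2 R, φ (X 0) = u ∧ φ (X 1) = v := by
  let ψ : P2 R →ₐ[R] P2 R := aeval ![u, v]
  have hr : ψ.range = ⊤ := by
    rw [eq_top_iff, ← MvPolynomial.adjoin_range_X]
    have hr2 : Algebra.adjoin R {u, v} ≤ ψ.range := by
      apply Algebra.adjoin_le
      rintro x (rfl | rfl)
      · exact ⟨X 0, by simp [ψ]⟩
      · exact ⟨X 1, by simp [ψ]⟩
    apply Algebra.adjoin_le
    rintro _ ⟨i, rfl⟩
    fin_cases i
    · exact hr2 h0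
    · exact hr2 h1
  have hs : Function.Surjective ψ := AlgHom.range_eq_top _ |>.1 hr
  have hi : Function.Injective ψ :=
    noeth_inj (ψ : P2 R →+* P2 R) hs
  exact ⟨AlgEquiv.ofBijective ψ ⟨hi, hs⟩, by simp [ψ], by simp [ψ]⟩

/-- shift automorphism -/
lemma exists_shift [IsNoetherianRing R] (h : Polynomial R) :
    ∃ φ : P2 R ≃ₐ[R] P2 R, φ (X 0) = X 0 + Polynomial.aeval (X 1) h ∧ φ (X 1) = X 1 := by
  apply exists_equiv
  · have h2 : Polynomial.aeval (X 1 : P2 R) h ∈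
        Algebra.adjoin R {X 0 + Polynomial.aeval (X 1) h, (X 1 : P2 R)} := by
      have : Polynomial.aeval (X 1 : P2 R) h ∈ Algebra.adjoin R {(X 1 : P2 R)} := by
        rw [Algebra.adjoin_singleton_eq_range_aeval]; exact ⟨h, rfl⟩
      exact Algebra.adjoin_mono (by simp) this
    have h3 := Subalgebra.sub_mem _ (Algebra.subset_adjoin (R := R) (show X 0 + Polynomial.aeval (X 1) h ∈
      ({X 0 + Polynomial.aeval (X 1) h, (X 1 : P2 R)} : Set (P2 R)) by simp)) h2
    simpa using h3
  · exact Algebra.subset_adjoin (by simp)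

end Chain

section Dom
variable {κ : Type*} [Field κ]

lemma lau_pow_mem (w : (Fin 2 → ℤ) →+ ℤ) {A : P2 κ} {a : ℤ} (hA : lau κ 2 A ∈ LE w a) (n : ℕ) :
    lau κ 2 (A^n) ∈ LE w (n * a) := by
  induction n with
  | zero =>
    rw [pow_zero, map_one, Nat.cast_zero, zero_mul]
    have := mon_mem (κ := κ) w (0 : Fin 2 → ℤ)
    rwa [mon_zero, map_zero] at this
  | succ n ih =>
    rw [pow_succ, map_mul]
    have := mul_mem_LE w ih hA
    convert this using 1
    push_cast; ring

lemma lau_C_mem (w : (Fin 2 → ℤ) →+ ℤ) (c : κ) : lau κ 2 (C c) ∈ LE w 0 := by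
  rw [lau_mem_LE]
  intro s hs
  classical
  rw [mem_support_iff, coeff_C] at hs
  by_cases h : 0 = s
  · rw [← h]
    have : zexp (0 : Fin 2 →₀ ℕ) = 0 := by ext; simp [zexp]
    rw [this, map_zero]
  · rw [if_neg h] at hs; exact absurd rfl hs

lemma dom_aux (w : (Fin 2 → ℤ) →+ ℤ) {A B r : P2 κ} {a b N : ℤ}
    (hA : lau κ 2 A ∈ LE w a) (hB : lau κ 2 B ∈ LE w b)
    (hr : ∀ e ∈ r.support, (e 0 : ℤ) * a + e 1 * b ≤ N) :
    lau κ 2 (aeval ![A, B] r) ∈ LE w N := by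
  rw [aeval_def, eval₂_eq', map_sum]
  refine Submodule.sum_mem _ fun e he => ?_
  rw [Fin.prod_univ_two]
  simp only [MvPolynomial.algebraMap_eq, Matrix.cons_val_zero, Matrix.cons_val_one, map_mul]
  have := mul_mem_LE w (lau_C_mem w (coeff e r)) (mul_mem_LE w (lau_pow_mem w hA (e 0)) (lau_pow_mem w hB (e 1)))
  rw [zero_add] at this
  exact LE_mono w (hr e he) this

/-- domination lemma -/
lemma dom (w : (Fin 2 → ℤ) →+ ℤ) {A B f : P2 κ} {a b M : ℤ} {n s : ℕ} {c μ : κ}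
    (hf : Form f n s c μ) (hs : 1 ≤ s)
    (hA : lau κ 2 A ∈ LE w a) (hB : lau κ 2 B ∈ LE w b) (hM : 1 ≤ M) (haM : a ≤ M) (hbM : s * b ≤ M) :
    lau κ 2 (aeval ![A, B] f - C c * (A - C μ * B ^ s)^n) ∈ LE w (n * M - 1) := by
  have h1 : aeval ![A, B] f - C c * (A - C μ * B ^ s)^n =
      aeval ![A, B] (f - C c * (X 0 - C μ * X 1 ^ s)^n) := by
    simp
  rw [h1]
  refine dom_aux w hA hB ?_
  intro e he
  have h2 := hf e he
  have hs0 : (1:ℤ) ≤ s := by exact_mod_cast hs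
  have h3 : (s : ℤ) * e 0 + e 1 + 1 ≤ s * n := by exact_mod_cast h2
  have h4 : (s:ℤ) * (e 0 * a + e 1 * b) ≤ (s * e 0 + e 1) * M := by
    have h5 : (e 0 : ℤ) * a ≤ e 0 * M := mul_le_mul_of_nonneg_left haM (by positivity)
    have h6 : (e 1 : ℤ) * (s * b) ≤ e 1 * M := mul_le_mul_of_nonneg_left hbM (by positivity)
    nlinarith
  by_contra hlt
  push Not at hlt
  have h7 : (n:ℤ) * M ≤ e 0 * a + e 1 * b := by linarith
  have h8 : (s:ℤ) * (n * M) ≤ s * (e 0 * a + e 1 * b) := mul_le_mul_of_nonneg_left h7 (by positivity)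
  nlinarith

/-- effect of the shift on a polynomial in normal form -/
lemma form_shift {f : P2 κ} {n s : ℕ} {c μ : κ} (hf : Form f n s c μ) (hs : 1 ≤ s) (hn : 1 ≤ n) :
    degreeOf 0 (aeval ![X 0 + C μ * X 1 ^ s, X 1] f : P2 κ) ≤ n ∧
    degreeOf 1 (aeval ![X 0 + C μ * X 1 ^ s, X 1] f : P2 κ) < s * n := by
  have hX0 : lau κ 2 (X 0) ∈ LE (wt2 s 1) (s : ℤ) := by
    simp only [lau, aeval_X]; exact LE_mono _ (by simp [wt2]) (mon_mem (wt2 s 1) _)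
  have hX1 : lau κ 2 (X 1) ∈ LE (wt2 s 1) (1 : ℤ) := by
    simp only [lau, aeval_X]; exact LE_mono _ (by simp [wt2]) (mon_mem (wt2 s 1) _)
  have hA : lau κ 2 (X 0 + C μ * X 1 ^ s) ∈ LE (wt2 s 1) (s : ℤ) := by
    rw [map_add, map_mul]
    refine add_mem hX0 ?_
    have := mul_mem_LE _ (lau_C_mem (wt2 s 1) μ) (lau_pow_mem _ hX1 s)
    simpa using this
  have h := dom (wt2 s 1) hf hs hA hX1 (M := s) (by exact_mod_cast hs) le_rfl (by simp)
  rw [add_sub_cancel_right] at h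
  set g : P2 κ := aeval ![X 0 + C μ * X 1 ^ s, X 1] f
  rw [lau_mem_LE] at h
  have hsupp : ∀ e ∈ g.support, e 0 ≤ n ∧ e 1 < s * n := by
    intro e he
    by_cases h1 : e ∈ (g - C c * X 0 ^ n).support
    · have h2 := h e h1
      rw [wt2_zexp] at h2
      have h3 : ((s * e 0 + 1 * e 1 + 1 : ℕ) : ℤ) ≤ ((n * s : ℕ) : ℤ) := by push_cast at h2 ⊢; linarith
      have h4 : s * e 0 + 1 * e 1 + 1 ≤ n * s := by exact_mod_cast h3
      constructor
      · by_contra h5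
        have : s * n ≤ s * e 0 := Nat.mul_le_mul_left s (by omega)
        rw [mul_comm n s] at h4; omega
      · rw [mul_comm s n]; omega
    · classical
      rw [notMem_support_iff, coeff_sub, sub_eq_zero] at h1
      rw [mem_support_iff, h1, coeff_C_mul, coeff_X_pow] at he
      by_cases h2 : Finsupp.single 0 n = e
      · rw [← h2]; simp; exact ⟨by omega, by omega⟩
      · rw [if_neg h2] at he; simp at he
  constructor
  · rw [degreeOf_le_iff]; exact fun e he => (hsupp e he).1
  · rw [degreeOf_lt_iff (by positivity)]; exact fun e he => (hsupp e he).2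

end Dom
end KR

set_option linter.unusedSectionVars false

namespace KR
open MvPolynomial

section S1
variable {κ : Type*} [Field κ]

lemma deg_mem (i : Fin 2) (f : P2 κ) (N : ℕ) :
    lau κ 2 f ∈ LE (Pi.evalAddMonoidHom (fun _ : Fin 2 => ℤ) i) (N : ℤ) ↔ degreeOf i f ≤ N := by
  rw [lau_mem_LE, degreeOf_le_iff]
  simp [zexp]

lemma dom_deg (i : Fin 2) {A B f : P2 κ} {n s : ℕ} {c μ : κ} (hf : Form f n s c μ) (hs : 1 ≤ s)
    (hn : 1 ≤ n) (hc : c ≠ 0) (hμ : μ ≠ 0) (hAB : degreeOf i A < s * degreeOf i B) :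
    degreeOf i (aeval ![A, B] f) = n * (s * degreeOf i B) := by
  set b := degreeOf i B with hb
  have hb0 : b ≠ 0 := by intro h; rw [h] at hAB; omega
  have hB0 : B ≠ 0 := ne_zero_of_degreeOf_ne_zero (i := i) (by rw [← hb]; exact hb0)
  have h := dom _ hf hs ((deg_mem i A _).2 hAB.le) ((deg_mem i B _).2 hb.symm.le)
    (M := ((s * b : ℕ) : ℤ)) (by have := Nat.zero_lt_of_lt hAB; exact_mod_cast this) le_rfl (by push_cast; rfl)
  have hpos : 1 ≤ n * (s * b) := Nat.mul_pos hn (by omega)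
  have e1 : ((n : ℤ) * ((s * b : ℕ) : ℤ) - 1) = ((n * (s * b) - 1 : ℕ) : ℤ) := by
    rw [Nat.cast_sub hpos]; push_cast; ring
  rw [e1, deg_mem] at h
  set T : P2 κ := A - C μ * B ^ s
  have hT : degreeOf i T = s * b := by
    have h1 : degreeOf i (-(C μ * B ^ s)) = s * b := by
      have : -(C μ * B ^ s) = C (-μ) * B ^ s := by rw [C_neg]; ring
      rw [this, degreeOf_C_mul _ _ (mem_nonZeroDivisors_of_ne_zero (neg_ne_zero.2 hμ)),
        degreeOf_pow_eq _ _ _ hB0]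
    have : T = -(C μ * B^s) + A := by simp only [T]; ring
    rw [this, degreeOf_add_eq_of_degreeOf_lt (by rw [h1]; exact hAB), h1]
  have hT0 : T ≠ 0 := ne_zero_of_degreeOf_ne_zero (i := i) (by rw [hT]; omega)
  have h2 : degreeOf i (C c * T ^ n) = n * (s * b) := by
    rw [degreeOf_C_mul _ _ (mem_nonZeroDivisors_of_ne_zero hc), degreeOf_pow_eq _ _ _ hT0, hT]
  have h3 : aeval ![A, B] f = C c * T ^ n + (aeval ![A, B] f - C c * T ^ n) := by ring
  rw [h3, degreeOf_add_eq_of_degreeOf_lt (by rw [h2]; omega), h2]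

lemma form_map (τ : κ →+* κ) {f : P2 κ} {n s : ℕ} {c μ : κ} (hf : Form f n s c μ) :
    Form (map τ f) n s (τ c) (τ μ) := by
  intro e he
  apply hf e
  have : map τ f - C (τ c) * (X 0 - C (τ μ) * X 1 ^ s)^n = map τ (f - C c * (X 0 - C μ * X 1 ^ s)^n) := by
    simp
  rw [this] at he
  exact support_map_subset _ _ he

lemma swp_X0 {R : Type*} [CommRing R] : swp R (X 0) = X 1 := by simp [swp]
lemma swp_X1 {R : Type*} [CommRing R] : swp R (X 1) = X 0 := by simp [swp]
lemma swp_swp {R : Type*} [CommRing R] (f : P2 R) : swp R (swp R f) = f := by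
  simp [swp, rename_rename, ← Equiv.coe_trans]
lemma swp_symm {R : Type*} [CommRing R] : (swp R).symm = swp R := by
  ext f : 1
  rw [AlgEquiv.symm_apply_eq, swp_swp]
lemma degreeOf_swp {R : Type*} [CommRing R] (f : P2 R) : degreeOf 0 (swp R f) = degreeOf 1 f := by
  have := degreeOf_rename_of_injective (p := f) (Equiv.swap (0 : Fin 2) 1).injective 1
  simpa [swp] using this
lemma degreeOf_swp' {R : Type*} [CommRing R] (f : P2 R) : degreeOf 1 (swp R f) = degreeOf 0 f := by
  rw [← degreeOf_swp, swp_swp]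
lemma aeval_swp {R S : Type*} [CommRing R] [CommRing S] [Algebra R S] (f : P2 R) (a b : S) :
    aeval ![a, b] (swp R f) = aeval ![b, a] f := by
  rw [swp, renameEquiv_apply, aeval_rename]
  congr 2
  funext i; fin_cases i <;> simp

lemma mem_adjoin_X1 [CharZero κ] {f : P2 κ} (h : pderiv 0 f = 0) : f ∈ Algebra.adjoin κ {(X 1 : P2 κ)} := by
  rw [pderiv_eq_zero_iff] at h
  rw [MvPolynomial.as_sum f]
  refine Subalgebra.sum_mem _ fun s hs => ?_
  rw [monomial_eq, Finsupp.prod_fintype _ _ (by simp), Fin.prod_univ_two, h s hs, pow_zero, one_mul,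
    ← algebraMap_eq]
  exact Subalgebra.mul_mem _ (Subalgebra.algebraMap_mem _ _)
    (Subalgebra.pow_mem _ (Algebra.subset_adjoin (Set.mem_singleton _)) _)

lemma eq_C_of_pderiv [CharZero κ] {f : P2 κ} (h : pderiv 0 f = 0) (h' : pderiv 1 f = 0) :
    ∃ c, f = C c := by
  rw [pderiv_eq_zero_iff] at h h'
  refine ⟨coeff 0 f, ?_⟩
  rw [← totalDegree_eq_zero_iff_eq_C, totalDegree_eq_zero_iff]
  intro m hm x
  fin_cases x
  · exact h m hm
  · exact h' m hm

lemma pderiv_of_degreeOf [CharZero κ] {f : P2 κ} {i : Fin 2} (h : degreeOf i f = 0) : pderiv i f = 0 := by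
  rw [pderiv_eq_zero_iff]
  exact degreeOf_le_iff.1 h.le |> fun h s hs => Nat.le_zero.1 (h s hs)

lemma semilin (τ : κ →+* κ) (σ : P2 κ →+* P2 κ) (hσ : ∀ a, σ (C a) = C (τ a)) (h : P2 κ) :
    σ h = aeval ![σ (X 0), σ (X 1)] (map τ h) := by
  have : σ = ((aeval ![σ (X 0), σ (X 1)] : P2 κ →ₐ[κ] P2 κ) : P2 κ →+* P2 κ).comp (map τ) := by
    apply MvPolynomial.ringHom_ext
    · intro a; simp [hσ]
    · intro i; fin_cases i <;> simp
  exact DFunLike.congr_fun this h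

/-- Step 1: antilinear involutions of the plane are linearizable -/
theorem step1 [CharZero κ] (τ : κ →+* κ) (hτ : ∀ a, τ (τ a) = a) (ii : κ) (hi : τ ii = -ii) (hi0 : ii ≠ 0) :
    ∀ (n m : ℕ) (σ : P2 κ →+* P2 κ), (∀ a, σ (C a) = C (τ a)) → (∀ f, σ (σ f) = f) →
      degreeOf 0 (σ (X 1)) = n → degreeOf 1 (σ (X 1)) = m →
      ∃ S : P2 κ ≃ₐ[κ] P2 κ, σ (S (X 0)) = S (X 0) ∧ σ (S (X 1)) = S (X 1) := by
  intro n
  induction n using Nat.strong_induction_on with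
  | _ n ihn =>
  intro m
  induction m using Nat.strong_induction_on with
  | _ m ihm =>
  intro σ hσ hσσ hn hm
  set P := σ (X 1) with hP
  set Q := σ (X 0) with hQ
  have hsl : ∀ h, σ h = aeval ![Q, P] (map τ h) := semilin τ σ hσ
  have hφs : Function.Surjective (aeval ![Q, P] : P2 κ →ₐ[κ] P2 κ) := by
    intro y
    exact ⟨map τ (σ y), by rw [← hsl, hσσ]⟩
  have hφi : Function.Injective (aeval ![Q, P] : P2 κ →ₐ[κ] P2 κ) :=
    noeth_inj ((aeval ![Q, P] : P2 κ →ₐ[κ] P2 κ) : P2 κ →+* P2 κ) hφs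
  let φ : P2 κ ≃ₐ[κ] P2 κ := AlgEquiv.ofBijective _ ⟨hφi, hφs⟩
  have hφ0 : φ (X 0) = Q := by simp [φ]
  have hφ1 : φ (X 1) = P := by simp [φ]
  have hJ := jac_unit φ
  rw [hφ0, hφ1] at hJ
  have hJC : ∃ J, jacD Q P = C J := by
    obtain ⟨r, -, hr⟩ := isUnit_iff_eq_C_of_isReduced.1 hJ
    exact ⟨r, hr⟩
  have hLNJ : LNJ P := by
    obtain ⟨J, h⟩ := hJC
    rw [← hφ1]
    apply LNJ_of_unit φ J
    rw [hφ0, hφ1, h]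
  rw [jacD_apply] at hJ
  -- conjugation
  have conj : ∀ T : P2 κ ≃ₐ[κ] P2 κ, ∃ σ1 : P2 κ →+* P2 κ, (∀ a, σ1 (C a) = C (τ a)) ∧
      (∀ f, σ1 (σ1 f) = f) ∧ (∀ f, σ1 f = T.symm (σ (T f))) ∧
      ((∃ S : P2 κ ≃ₐ[κ] P2 κ, σ1 (S (X 0)) = S (X 0) ∧ σ1 (S (X 1)) = S (X 1)) →
        ∃ S : P2 κ ≃ₐ[κ] P2 κ, σ (S (X 0)) = S (X 0) ∧ σ (S (X 1)) = S (X 1)) := by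
    intro T
    refine ⟨((T.symm : P2 κ →+* P2 κ).comp σ).comp (T : P2 κ →+* P2 κ), ?_, ?_, fun f => rfl, ?_⟩
    · intro a
      have h1 : T (C a) = C a := T.commutes a
      have h2 : T.symm (C (τ a)) = C (τ a) := T.symm.commutes _
      simp [h1, hσ, h2]
    · intro f; simp [hσσ]
    · rintro ⟨S, h0, h1⟩
      refine ⟨S.trans T, ?_, ?_⟩
      · simp only [RingHom.comp_apply] at h0
        have h0' : T.symm (σ (T (S (X 0)))) = S (X 0) := h0
        rw [AlgEquiv.symm_apply_eq] at h0'
        exact h0'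
      · have h1' : T.symm (σ (T (S (X 1)))) = S (X 1) := h1
        rw [AlgEquiv.symm_apply_eq] at h1'
        exact h1'
  have unitC : ∀ f : P2 κ, IsUnit f → ∃ a, a ≠ 0 ∧ f = C a := by
    intro f hf
    obtain ⟨r, h1, hr⟩ := isUnit_iff_eq_C_of_isReduced.1 hf
    exact ⟨r, h1.ne_zero, hr⟩
  have p01 : pderiv (R := κ) (0 : Fin 2) (X 1) = 0 := pderiv_X_of_ne (by decide)
  have p10 : pderiv (R := κ) (1 : Fin 2) (X 0) = 0 := pderiv_X_of_ne (by decide)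
  have fixC : ∀ (ω : κ) (f : P2 κ), σ (C ω * f + C (τ ω) * σ f) = C ω * f + C (τ ω) * σ f := by
    intro ω f
    rw [map_add, map_mul, map_mul, hσ, hσ, hσσ, hτ]; ring
  have exω : ∀ a : κ, ∃ ω, ω + τ ω * a ≠ 0 := by
    intro a
    by_cases h : 1 + a = 0
    · refine ⟨ii, ?_⟩
      rw [hi, show a = -1 by linear_combination h]
      have : ii + -ii * -1 = 2 * ii := by ring
      rw [this]; exact mul_ne_zero two_ne_zero hi0
    · exact ⟨1, by simpa using h⟩
  have Cmem : ∀ (A : Subalgebra κ (P2 κ)) (a : κ), C a ∈ A := fun A a => A.algebraMap_mem a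
  have Cdiv : ∀ (A : Subalgebra κ (P2 κ)) (a : κ) (f : P2 κ), a ≠ 0 → C a * f ∈ A → f ∈ A := by
    intro A a f ha h
    have := A.mul_mem (Cmem A a⁻¹) h
    rwa [← mul_assoc, ← C_mul, inv_mul_cancel₀ ha, C_1, one_mul] at this
  by_cases hn0 : n = 0
  · have hP0 : pderiv 0 P = 0 := pderiv_of_degreeOf (by rw [hn, hn0])
    rw [hP0, mul_zero, sub_zero] at hJ
    obtain ⟨k, hk0, hk⟩ := unitC _ (isUnit_of_mul_isUnit_right hJ)
    obtain ⟨k', hk0', hk'⟩ := unitC _ (isUnit_of_mul_isUnit_left hJ)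
    obtain ⟨ε, hε⟩ : ∃ ε, P - C k * X 1 = C ε := by
      apply eq_C_of_pderiv
      · rw [map_sub, hP0, pderiv_C_mul, p01]; simp
      · rw [map_sub, hk, pderiv_C_mul, pderiv_X_self]; simp
    have hq : Q - C k' * X 0 ∈ Algebra.adjoin κ {(X 1 : P2 κ)} := by
      apply mem_adjoin_X1
      rw [map_sub, hk', pderiv_C_mul, pderiv_X_self]; simp
    obtain ⟨ω, hω⟩ := exω k
    obtain ⟨ω', hω'⟩ := exω k'
    set u := C ω' * X 0 + C (τ ω') * Q with hu
    set v := C ω * X 1 + C (τ ω) * P with hv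
    have hX1 : X 1 ∈ Algebra.adjoin κ {u, v} := by
      apply Cdiv _ _ _ hω
      have : C (ω + τ ω * k) * X 1 = v - C (τ ω) * C ε := by
        rw [← hε, hv, C_add, C_mul]; ring
      rw [this]
      exact Subalgebra.sub_mem _ (Algebra.subset_adjoin (by simp)) (Subalgebra.mul_mem _ (Cmem _ _) (Cmem _ _))
    have hX0 : X 0 ∈ Algebra.adjoin κ {u, v} := by
      apply Cdiv _ _ _ hω'
      have : C (ω' + τ ω' * k') * X 0 = u - C (τ ω') * (Q - C k' * X 0) := by
        rw [hu, C_add, C_mul]; ring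
      rw [this]
      refine Subalgebra.sub_mem _ (Algebra.subset_adjoin (by simp)) (Subalgebra.mul_mem _ (Cmem _ _) ?_)
      exact Algebra.adjoin_le (by simpa using hX1) hq
    obtain ⟨S, hS0, hS1⟩ := exists_equiv u v hX0 hX1
    refine ⟨S, ?_, ?_⟩
    · rw [hS0]; exact fixC _ _
    · rw [hS1]; exact fixC _ _
  by_cases hm0 : m = 0
  · have hP1 : pderiv 1 P = 0 := pderiv_of_degreeOf (by rw [hm, hm0])
    rw [hP1, mul_zero, zero_sub, IsUnit.neg_iff] at hJ
    obtain ⟨k, hk0, hk⟩ := unitC _ (isUnit_of_mul_isUnit_right hJ)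
    obtain ⟨ε, hε⟩ : ∃ ε, P - C k * X 0 = C ε := by
      apply eq_C_of_pderiv
      · rw [map_sub, hk, pderiv_C_mul, pderiv_X_self]; simp
      · rw [map_sub, hP1, pderiv_C_mul, p10]; simp
    set u := C 1 * X 1 + C (τ 1) * P with hu
    set v := C ii * X 1 + C (τ ii) * P with hv
    have hum : u ∈ Algebra.adjoin κ {u, v} := Algebra.subset_adjoin (by simp)
    have hvm : v ∈ Algebra.adjoin κ {u, v} := Algebra.subset_adjoin (by simp)
    have hX1 : X 1 ∈ Algebra.adjoin κ {u, v} := by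
      apply Cdiv _ (2 * ii) _ (mul_ne_zero two_ne_zero hi0)
      have : C (2 * ii) * X 1 = C ii * u + v := by
        rw [hu, hv, hi, map_one, C_mul, C_neg, show (2:κ) = 1 + 1 by norm_num, C_add]; simp; ring
      rw [this]
      exact Subalgebra.add_mem _ (Subalgebra.mul_mem _ (Cmem _ _) hum) hvm
    have hX0 : X 0 ∈ Algebra.adjoin κ {u, v} := by
      apply Cdiv _ k _ hk0
      have : C k * X 0 = u - X 1 - C ε := by
        rw [← hε, hu]; simp
      rw [this]
      exact Subalgebra.sub_mem _ (Subalgebra.sub_mem _ hum hX1) (Cmem _ _)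
    obtain ⟨S, hS0, hS1⟩ := exists_equiv u v hX0 hX1
    refine ⟨S, ?_, ?_⟩
    · rw [hS0]; exact fixC _ _
    · rw [hS1]; exact fixC _ _
  obtain ⟨s, c, μ, hs, hc, hμ, h | ⟨hs2, hF, hdeg⟩⟩ := lemJ P hLNJ (by omega) (by omega)
  · obtain ⟨hF, hdeg⟩ := h
    obtain ⟨T, hT0, hT1⟩ := exists_shift (Polynomial.C μ * Polynomial.X ^ s : Polynomial κ)
    obtain ⟨σ1, a1, a2, a3, a4⟩ := conj T.symm
    apply a4
    have hTs1 : T.symm (X 1) = X 1 := by rw [AlgEquiv.symm_apply_eq, hT1]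
    have hP1 : σ1 (X 1) = aeval ![X 0 + C μ * X 1 ^ s, X 1] P := by
      rw [a3, hTs1, ← hP, AlgEquiv.symm_symm]
      have : (T : P2 κ →ₐ[κ] P2 κ) = aeval ![X 0 + C μ * X 1 ^ s, X 1] := by
        apply MvPolynomial.algHom_ext
        intro i; fin_cases i
        · simp [hT0, algebraMap_eq]
        · simp [hT1]
      exact DFunLike.congr_fun this P
    obtain ⟨d0, d1⟩ := form_shift hF hs (by omega)
    rw [← hP1] at d0 d1
    rw [← hdeg, hm] at d1
    rw [hn] at d0
    rcases d0.lt_or_eq with d0 | d0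
    · exact ihn _ d0 _ σ1 a1 a2 rfl rfl
    · exact ihm _ d1 σ1 a1 a2 d0 rfl
  · rw [hm] at hF
    rw [hm, hn] at hdeg
    obtain ⟨σ1, a1, a2, a3, a4⟩ := conj (swp κ)
    apply a4
    have hlt : degreeOf 1 Q < n := by
      by_contra hge
      push Not at hge
      have hX : aeval ![P, Q] (map τ (swp κ P)) = X 1 := by
        rw [← swp_map, aeval_swp, ← hsl, hP, hσσ]
      have h1 := dom_deg 1 (form_map τ hF) (A := P) (B := Q) hs (by omega) (by simpa using hc) (by simpa using hμ)
        (by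
          rw [hm]
          have h2 : 2 * n ≤ s * degreeOf 1 Q := Nat.mul_le_mul hs2 hge
          have h3 : 2 * m ≤ n := by rw [hdeg]; exact Nat.mul_le_mul_right _ hs2
          omega)
      rw [hX, degreeOf_X_self] at h1
      have h4 : 1 * (2 * 1) ≤ m * (s * degreeOf 1 Q) :=
        Nat.mul_le_mul (by omega) (Nat.mul_le_mul hs2 (by omega))
      omega
    have hd : degreeOf 0 (σ1 (X 1)) < n := by
      rw [a3, swp_X1, swp_symm, degreeOf_swp]; exact hlt
    exact ihn _ hd _ σ1 a1 a2 rfl rfl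

end S1
end KR

set_option linter.unusedSectionVars false

namespace KR
open MvPolynomial

section H0
variable {R : Type*} [CommRing R]

lemma LNJ_equiv (T : P2 R ≃ₐ[R] P2 R) (J : R) (hJ : jacD (T (X 0)) (T (X 1)) = C J) {f : P2 R}
    (hf : LNJ f) : LNJ (T f) := by
  have key : ∀ (n : ℕ) (h : P2 R), (jacD (T f))^[n] (T h) = C (J^n) * T ((jacD f)^[n] h) := by
    intro n
    induction n with
    | zero => intro h; simp
    | succ n ih =>
      intro h
      have h0 : jacD (T f) (T h) = T (jacD f h) * jacD (T (X 0)) (T (X 1)) := jac_chain T.toAlgHom f h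
      have h3 : T (C J * jacD f h) = C J * T (jacD f h) := by
        rw [map_mul]; congr 1; exact T.commutes _
      have h4 : ∀ g : P2 R, (jacD f)^[n] (C J * g) = C J * (jacD f)^[n] g := by
        intro g
        rw [C_mul', C_mul', iter_smul]
      rw [Function.iterate_succ_apply, h0, hJ, mul_comm, ← h3, ih, Function.iterate_succ_apply, h4,
        map_mul, pow_succ, C_mul, mul_assoc]
      congr 2
      exact T.commutes _
  intro i
  obtain ⟨n, hn⟩ := hf.nil (T.symm (X i))
  refine ⟨n, ?_⟩
  have := key n (T.symm (X i))
  rw [AlgEquiv.apply_symm_apply, hn, map_zero, mul_zero] at this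
  exact this

lemma adjoin_pair (u v : P2 R) : (aeval ![u, v] : P2 R →ₐ[R] P2 R).range = Algebra.adjoin R {u, v} := by
  rw [← Algebra.adjoin_range_eq_range_aeval]
  congr 1
  ext x; simp [eq_comm, or_comm]

lemma mem_pair {u v f : P2 R} : f ∈ Algebra.adjoin R {u, v} ↔ ∃ g : P2 R, aeval ![u, v] g = f := by
  rw [← adjoin_pair]; rfl

lemma left_mem (u v : P2 R) : u ∈ Algebra.adjoin R {u, v} := Algebra.subset_adjoin (by simp)
lemma right_mem (u v : P2 R) : v ∈ Algebra.adjoin R {u, v} := Algebra.subset_adjoin (by simp)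

lemma pair_le {u v : P2 R} {A : Subalgebra R (P2 R)} (hu : u ∈ A) (hv : v ∈ A) :
    Algebra.adjoin R {u, v} ≤ A := Algebra.adjoin_le (by
      rintro x (rfl | rfl)
      · exact hu
      · exact hv)

lemma C_mem (A : Subalgebra R (P2 R)) (a : R) : C a ∈ A := A.algebraMap_mem a

lemma jac_dvd {u v u' v' : P2 R} (hu : u' ∈ Algebra.adjoin R {u, v}) (hv : v' ∈ Algebra.adjoin R {u, v}) :
    jacD u v ∣ jacD u' v' := by
  obtain ⟨f, rfl⟩ := mem_pair.1 hu
  obtain ⟨g, rfl⟩ := mem_pair.1 hv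
  rw [jac_chain]
  simp

end H0

section H1

lemma const_of_root {B : P2 ℂ} : ∀ (n : ℕ) (g : Polynomial ℂ), g.natDegree = n → g ≠ 0 →
    Polynomial.aeval B g = 0 → ∃ c, B = C c := by
  intro n
  induction n with
  | zero =>
    intro g hg h0 h
    rw [Polynomial.eq_C_of_natDegree_eq_zero hg, Polynomial.aeval_C, algebraMap_eq, C_eq_zero] at h
    exact absurd (by rw [Polynomial.eq_C_of_natDegree_eq_zero hg, h, Polynomial.C_0]) h0
  | succ n ih =>
    intro g hg h0 h
    obtain ⟨r, hr⟩ := IsAlgClosed.exists_root g (by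
      intro h; rw [Polynomial.degree_eq_natDegree h0, hg] at h; norm_cast at h)
    obtain ⟨g1, hg1⟩ := Polynomial.dvd_iff_isRoot.2 hr
    have h10 : g1 ≠ 0 := by rintro rfl; simp at hg1; exact h0 hg1
    rw [hg1, map_mul, mul_eq_zero] at h
    rcases h with h | h
    · refine ⟨r, ?_⟩
      simpa [sub_eq_zero, algebraMap_eq] using h
    · refine ih g1 ?_ h10 h
      rw [hg1, Polynomial.natDegree_mul (Polynomial.X_sub_C_ne_zero r) h10, Polynomial.natDegree_X_sub_C] at hg
      omega

lemma const_of_G {A B G : P2 ℂ} (hG : G ≠ 0) (hd : degreeOf 0 G = 0) (h : aeval ![A, B] G = 0) :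
    ∃ c, B = C c := by
  have h1 := mem_adjoin_X1 (pderiv_of_degreeOf hd)
  rw [Algebra.adjoin_singleton_eq_range_aeval] at h1
  obtain ⟨g, hg⟩ := h1
  have hg' : Polynomial.aeval (X 1 : P2 ℂ) g = G := hg
  refine const_of_root _ g rfl (by rintro rfl; simp at hg'; exact hG hg'.symm) ?_
  rw [← hg', ← Polynomial.aeval_algHom_apply] at h
  simpa using h

lemma const_of_degreeOf {B : P2 ℂ} (h0 : degreeOf 0 B = 0) (h1 : degreeOf 1 B = 0) : ∃ c, B = C c :=
  eq_C_of_pderiv (pderiv_of_degreeOf h0) (pderiv_of_degreeOf h1)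

lemma real_mu (i : Fin 2) {A B G G' : P2 ℂ} {n s : ℕ} {c μ c' μ' : ℂ} (hf : Form G n s c μ)
    (hf' : Form G' n s c' μ') (hs : 1 ≤ s) (hn : 1 ≤ n) (hc : c ≠ 0) (hc' : c' ≠ 0) (hne : μ ≠ μ')
    (h : aeval ![A, B] G = 0) (h' : aeval ![A, B] G' = 0) : degreeOf i B = 0 := by
  by_contra hb
  set M := max (degreeOf i A) (s * degreeOf i B) with hM
  have hM1 : 1 ≤ M := le_trans (Nat.mul_pos hs (Nat.pos_of_ne_zero hb)) (le_max_right _ _)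
  have key : ∀ (G : P2 ℂ) (c μ : ℂ), Form G n s c μ → c ≠ 0 → aeval ![A, B] G = 0 →
      degreeOf i (A - C μ * B ^ s) ≤ M - 1 := by
    intro G c μ hf hc h
    have := dom _ hf hs ((deg_mem i A _).2 le_rfl) ((deg_mem i B _).2 le_rfl)
      (M := (M : ℤ)) (by exact_mod_cast hM1) (by exact_mod_cast le_max_left _ _)
      (by exact_mod_cast le_max_right _ _)
    rw [h, zero_sub, show ((n : ℤ) * (M:ℤ) - 1) = ((n * M - 1 : ℕ) : ℤ) by
      rw [Nat.cast_sub (Nat.mul_pos hn hM1)]; push_cast; ring, deg_mem] at this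
    by_cases h0 : A - C μ * B ^ s = 0
    · rw [h0]; simp
    · rw [show -(C c * (A - C μ * B ^ s)^n) = C (-c) * (A - C μ * B ^ s)^n by rw [C_neg]; ring,
        degreeOf_C_mul _ _ (mem_nonZeroDivisors_of_ne_zero (neg_ne_zero.2 hc)), degreeOf_pow_eq _ _ _ h0] at this
      by_contra hlt
      have h3 : n * M ≤ n * degreeOf i (A - C μ * B ^ s) := Nat.mul_le_mul_left n (by omega)
      have h4 : 1 ≤ n * M := Nat.mul_pos hn hM1
      omega
  have k1 := key G c μ hf hc h
  have k2 := key G' c' μ' hf' hc' h'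
  have hB0 : B ≠ 0 := ne_zero_of_degreeOf_ne_zero hb
  have sub_le : ∀ a b : P2 ℂ, degreeOf i (a - b) ≤ max (degreeOf i a) (degreeOf i b) := by
    intro a b
    have := degreeOf_add_le i a (C (-1) * b)
    rw [degreeOf_C_mul _ _ (mem_nonZeroDivisors_of_ne_zero (by norm_num))] at this
    convert this using 2
    simp; ring
  have k3 : degreeOf i (B ^ s) ≤ M - 1 := by
    have e : C (μ' - μ) * B ^ s = (A - C μ * B ^ s) - (A - C μ' * B ^ s) := by rw [C_sub]; ring
    rw [← degreeOf_C_mul i (μ' - μ) (mem_nonZeroDivisors_of_ne_zero (sub_ne_zero.2 hne.symm)), e]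
    exact (sub_le _ _).trans (max_le k1 k2)
  have k4 : degreeOf i A ≤ M - 1 := by
    have e : A = (A - C μ * B ^ s) + C μ * B ^ s := by ring
    rw [e]
    exact (degreeOf_add_le _ _ _).trans (max_le k1 ((degreeOf_C_mul_le _ _ _).trans k3))
  rw [degreeOf_pow_eq _ _ _ hB0] at k3
  have : M ≤ M - 1 := max_le k4 k3
  omega

end H1
end KR

set_option linter.unusedSectionVars false

namespace KR
open MvPolynomial

/-- base ring -/
abbrev CX := Polynomial ℂ
/-- conjugation of coefficients -/
noncomputable abbrev cj : CX →+* CX := Polynomial.mapRingHom (starRingEnd ℂ)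
/-- evaluation at a point -/
noncomputable abbrev ev (a : ℂ) : P2 CX →+* P2 ℂ := map (Polynomial.evalRingHom a)

lemma cj_cj (p : CX) : cj (cj p) = p := by
  simp [Polynomial.map_map]

lemma ev_aeval (a : ℂ) (u v f : P2 CX) : ev a (aeval ![u, v] f) = aeval ![ev a u, ev a v] (ev a f) := by
  have : (ev a).comp ((aeval ![u, v] : P2 CX →ₐ[CX] P2 CX) : P2 CX →+* P2 CX) =
      ((aeval ![ev a u, ev a v] : P2 ℂ →ₐ[ℂ] P2 ℂ) : P2 ℂ →+* P2 ℂ).comp (ev a) := by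
    apply MvPolynomial.ringHom_ext
    · intro r; simp [algebraMap_eq]
    · intro i; fin_cases i <;> simp
  exact DFunLike.congr_fun this f

lemma dvd_of_ev {a : ℂ} {f : P2 CX} (h : ev a f = 0) : C (Polynomial.X - Polynomial.C a) ∣ f := by
  rw [C_dvd_iff_dvd_coeff]
  intro i
  rw [Polynomial.dvd_iff_isRoot]
  have := congrArg (coeff i) h
  simpa [coeff_map] using this

/-- data -/
structure AInv (σ : P2 CX →+* P2 CX) : Prop where
  onC : ∀ p, σ (C p) = C (cj p)
  inv : ∀ f, σ (σ f) = f

variable {σ : P2 CX →+* P2 CX}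

/-- reduction at a real point -/
lemma AInv.red (hσ : AInv σ) {a : ℂ} (ha : starRingEnd ℂ a = a) :
    ∃ s : P2 ℂ →+* P2 ℂ, (∀ c, s (C c) = C (starRingEnd ℂ c)) ∧ ∀ f, s (ev a f) = ev a (σ f) := by
  refine ⟨eval₂Hom ((C : ℂ →+* P2 ℂ).comp (starRingEnd ℂ)) (fun i => ev a (σ (X i))), ?_, ?_⟩
  · intro c; simp
  · intro f
    have : (eval₂Hom ((C : ℂ →+* P2 ℂ).comp (starRingEnd ℂ)) (fun i => ev a (σ (X i)))).comp (ev a) =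
        (ev a).comp σ := by
      apply MvPolynomial.ringHom_ext
      · intro r
        simp only [RingHom.comp_apply, map_C, coe_eval₂Hom, eval₂_C, hσ.onC]
        congr 1
        simp only [Polynomial.coe_evalRingHom, Polynomial.coe_mapRingHom]
        conv_rhs => rw [← ha]
        rw [Polynomial.eval_map, Polynomial.eval₂_hom]
      · intro i; simp
    exact DFunLike.congr_fun this f

lemma semi_aeval (s : P2 ℂ →+* P2 ℂ) (hs : ∀ c, s (C c) = C (starRingEnd ℂ c)) (A B G : P2 ℂ) :
    s (aeval ![A, B] G) = aeval ![s A, s B] (map (starRingEnd ℂ) G) := by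
  have : s.comp ((aeval ![A, B] : P2 ℂ →ₐ[ℂ] P2 ℂ) : P2 ℂ →+* P2 ℂ) =
      ((aeval ![s A, s B] : P2 ℂ →ₐ[ℂ] P2 ℂ) : P2 ℂ →+* P2 ℂ).comp (map (starRingEnd ℂ)) := by
    apply MvPolynomial.ringHom_ext
    · intro r; simp [algebraMap_eq, hs]
    · intro i; fin_cases i <;> simp
  exact DFunLike.congr_fun this G

/-- real interpolation -/
lemma real_interp (a μ : ℂ) (h : starRingEnd ℂ a = a → starRingEnd ℂ μ = μ) :
    ∃ r : CX, cj r = r ∧ r.eval a = μ := by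
  by_cases ha : starRingEnd ℂ a = a
  · exact ⟨Polynomial.C μ, by simp [h ha], by simp⟩
  · have him : a.im ≠ 0 := fun h0 => ha (Complex.conj_eq_iff_im.2 h0)
    let β : ℝ := μ.im / a.im
    let α : ℝ := μ.re - β * a.re
    refine ⟨Polynomial.C (α : ℂ) + Polynomial.C (β : ℂ) * Polynomial.X, by simp, ?_⟩
    simp only [Polynomial.eval_add, Polynomial.eval_C, Polynomial.eval_mul, Polynomial.eval_X]
    apply Complex.ext
    · simp [α]
    · simp [β]; field_simp

lemma step_form (hσ : AInv σ) (a : ℂ) {u v : P2 CX} (hu : σ u = u) (hv : σ v = v) {G : P2 ℂ}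
    (hL : LNJ G) (hG : aeval ![ev a u, ev a v] G = 0) (hn : 1 ≤ degreeOf 0 G) {s : ℕ} {c μ : ℂ} (hs : 1 ≤ s)
    (hc : c ≠ 0) (hF : Form G (degreeOf 0 G) s c μ) (hdeg : degreeOf 1 G = s * degreeOf 0 G) :
    (∃ e, ev a v = C e) ∨ ∃ (u' : P2 CX) (G' : P2 ℂ), σ u' = u' ∧
      Algebra.adjoin CX {u', v} = Algebra.adjoin CX {u, v} ∧ G' ≠ 0 ∧ LNJ G' ∧
      aeval ![ev a u', ev a v] G' = 0 ∧ degreeOf 0 G' + degreeOf 1 G' < degreeOf 0 G + degreeOf 1 G := by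
  have hG0 : G ≠ 0 := ne_zero_of_degreeOf_ne_zero (i := 0) (by omega)
  by_cases hre : starRingEnd ℂ a = a → starRingEnd ℂ μ = μ
  · right
    obtain ⟨r, hr, hra⟩ := real_interp a μ hre
    obtain ⟨T, hT0, hT1⟩ := exists_shift (Polynomial.C μ * Polynomial.X ^ s : Polynomial ℂ)
    have hTe : ∀ f, T f = aeval ![X 0 + C μ * X 1 ^ s, X 1] f := by
      have : (T : P2 ℂ →ₐ[ℂ] P2 ℂ) = aeval ![X 0 + C μ * X 1 ^ s, X 1] := by
        apply MvPolynomial.algHom_ext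
        intro i; fin_cases i
        · simp [hT0, algebraMap_eq]
        · simp [hT1]
      exact fun f => DFunLike.congr_fun this f
    refine ⟨u - C r * v ^ s, T G, ?_, ?_, ?_, ?_, ?_, ?_⟩
    · simp [hu, hv, hσ.onC]
      rw [Polynomial.coe_mapRingHom] at hr; left; exact hr
    · apply le_antisymm
      · exact pair_le (sub_mem (left_mem u v) (mul_mem (C_mem _ _) (pow_mem (right_mem u v) _))) (right_mem u v)
      · refine pair_le ?_ (right_mem _ v)
        have := add_mem (left_mem (u - C r * v ^ s) v) (mul_mem (C_mem (Algebra.adjoin CX {u - C r * v ^ s, v}) r) (pow_mem (right_mem (u - C r * v ^ s) v) s))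
        simpa using this
    · simpa using hG0
    · refine LNJ_equiv T 1 ?_ hL
      rw [hT1, jacD_X1, hT0]
      simp [algebraMap_eq, pderiv_X_of_ne (show (1 : Fin 2) ≠ 0 by decide), Derivation.leibniz_pow]
    · rw [hTe, ← hG]
      have : (aeval ![ev a (u - C r * v ^ s), ev a v] : P2 ℂ →ₐ[ℂ] P2 ℂ).comp
          (aeval ![X 0 + C μ * X 1 ^ s, X 1]) = aeval ![ev a u, ev a v] := by
        apply MvPolynomial.algHom_ext
        intro i; fin_cases i
        · simp [algebraMap_eq, hra]
        · simp
      exact DFunLike.congr_fun this G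
    · obtain ⟨d0, d1⟩ := form_shift hF hs hn
      rw [← hTe] at d0 d1
      omega
  · left
    push Not at hre
    obtain ⟨ha, hμ⟩ := hre
    obtain ⟨t, ht, hte⟩ := hσ.red ha
    have hG' : aeval ![ev a u, ev a v] (map (starRingEnd ℂ) G) = 0 := by
      have := semi_aeval t ht (ev a u) (ev a v) G
      rwa [hG, map_zero, hte, hte, hu, hv, eq_comm] at this
    have hb := fun i => real_mu i hF (form_map _ hF) hs hn hc (by simpa using hc) hμ.symm hG hG'
    exact const_of_degreeOf (hb 0) (hb 1)

lemma inner (hσ : AInv σ) (a : ℂ) : ∀ (N : ℕ) (u v : P2 CX) (G : P2 ℂ), σ u = u → σ v = v →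
    G ≠ 0 → LNJ G → aeval ![ev a u, ev a v] G = 0 → degreeOf 0 G + degreeOf 1 G = N →
    ∃ u' v', σ u' = u' ∧ σ v' = v' ∧ Algebra.adjoin CX {u', v'} = Algebra.adjoin CX {u, v} ∧
      ∃ e, ev a u' = C e := by
  intro N
  induction N using Nat.strong_induction_on with
  | _ N ih =>
  intro u v G hu hv hG0 hL hG hN
  have hsG : aeval ![ev a v, ev a u] (swp ℂ G) = 0 := by rw [aeval_swp, hG]
  have hsG0 : swp ℂ G ≠ 0 := by simpa using hG0
  by_cases h0 : degreeOf 0 G = 0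
  · obtain ⟨e, he⟩ := const_of_G hG0 h0 hG
    exact ⟨v, u, hv, hu, by rw [Set.pair_comm], e, he⟩
  by_cases h1 : degreeOf 1 G = 0
  · obtain ⟨e, he⟩ := const_of_G hsG0 (by rw [degreeOf_swp, h1]) hsG
    exact ⟨u, v, hu, hv, rfl, e, he⟩
  obtain ⟨s, c, μ, hs, hc, hμ, h | ⟨hs2, hF, hdeg⟩⟩ := lemJ G hL (by omega) (by omega)
  · obtain ⟨hF, hdeg⟩ := h
    obtain ⟨e, he⟩ | ⟨u', G', b1, b2, b3, b4, b5, b6⟩ := step_form hσ a hu hv hL hG (by omega) hs hc hF hdeg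
    · exact ⟨v, u, hv, hu, by rw [Set.pair_comm], e, he⟩
    · obtain ⟨u1, v1, c1, c2, c3, c4⟩ := ih _ (by omega) u' v G' b1 hv b3 b4 b5 rfl
      exact ⟨u1, v1, c1, c2, by rw [c3, b2], c4⟩
  · rw [← degreeOf_swp] at hF
    have hLs : LNJ (swp ℂ G) := by
      refine LNJ_equiv (swp ℂ) (-1) ?_ hL
      rw [swp_X0, swp_X1, jacD_swap, jac_XX]; simp
    obtain ⟨e, he⟩ | ⟨u', G', b1, b2, b3, b4, b5, b6⟩ := step_form hσ a hv hu hLs hsG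
      (by rw [degreeOf_swp]; omega) hs hc hF (by rw [degreeOf_swp, degreeOf_swp', hdeg])
    · exact ⟨u, v, hu, hv, rfl, e, he⟩
    · rw [degreeOf_swp, degreeOf_swp'] at b6
      obtain ⟨u1, v1, c1, c2, c3, c4⟩ := ih _ (by omega) u' u G' b1 hu b3 b4 b5 rfl
      exact ⟨u1, v1, c1, c2, by rw [c3, b2, Set.pair_comm], c4⟩

end KR

set_option linter.unusedSectionVars false

namespace KR
open MvPolynomial

lemma map_aeval2 {R S : Type*} [CommRing R] [CommRing S] (ρ : R →+* S) (u v f : P2 R) :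
    map ρ (aeval ![u, v] f) = aeval ![map ρ u, map ρ v] (map ρ f) := by
  have : (map ρ).comp ((aeval ![u, v] : P2 R →ₐ[R] P2 R) : P2 R →+* P2 R) =
      ((aeval ![map ρ u, map ρ v] : P2 S →ₐ[S] P2 S) : P2 S →+* P2 S).comp (map ρ) := by
    apply MvPolynomial.ringHom_ext
    · intro r; simp [algebraMap_eq]
    · intro i; fin_cases i <;> simp
  exact DFunLike.congr_fun this f

lemma frac_inj {R : Type*} [CommRing R] [IsDomain R] {u v : P2 R} {q : R} (hq : q ≠ 0)
    (h : ∀ i, C q * X i ∈ Algebra.adjoin R {u, v}) :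
    Function.Injective (aeval ![u, v] : P2 R →ₐ[R] P2 R) := by
  let K := FractionRing R
  let ρ : R →+* K := algebraMap R K
  have hρ : Function.Injective ρ := IsFractionRing.injective R K
  have hρq : ρ q ≠ 0 := fun h => hq (hρ (by rw [h, map_zero]))
  have hr : (aeval ![map ρ u, map ρ v] : P2 K →ₐ[K] P2 K).range = ⊤ := by
    rw [eq_top_iff, ← MvPolynomial.adjoin_range_X]
    apply Algebra.adjoin_le
    rintro _ ⟨i, rfl⟩
    obtain ⟨ζ, hζ⟩ := mem_pair.1 (h i)
    refine ⟨C (ρ q)⁻¹ * map ρ ζ, ?_⟩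
    have h2 := map_aeval2 ρ u v ζ
    rw [hζ] at h2
    change aeval ![map ρ u, map ρ v] (C (ρ q)⁻¹ * map ρ ζ) = X i
    rw [map_mul, ← h2, map_mul, map_C, map_X, ← algebraMap_eq, AlgHom.commutes, algebraMap_eq,
      ← mul_assoc, ← C_mul, inv_mul_cancel₀ hρq, C_1, one_mul]
  have hs := (AlgHom.range_eq_top _).1 hr
  have hi := noeth_inj ((aeval ![map ρ u, map ρ v] : P2 K →ₐ[K] P2 K) : P2 K →+* P2 K) hs
  intro f g hfg
  apply map_injective ρ hρ
  apply hi
  have := congrArg (map ρ) hfg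
  rw [map_aeval2, map_aeval2] at this
  exact this

lemma eq_C_of_dvd_C {R : Type*} [CommRing R] [IsDomain R] {f : P2 R} {a : R} (ha : a ≠ 0) (h : f ∣ C a) :
    ∃ c, c ≠ 0 ∧ f = C c := by
  obtain ⟨g, hg⟩ := h
  have hne : f * g ≠ 0 := by rw [← hg]; simpa using ha
  have h1 := totalDegree_mul_of_isDomain (left_ne_zero_of_mul hne) (right_ne_zero_of_mul hne)
  rw [← hg, totalDegree_C] at h1
  have h2 := totalDegree_eq_zero_iff_eq_C.1 (show f.totalDegree = 0 by omega)
  refine ⟨_, ?_, h2⟩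
  intro h0
  rw [h0, C_0] at h2
  exact left_ne_zero_of_mul hne h2

lemma LNJ_good {R : Type*} [CommRing R] [IsDomain R] {u v : P2 R} {q J : R} (hq : q ≠ 0)
    (h : ∀ i, C q * X i ∈ Algebra.adjoin R {u, v}) (hJ0 : J ≠ 0) (hJ : jacD u v = C J) (i : Fin 2)
    (ζ : P2 R) (hζ : aeval ![u, v] ζ = C q * X i) : LNJ ζ := by
  have hi := frac_inj hq h
  set φ : P2 R →ₐ[R] P2 R := aeval ![u, v] with hφ
  have hφ0 : φ (X 0) = u := by simp [φ]
  have hφ1 : φ (X 1) = v := by simp [φ]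
  have hφC : ∀ r, φ (C r) = C r := fun r => φ.commutes r
  have key : ∀ (n : ℕ) (f : P2 R), C (J^n) * φ ((jacD ζ)^[n] f) = C (q^n) * (jacD (X i))^[n] (φ f) := by
    intro n
    induction n with
    | zero => intro f; simp
    | succ n ih =>
      intro f
      have h1 : C J * φ (jacD ζ f) = C q * jacD (X i) (φ f) := by
        have h2 := jac_chain φ ζ f
        rw [hφ0, hφ1, hJ, hζ] at h2
        rw [mul_comm, ← h2]
        simp only [jacD_apply, pderiv_C_mul]
        ring
      have h3 := ih (jacD ζ f)
      rw [Function.iterate_succ_apply, Function.iterate_succ_apply, pow_succ, C_mul, mul_assoc,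
        mul_left_comm, h3, mul_left_comm, ← smul_eq_C_mul _ J, ← iter_smul, smul_eq_C_mul, h1,
        ← smul_eq_C_mul _ q, iter_smul, smul_eq_C_mul, pow_succ, C_mul]
      ring
  intro j
  have hXi : LNJ (X i : P2 R) := by
    fin_cases i
    · have := LNJ_of_unit (swp R) (-1) (by rw [swp_X0, swp_X1, jacD_swap, jac_XX]; simp)
      rwa [swp_X1] at this
    · exact LNJ_of_unit (AlgEquiv.refl (R := R)) 1 (by simpa using jac_XX)
  obtain ⟨n, hn⟩ := hXi.nil (φ (X j))
  refine ⟨n, ?_⟩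
  have := key n (X j)
  rw [hn, mul_zero, mul_eq_zero] at this
  rcases this with h | h
  · rw [C_eq_zero] at h; exact absurd h (pow_ne_zero _ hJ0)
  · apply hi; rw [h, map_zero]

variable {σ : P2 CX →+* P2 CX}

theorem step2_good (hσ : AInv σ) : ∀ (N : ℕ) (u v : P2 CX) (J q : CX), σ u = u → σ v = v → q ≠ 0 →
    (∀ i, C q * X i ∈ Algebra.adjoin CX {u, v}) → jacD u v = C J → J.natDegree = N →
    ∃ S : P2 CX ≃ₐ[CX] P2 CX, σ (S (X 0)) = S (X 0) ∧ σ (S (X 1)) = S (X 1) := by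
  intro N
  induction N using Nat.strong_induction_on with
  | _ N ih =>
  intro u v J q₀ hu hv hq₀ hmem₀ hJ hN
  have hJ0 : J ≠ 0 := by
    rintro rfl
    have := jac_dvd (hmem₀ 0) (hmem₀ 1)
    rw [hJ, C_0, zero_dvd_iff, jacD_apply] at this
    simp only [pderiv_C_mul, pderiv_X_self, pderiv_X_of_ne (show (1 : Fin 2) ≠ 0 by decide),
      pderiv_X_of_ne (show (0 : Fin 2) ≠ 1 by decide)] at this
    simp [hq₀, smul_eq_C_mul] at this
  classical
  have hex : ∃ n, ∃ q : CX, q ≠ 0 ∧ (∀ i, C q * X i ∈ Algebra.adjoin CX {u, v}) ∧ q.natDegree = n :=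
    ⟨_, q₀, hq₀, hmem₀, rfl⟩
  obtain ⟨q, hq, hmem, hdeg⟩ := Nat.find_spec hex
  have hmin := fun n => Nat.find_min hex (m := n)
  rw [← hdeg] at hmin
  by_cases hd0 : q.natDegree = 0
  · rw [Polynomial.eq_C_of_natDegree_eq_zero hd0] at hmem hq
    set c := q.coeff 0
    have hc : c ≠ 0 := by simpa using hq
    have hX : ∀ i, X i ∈ Algebra.adjoin CX {u, v} := by
      intro i
      have := mul_mem (C_mem (Algebra.adjoin CX {u, v}) (Polynomial.C c⁻¹)) (hmem i)
      rwa [← mul_assoc, ← C_mul, ← Polynomial.C_mul, inv_mul_cancel₀ hc, Polynomial.C_1, C_1, one_mul] at this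
    obtain ⟨S, h0, h1⟩ := exists_equiv u v (hX 0) (hX 1)
    exact ⟨S, by rw [h0, hu], by rw [h1, hv]⟩
  obtain ⟨a, ha⟩ := IsAlgClosed.exists_root q (by
    intro h; rw [Polynomial.degree_eq_natDegree hq] at h; exact hd0 (by exact_mod_cast h))
  obtain ⟨q', hq'⟩ := Polynomial.dvd_iff_isRoot.2 ha
  have hq'0 : q' ≠ 0 := by rintro rfl; simp at hq'; exact hq hq'
  have hdq : q.natDegree = 1 + q'.natDegree := by
    rw [hq', Polynomial.natDegree_mul (Polynomial.X_sub_C_ne_zero a) hq'0, Polynomial.natDegree_X_sub_C]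
  have hnot := hmin q'.natDegree (by omega)
  push Not at hnot
  have hnot2 : ∃ i, C q' * X i ∉ Algebra.adjoin CX {u, v} := by
    by_contra hcon
    push Not at hcon
    exact hnot q' hq'0 hcon rfl
  obtain ⟨i, hi⟩ := hnot2
  obtain ⟨ζ, hζ⟩ := mem_pair.1 (hmem i)
  have hG0 : ev a ζ ≠ 0 := by
    intro h
    obtain ⟨ζ', rfl⟩ := dvd_of_ev h
    apply hi
    rw [mem_pair]
    refine ⟨ζ', ?_⟩
    rw [map_mul, ← algebraMap_eq, AlgHom.commutes, algebraMap_eq, hq', C_mul, mul_assoc] at hζ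
    exact mul_left_cancel₀ (C_ne_zero.2 (Polynomial.X_sub_C_ne_zero a)) hζ
  have hGe : aeval ![ev a u, ev a v] (ev a ζ) = 0 := by
    rw [← ev_aeval, hζ, map_mul, map_C, Polynomial.coe_evalRingHom, ha.eq_zero]; simp
  have hL : LNJ (ev a ζ) := (LNJ_good hq hmem hJ0 hJ i ζ hζ).map _
  obtain ⟨u', v', hu', hv', hadj, e, he⟩ := inner hσ a _ u v _ hu hv hG0 hL hGe rfl
  obtain ⟨r, hr, hra⟩ := real_interp a e (by
    intro hreal
    obtain ⟨t, ht, hte⟩ := hσ.red hreal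
    have := hte u'
    rw [hu', he, ht] at this
    exact C_injective _ _ this)
  have hfix : σ (u' - C r) = u' - C r := by rw [map_sub, hu', hσ.onC, hr]
  have hdvd : C (Polynomial.X - Polynomial.C a) ∣ u' - C r := by
    apply dvd_of_ev
    rw [map_sub, he, map_C, Polynomial.coe_evalRingHom, hra, sub_self]
  obtain ⟨p, hp, hpd, hpdvd⟩ : ∃ p : CX, cj p = p ∧ 1 ≤ p.natDegree ∧ C p ∣ u' - C r := by
    by_cases hreal : starRingEnd ℂ a = a
    · exact ⟨_, by simp [hreal], by simp, hdvd⟩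
    · refine ⟨(Polynomial.X - Polynomial.C a) * (Polynomial.X - Polynomial.C (starRingEnd ℂ a)), ?_, ?_, ?_⟩
      · rw [map_mul]; simp [mul_comm]
      · rw [Polynomial.natDegree_mul (Polynomial.X_sub_C_ne_zero _) (Polynomial.X_sub_C_ne_zero _)]; simp
      · have h2 : C (Polynomial.X - Polynomial.C (starRingEnd ℂ a)) ∣ u' - C r := by
          have := map_dvd σ hdvd
          rwa [hfix, hσ.onC, show cj (Polynomial.X - Polynomial.C a) =
            Polynomial.X - Polynomial.C (starRingEnd ℂ a) by simp] at this
        rw [C_dvd_iff_dvd_coeff] at hdvd h2 ⊢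
        intro j
        refine IsCoprime.mul_dvd ?_ (hdvd j) (h2 j)
        exact Polynomial.isCoprime_X_sub_C_of_isUnit_sub (by
          rw [isUnit_iff_ne_zero]; exact sub_ne_zero.2 (Ne.symm hreal))
  obtain ⟨w, hw⟩ := hpdvd
  have hp0 : p ≠ 0 := by rintro rfl; simp at hpd
  have hwfix : σ w = w := by
    have h3 := hfix
    rw [hw, map_mul, hσ.onC, hp] at h3
    exact mul_left_cancel₀ (by simpa using hp0) h3
  have hu'e : u' = C p * w + C r := by rw [← hw]; ring
  have hle : Algebra.adjoin CX {u, v} ≤ Algebra.adjoin CX {w, v'} := by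
    rw [← hadj]
    refine pair_le ?_ (right_mem _ _)
    rw [hu'e]
    exact add_mem (mul_mem (C_mem _ _) (left_mem _ _)) (C_mem _ _)
  have hJ' : jacD u' v' ∣ C J := by
    rw [← hJ]
    apply jac_dvd
    · rw [hadj]; exact left_mem _ _
    · rw [hadj]; exact right_mem _ _
  have hJ'' : jacD u' v' = C p * jacD w v' := by
    rw [hu'e]
    simp only [jacD_apply, map_add, pderiv_C_mul, pderiv_C, smul_eq_C_mul]; ring
  obtain ⟨J1, hJ10, hJ1⟩ := eq_C_of_dvd_C hJ0 (dvd_trans (Dvd.intro_left _ hJ''.symm) hJ')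
  refine ih J1.natDegree ?_ w v' J1 q hwfix hv' hq (fun i => hle (hmem i)) hJ1 rfl
  rw [hJ'', hJ1, ← C_mul] at hJ'
  have h5 : p * J1 ∣ J := by
    obtain ⟨g, hg⟩ := hJ'
    refine ⟨coeff 0 g, ?_⟩
    have := congrArg (coeff 0) hg
    rwa [coeff_zero_C, coeff_C_mul] at this
  have h6 := Polynomial.natDegree_le_of_dvd h5 hJ0
  rw [Polynomial.natDegree_mul hp0 hJ10] at h6
  omega

end KR

set_option linter.unusedSectionVars false

namespace KR
open MvPolynomial

lemma clear_den {R K : Type*} [CommRing R] [IsDomain R] [Field K] [Algebra R K] [IsFractionRing R K]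
    (f : P2 K) : ∃ r : R, r ≠ 0 ∧ ∃ g : P2 R, C (algebraMap R K r) * f = map (algebraMap R K) g := by
  induction f using MvPolynomial.induction_on with
  | C a =>
    obtain ⟨x, y, hy, rfl⟩ := IsFractionRing.div_surjective (A := R) a
    have hy0 : y ≠ 0 := nonZeroDivisors.ne_zero hy
    refine ⟨y, hy0, C x, ?_⟩
    have : algebraMap R K y ≠ 0 := by
      rwa [Ne, IsFractionRing.to_map_eq_zero_iff]
    rw [map_C, ← C_mul, mul_div_cancel₀ _ this]
  | add p q hp hq =>
    obtain ⟨r, hr, g, hg⟩ := hp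
    obtain ⟨r', hr', g', hg'⟩ := hq
    refine ⟨r * r', mul_ne_zero hr hr', C r' * g + C r * g', ?_⟩
    simp only [map_add, map_mul, ← hg, ← hg', map_C]; ring
  | mul_X p i hp =>
    obtain ⟨r, hr, g, hg⟩ := hp
    refine ⟨r, hr, g * X i, ?_⟩
    rw [map_mul, ← hg, map_X]; ring

theorem step2 {σ : P2 CX →+* P2 CX} (hσ : AInv σ) :
    ∃ S : P2 CX ≃ₐ[CX] P2 CX, σ (S (X 0)) = S (X 0) ∧ σ (S (X 1)) = S (X 1) := by
  let K := FractionRing CX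
  let ρ : CX →+* K := algebraMap CX K
  have hρ : Function.Injective ρ := IsFractionRing.injective CX K
  have hmρ : Function.Injective (map ρ : P2 CX →+* P2 K) := map_injective ρ hρ
  have hcz : CharZero K := charZero_of_injective_ringHom hρ
  have hcj : Function.Injective cj := Function.LeftInverse.injective (g := cj) cj_cj
  let τ : K →+* K := IsFractionRing.map hcj
  have hτρ : ∀ p, τ (ρ p) = ρ (cj p) := fun p => IsLocalization.map_eq _ p
  have hττ : ∀ a, τ (τ a) = a := by
    intro a
    obtain ⟨x, y, -, rfl⟩ := IsFractionRing.div_surjective (A := CX) a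
    have h1 : ∀ p, τ (algebraMap CX K p) = algebraMap CX K (cj p) := hτρ
    rw [map_div₀, map_div₀, h1, h1, h1, h1, cj_cj, cj_cj]
  have hii : τ (ρ (Polynomial.C Complex.I)) = - ρ (Polynomial.C Complex.I) := by
    rw [hτρ, ← map_neg]; congr 1; simp
  have hii0 : ρ (Polynomial.C Complex.I) ≠ 0 := by
    intro h
    have : Polynomial.C Complex.I = 0 := hρ (by rw [h, map_zero])
    simp at this
  let σK : P2 K →+* P2 K := eval₂Hom ((C : K →+* P2 K).comp τ) (fun i => map ρ (σ (X i)))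
  have hσKC : ∀ a, σK (C a) = C (τ a) := by intro a; simp [σK]
  have hσKρ : ∀ f, σK (map ρ f) = map ρ (σ f) := by
    intro f
    have : σK.comp (map ρ) = (map ρ).comp σ := by
      apply MvPolynomial.ringHom_ext
      · intro r
        rw [RingHom.comp_apply, RingHom.comp_apply, map_C, hσKC, hτρ, hσ.onC, map_C]
      · intro i; simp [σK]
    exact DFunLike.congr_fun this f
  have hσKσK : ∀ f, σK (σK f) = f := by
    intro f
    have : σK.comp σK = RingHom.id _ := by
      apply MvPolynomial.ringHom_ext
      · intro a
        rw [RingHom.comp_apply, hσKC, hσKC, hττ]; rfl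
      · intro i
        rw [RingHom.comp_apply, ← map_X ρ, hσKρ, hσKρ, hσ.inv]; rfl
    exact DFunLike.congr_fun this f
  obtain ⟨S, hS0, hS1⟩ := step1 τ hττ _ hii hii0 _ _ σK hσKC hσKσK rfl rfl
  obtain ⟨r, hr, g0, hg0⟩ := clear_den (R := CX) (S (X 0))
  obtain ⟨r', hr', g1, hg1⟩ := clear_den (R := CX) (S (X 1))
  have hcj0 : ∀ p, p ≠ 0 → cj p ≠ 0 := fun p hp h => hp (hcj (by rw [h, map_zero]))
  set R0 : CX := r * r' * cj (r * r') with hR0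
  have hR00 : R0 ≠ 0 := mul_ne_zero (mul_ne_zero hr hr') (hcj0 _ (mul_ne_zero hr hr'))
  have hR0c : cj R0 = R0 := by rw [hR0, map_mul, cj_cj, mul_comm]
  have real : ∀ (f : P2 K) (g : P2 CX), σK f = f → C (ρ R0) * f = map ρ g → σ g = g := by
    intro f g hf hg
    apply hmρ
    rw [← hσKρ, ← hg, map_mul, hσKC, hτρ, hR0c, hf]
  have hu : C (ρ R0) * S (X 0) = map ρ (C (r' * cj (r * r')) * g0) := by
    have : map ρ g0 = C (ρ r) * S (X 0) := hg0.symm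
    simp only [map_mul, this, map_C, hR0]; ring
  have hv : C (ρ R0) * S (X 1) = map ρ (C (r * cj (r * r')) * g1) := by
    have : map ρ g1 = C (ρ r') * S (X 1) := hg1.symm
    simp only [map_mul, this, map_C, hR0]; ring
  set u := C (r' * cj (r * r')) * g0
  set v := C (r * cj (r * r')) * g1
  have hρR0 : ρ R0 ≠ 0 := fun h => hR00 (hρ (by rw [h, map_zero]))
  have hq : ∀ i, ∃ q : CX, q ≠ 0 ∧ C q * X i ∈ Algebra.adjoin CX {u, v} := by
    intro i
    let T : P2 K →ₐ[K] P2 K := aeval (fun j => C (ρ R0)⁻¹ * X j)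
    have hT : (aeval ![map ρ u, map ρ v] : P2 K →ₐ[K] P2 K).comp T = (S : P2 K →ₐ[K] P2 K) := by
      apply MvPolynomial.algHom_ext
      intro j
      fin_cases j
      · simp only [T, AlgHom.comp_apply, aeval_X, map_mul]
        rw [← algebraMap_eq, AlgHom.commutes]
        simp only [Fin.zero_eta, aeval_X, Matrix.cons_val_zero]
        rw [← hu, algebraMap_eq, ← mul_assoc, ← C_mul, inv_mul_cancel₀ hρR0, C_1, one_mul]; rfl
      · simp only [T, AlgHom.comp_apply, aeval_X, map_mul]
        rw [← algebraMap_eq, AlgHom.commutes]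
        simp only [Fin.mk_one, aeval_X, Matrix.cons_val_one, Matrix.cons_val_fin_one]
        rw [← hv, algebraMap_eq, ← mul_assoc, ← C_mul, inv_mul_cancel₀ hρR0, C_1, one_mul]; rfl
    have hTi : aeval ![map ρ u, map ρ v] (T (S.symm (X i))) = X i := by
      have h1 := DFunLike.congr_fun hT (S.symm (X i))
      exact h1.trans (S.apply_symm_apply _)
    obtain ⟨q, hq0, g, hg⟩ := clear_den (R := CX) (T (S.symm (X i)))
    refine ⟨q, hq0, ?_⟩
    rw [mem_pair]
    refine ⟨g, hmρ ?_⟩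
    have hg' : map ρ g = C (ρ q) * T (S.symm (X i)) := hg.symm
    rw [map_aeval2, hg', map_mul, hTi, ← algebraMap_eq, AlgHom.commutes]
    simp [algebraMap_eq]
  choose q hq0 hqm using hq
  have hm : ∀ i, C (q 0 * q 1) * X i ∈ Algebra.adjoin CX {u, v} := by
    intro i
    fin_cases i
    · have := mul_mem (C_mem (Algebra.adjoin CX {u, v}) (q 1)) (hqm 0)
      simp only [Fin.zero_eta]
      rwa [← mul_assoc, ← C_mul, mul_comm (q 1)] at this
    · have := mul_mem (C_mem (Algebra.adjoin CX {u, v}) (q 0)) (hqm 1)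
      simp only [Fin.mk_one]
      rwa [← mul_assoc, ← C_mul] at this
  have hq00 := mul_ne_zero (hq0 0) (hq0 1)
  have hdvd := jac_dvd (hm 0) (hm 1)
  have : jacD (C (q 0 * q 1) * X 0 : P2 CX) (C (q 0 * q 1) * X 1) = C ((q 0 * q 1)^2) := by
    simp only [jacD_apply, pderiv_C_mul, pderiv_X_self, pderiv_X_of_ne (show (1 : Fin 2) ≠ 0 by decide),
      pderiv_X_of_ne (show (0 : Fin 2) ≠ 1 by decide), C_pow]
    ring
  rw [this] at hdvd
  obtain ⟨J, -, hJ⟩ := eq_C_of_dvd_C (pow_ne_zero 2 hq00) hdvd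
  exact step2_good hσ _ u v J _ (real _ _ hS0 hu) (real _ _ hS1 hv) hq00 hm hJ rfl

end KR

set_option linter.unusedSectionVars false

namespace KR

lemma exists_sqrt_poly (d : ℕ) : ∃ h : Polynomial ℚ, h.coeff 0 = 1 ∧
    Polynomial.X ^ d ∣ h ^ 2 - (1 + Polynomial.X) := by
  suffices H : ∃ h : Polynomial ℚ, h.coeff 0 = 1 ∧ Polynomial.X ^ (d+1) ∣ h ^ 2 - (1 + Polynomial.X) by
    obtain ⟨h, h1, h2⟩ := H
    exact ⟨h, h1, dvd_trans (pow_dvd_pow _ (by omega)) h2⟩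
  induction d with
  | zero => exact ⟨1, by simp, ⟨-1, by ring⟩⟩
  | succ d ih =>
    obtain ⟨h, h1, g, hg⟩ := ih
    refine ⟨h - Polynomial.C (g.coeff 0 / 2) * Polynomial.X ^ (d+1), by simp [h1], ?_⟩
    have e1 : (h - Polynomial.C (g.coeff 0 / 2) * Polynomial.X ^ (d+1)) ^ 2 - (1 + Polynomial.X) =
        Polynomial.X ^ (d+1) * (g - Polynomial.C (g.coeff 0) * h) +
          Polynomial.X ^ (d+1+1) * (Polynomial.C (g.coeff 0 / 2) ^ 2 * Polynomial.X ^ d) := by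
      have e2 : Polynomial.C (g.coeff 0) = 2 * Polynomial.C (g.coeff 0 / 2) := by
        rw [show (2 : Polynomial ℚ) = Polynomial.C 2 from rfl, ← Polynomial.C_mul]; congr 1; ring
      have e3 : h ^ 2 = (1 + Polynomial.X) + Polynomial.X ^ (d+1) * g := by rw [← hg]; ring
      rw [e2, sub_sq, e3]; ring
    rw [e1]
    refine dvd_add ?_ (Dvd.intro _ rfl)
    rw [pow_succ _ (d+1)]
    apply mul_dvd_mul_left
    rw [Polynomial.X_dvd_iff]
    simp [h1]

section Sqrt
variable {M : Type*} [CommRing M] [Algebra ℚ M] (e : M) (d : ℕ)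

lemma dvd_of_two {j : ℕ} {a : M} (h : e ^ j ∣ a + a) : e ^ j ∣ a := by
  obtain ⟨b, hb⟩ := h
  refine ⟨(2⁻¹ : ℚ) • b, ?_⟩
  rw [mul_smul_comm, ← hb, ← two_smul ℚ a, smul_smul]; norm_num

/-- abstract square root of a unipotent automorphism -/
lemma exists_sqrt (θ : M ≃+* M) (hθe : θ e = e) (hθ : ∀ a, e ∣ θ a - a) :
    ∃ R : M →ₗ[ℚ] M, (∀ p a, (∀ b, θ (p * b) = p * θ b) → R (p * a) = p * R a) ∧
      (∀ a, θ a = a → R a = a) ∧ (∀ a, e ∣ R a - a) ∧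
      (∀ a, e ^ d ∣ R (R a) - θ a) ∧ (∀ a b, e ^ d ∣ R (a * b) - R a * R b) ∧
      (∀ I : Submodule ℚ M, (∀ a ∈ I, θ a ∈ I) → ∀ a ∈ I, R a ∈ I) ∧
      (∀ c : M →+* M, (∀ a, c (c a) = a) → c e = e → (∀ a, c (θ (c (θ a))) = a) →
        ∀ a, e ^ d ∣ R (c (R (c a))) - a) := by
  obtain ⟨h, h0, g, hg⟩ := exists_sqrt_poly d
  let θl : M →ₗ[ℚ] M := (θ : M →+* M).toAddMonoidHom.toRatLinearMap
  have hθl : ∀ a, θl a = θ a := fun a => rfl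
  let N : Module.End ℚ M := θl - 1
  have hN : ∀ a, N a = θ a - a := fun a => rfl
  let R : Module.End ℚ M := Polynomial.aeval N h
  -- general facts about polynomials in an endomorphism raising order
  have pol_e : ∀ (N' : Module.End ℚ M) (p : M), (∀ a, N' (p * a) = p * N' a) → ∀ (f : Polynomial ℚ) a,
      Polynomial.aeval N' f (p * a) = p * Polynomial.aeval N' f a := by
    intro N' p hp f
    induction f using Polynomial.induction_on' with
    | add f g hf hg => intro a; simp only [map_add, LinearMap.add_apply, hf, hg]; ring
    | monomial n r =>
      intro a
      rw [Polynomial.aeval_monomial]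
      have : ∀ (n : ℕ) a, (N' ^ n) (p * a) = p * (N' ^ n) a := by
        intro n
        induction n with
        | zero => intro a; simp
        | succ n ih => intro a; rw [pow_succ, Module.End.mul_apply, hp, ih]; rfl
      rw [Module.End.mul_apply, Module.End.mul_apply, this, Module.algebraMap_end_apply,
        Module.algebraMap_end_apply, mul_smul_comm]
  have pol_sub : ∀ (N' : Module.End ℚ M) (I : Submodule ℚ M), (∀ a ∈ I, N' a ∈ I) → ∀ (f : Polynomial ℚ),
      ∀ a ∈ I, Polynomial.aeval N' f a ∈ I := by
    intro N' I hI f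
    induction f using Polynomial.induction_on' with
    | add f g hf hg => intro a ha; simp only [map_add, LinearMap.add_apply]; exact add_mem (hf a ha) (hg a ha)
    | monomial n r =>
      intro a ha
      rw [Polynomial.aeval_monomial, Module.End.mul_apply, Module.algebraMap_end_apply]
      apply I.smul_mem
      have : ∀ n, (N' ^ n) a ∈ I := by
        intro n
        induction n with
        | zero => simpa using ha
        | succ n ih => rw [pow_succ']; exact hI _ ih
      exact this n
  have pow_dvd : ∀ (N' : Module.End ℚ M), (∀ a, N' (e * a) = e * N' a) → (∀ a, e ∣ N' a) →
      ∀ (n : ℕ) a, e ^ n ∣ (N' ^ n) a := by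
    intro N' h1 h2 n
    induction n with
    | zero => intro a; simp
    | succ n ih =>
      intro a
      rw [pow_succ N' n, Module.End.mul_apply]
      obtain ⟨b, hb⟩ := h2 a
      have : (N' ^ n) (e * b) = e * (N' ^ n) b := by
        have := pol_e N' e h1 (Polynomial.X ^ n) b
        simpa using this
      rw [hb, this, pow_succ e n, mul_comm]
      exact mul_dvd_mul_left _ (ih b)
  -- for any such N', h(N') is a square root of 1 + N'
  have sq : ∀ (N' : Module.End ℚ M), (∀ a, N' (e * a) = e * N' a) → (∀ a, e ∣ N' a) →
      ∀ a, e ^ d ∣ Polynomial.aeval N' h (Polynomial.aeval N' h a) - (a + N' a) := by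
    intro N' h1 h2 a
    have h3 := congrArg (fun p => Polynomial.aeval N' p a) hg
    simp only [map_sub, map_pow, map_add, map_one, Polynomial.aeval_X, map_mul] at h3
    rw [pow_two] at h3
    have h4 : Polynomial.aeval N' h (Polynomial.aeval N' h a) - (a + N' a) = (N' ^ d) (Polynomial.aeval N' g a) := h3
    rw [h4]
    exact pow_dvd N' h1 h2 _ _
  have one : ∀ (N' : Module.End ℚ M), (∀ a, N' (e * a) = e * N' a) → (∀ a, e ∣ N' a) →
      ∀ a, e ∣ Polynomial.aeval N' h a - a := by
    intro N' h1 h2 a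
    obtain ⟨g', hg'⟩ : Polynomial.X ∣ h - 1 := by rw [Polynomial.X_dvd_iff]; simp [h0]
    have h3 := congrArg (fun p => Polynomial.aeval N' p a) hg'
    simp only [map_sub, map_one, Polynomial.aeval_X, map_mul] at h3
    have h4 : Polynomial.aeval N' h a - a = N' (Polynomial.aeval N' g' a) := h3
    rw [h4]; exact h2 _
  have hNe : ∀ a, N (e * a) = e * N a := by
    intro a; rw [hN, hN, map_mul, hθe]; ring
  have hNd : ∀ a, e ∣ N a := hθ
  have hRe : ∀ a, R (e * a) = e * R a := pol_e N e hNe h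
  have hRej : ∀ j a, R (e ^ j * a) = e ^ j * R a := by
    intro j
    induction j with
    | zero => intro a; simp
    | succ j ih => intro a; rw [pow_succ, mul_assoc, ih, hRe, mul_assoc]
  have hR1 : ∀ a, e ∣ R a - a := one N hNe hNd
  have hRR : ∀ a, e ^ d ∣ R (R a) - θ a := by
    intro a
    have := sq N hNe hNd a
    rwa [hN, add_sub_cancel] at this
  have hRdvd : ∀ j a, e ^ j ∣ a → e ^ j ∣ R a := by
    rintro j _ ⟨b, rfl⟩; rw [hRej]; exact Dvd.intro _ rfl
  have hR1j : ∀ j a, e ^ j ∣ a → e ^ (j+1) ∣ R a - a := by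
    rintro j _ ⟨b, rfl⟩; rw [hRej, ← mul_sub, pow_succ]; exact mul_dvd_mul_left _ (hR1 b)
  have hfix : ∀ a, θ a = a → R a = a := by
    intro a ha
    obtain ⟨g', hg'⟩ : Polynomial.X ∣ h - 1 := by rw [Polynomial.X_dvd_iff]; simp [h0]
    have hg2 : h = 1 + g' * Polynomial.X := by rw [mul_comm, ← hg']; ring
    have h3 := congrArg (fun p => Polynomial.aeval N p a) hg2
    simp only [map_add, map_one, Polynomial.aeval_X, map_mul] at h3
    have h4 : R a = a + Polynomial.aeval N g' (N a) := h3
    rw [h4, hN, ha, sub_self, map_zero, add_zero]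
  refine ⟨R, ?_, hfix, hR1, hRR, ?_, ?_, ?_⟩
  · intro p a hp
    apply pol_e
    intro b; rw [hN, hN, hp]; ring
  · suffices H : ∀ j, j ≤ d → ∀ a b, e ^ j ∣ R (a * b) - R a * R b from H d le_rfl
    intro j
    induction j with
    | zero => intro _ a b; simp
    | succ j ih =>
      intro hj a b
      have ihj := ih (by omega)
      set δ : M → M → M := fun a b => R (a * b) - R a * R b with hδ
      have ihδ : ∀ a b, e ^ j ∣ δ a b := ihj
      have k1 : e ^ d ∣ δ (R a) (R b) + R (δ a b) := by
        have e1 : δ (R a) (R b) + R (δ a b) = (R (R (a * b)) - θ (a * b)) -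
            ((R (R a) - θ a) * R (R b) + θ a * (R (R b) - θ b)) := by
          simp only [hδ, map_sub, map_mul]; ring
        rw [e1]
        exact dvd_sub (hRR _) (dvd_add (Dvd.dvd.mul_right (hRR _) _) (Dvd.dvd.mul_left (hRR _) _))
      have k2 : e ^ (j+1) ∣ δ (R a) (R b) - δ a b := by
        obtain ⟨a', ha'⟩ := hR1 a
        obtain ⟨b', hb'⟩ := hR1 b
        have ea : R a = a + e * a' := by rw [← ha']; ring
        have eb : R b = b + e * b' := by rw [← hb']; ring
        have e1 : δ (R a) (R b) - δ a b = e * (δ a b' + δ a' b + e * δ a' b') := by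
          have r1 : (a + e * a') * (b + e * b') = a * b + e * (a * b') + e * (a' * b) + e * (e * (a' * b')) := by ring
          rw [ea, eb]
          simp only [hδ, r1, map_add, hRe]
          ring
        rw [e1, pow_succ, mul_comm]
        exact mul_dvd_mul_left _ (dvd_add (dvd_add (ihδ _ _) (ihδ _ _)) (Dvd.dvd.mul_left (ihδ _ _) _))
      have k3 : e ^ (j+1) ∣ R (δ a b) - δ a b := hR1j _ _ (ihδ a b)
      have k4 : e ^ (j+1) ∣ δ a b + δ a b := by
        have : δ a b + δ a b = (δ (R a) (R b) + R (δ a b)) - (δ (R a) (R b) - δ a b) - (R (δ a b) - δ a b) := by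
          ring
        rw [this]
        exact dvd_sub (dvd_sub (dvd_trans (pow_dvd_pow _ hj) k1) k2) k3
      exact dvd_of_two e k4
  · intro I hI
    apply pol_sub
    intro a ha; rw [hN]; exact sub_mem (hI a ha) ha
  · intro c hcc hce hcθ
    let cl : Module.End ℚ M := c.toAddMonoidHom.toRatLinearMap
    have hcl : ∀ a, cl a = c a := fun a => rfl
    let N' : Module.End ℚ M := cl * N * cl
    have hN' : ∀ a, N' a = c (N (c a)) := fun a => rfl
    let R' : Module.End ℚ M := Polynomial.aeval N' h
    have conjpol : ∀ f : Polynomial ℚ, ∀ a, Polynomial.aeval N' f a = c (Polynomial.aeval N f (c a)) := by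
      intro f
      induction f using Polynomial.induction_on' with
      | add f g hf hg => intro a; simp only [map_add, LinearMap.add_apply, hf, hg]
      | monomial n r =>
        intro a
        have : ∀ (n : ℕ) a, (N' ^ n) a = c ((N ^ n) (c a)) := by
          intro n
          induction n with
          | zero => intro a; simp [hcc]
          | succ n ih => intro a; rw [pow_succ', Module.End.mul_apply, ih, hN', hcc, pow_succ']; rfl
        rw [Polynomial.aeval_monomial, Polynomial.aeval_monomial, Module.End.mul_apply, Module.End.mul_apply, this,
          Module.algebraMap_end_apply, Module.algebraMap_end_apply]
        rw [← hcl, ← hcl, ← hcl, map_smul]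
    have hR' : ∀ a, R' a = c (R (c a)) := conjpol h
    have hN'e : ∀ a, N' (e * a) = e * N' a := by
      intro a; rw [hN', map_mul, hce, hNe, map_mul, hce]; rfl
    have hN'd : ∀ a, e ∣ N' a := by
      intro a; rw [hN']
      have := map_dvd c (hNd (c a))
      rwa [hce] at this
    -- commutation
    have hcomm : Commute N N' := by
      have e1 : ∀ a, θ (c (θ (c a))) = a := by
        intro a
        have := hcθ (c a)
        have h2 := congrArg c this
        rwa [hcc, hcc] at h2
      have e2 : ∀ a, c (θ (c a)) = θ.symm a := by
        intro a; rw [RingEquiv.eq_symm_apply]; exact e1 a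
      apply LinearMap.ext
      intro a
      have e3 : ∀ a, N' a = θ.symm a - a := by
        intro a; rw [hN', hN, map_sub, hcc, e2]
      change N (N' a) = N' (N a)
      rw [e3, e3, hN, hN, map_sub, map_sub]
      simp; ring
    have hRR'c : ∀ a, R (R' a) = R' (R a) := by
      intro a
      have h1 : Commute R R' := by
        have h2 : Commute N R' := by
          have : ∀ f : Polynomial ℚ, Commute N (Polynomial.aeval N' f) := by
            intro f
            induction f using Polynomial.induction_on' with
            | add f g hf hg => rw [map_add]; exact hf.add_right hg
            | monomial n r =>
              rw [Polynomial.aeval_monomial]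
              exact Commute.mul_right (Algebra.commutes r N).symm (hcomm.pow_right n)
          exact this h
        have : ∀ f : Polynomial ℚ, Commute (Polynomial.aeval N f) R' := by
          intro f
          induction f using Polynomial.induction_on' with
          | add f g hf hg => rw [map_add]; exact hf.add_left hg
          | monomial n r =>
            rw [Polynomial.aeval_monomial]
            exact Commute.mul_left (Algebra.commutes r R') (h2.pow_left n)
        exact this h
      exact DFunLike.congr_fun h1 a
    have hR'1 : ∀ a, e ∣ R' a - a := one N' hN'e hN'd
    have hR'e : ∀ a, R' (e * a) = e * R' a := pol_e N' e hN'e h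
    have hR'ej : ∀ j a, R' (e ^ j * a) = e ^ j * R' a := by
      intro j
      induction j with
      | zero => intro a; simp
      | succ j ih => intro a; rw [pow_succ, mul_assoc, ih, hR'e, mul_assoc]
    have hR'R' : ∀ a, e ^ d ∣ R' (R' a) - (a + N' a) := sq N' hN'e hN'd
    let Q : Module.End ℚ M := R * R'
    have hQ : ∀ a, Q a = R (R' a) := fun a => rfl
    have hQej : ∀ j a, Q (e ^ j * a) = e ^ j * Q a := by
      intro j a; rw [hQ, hR'ej, hRej]; rfl
    have hQ1 : ∀ a, e ∣ Q a - a := by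
      intro a
      have : Q a - a = (R (R' a) - R' a) + (R' a - a) := by rw [hQ]; ring
      rw [this]; exact dvd_add (hR1 _) (hR'1 _)
    have hQQ : ∀ a, e ^ d ∣ Q (Q a) - a := by
      intro a
      have e0 : Q (Q a) = R' (R' (R (R a))) := by
        rw [hQ, hQ, hRR'c (R (R' a)), hRR'c a, hRR'c (R a)]
      have e1 : a = θ a + N' (θ a) := by
        have : N' (θ a) = c (θ (c (θ a))) - θ a := by rw [hN', hN, map_sub, hcc]
        rw [this, hcθ]; ring
      have e2 : Q (Q a) - a = R' (R' (R (R a) - θ a)) + (R' (R' (θ a)) - (θ a + N' (θ a))) := by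
        rw [e0, ← e1, map_sub, map_sub]; ring
      rw [e2]
      refine dvd_add ?_ (hR'R' _)
      obtain ⟨b, hb⟩ := hRR a
      rw [hb, hR'ej, hR'ej]; exact Dvd.intro _ rfl
    have main : ∀ j, j ≤ d → ∀ a, e ^ j ∣ Q a - a := by
      intro j
      induction j with
      | zero => intro _ a; simp
      | succ j ih =>
        intro hj a
        obtain ⟨b, hb⟩ := ih (by omega) a
        have k1 : e ^ (j+1) ∣ Q (Q a - a) - (Q a - a) := by
          rw [hb, hQej, ← mul_sub, pow_succ]; exact mul_dvd_mul_left _ (hQ1 b)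
        have k2 : (Q a - a) + (Q a - a) = (Q (Q a) - a) - (Q (Q a - a) - (Q a - a)) := by
          rw [map_sub]; ring
        apply dvd_of_two
        rw [k2]
        exact dvd_sub (dvd_trans (pow_dvd_pow _ hj) (hQQ a)) k1
    intro a
    have := main d le_rfl a
    rwa [hQ, hR'] at this

/-- the Jacobian of the square root -/
lemma jac_sqrt (R : M → M) (hRe : ∀ j w, e ∣ R (1 + e ^ j * w) - (1 + e ^ j * w) ∧
    e ^ (j+1) ∣ R (1 + e ^ j * w) - (1 + e ^ j * w)) (v : M) (h1 : e ∣ v - 1) (h : e ^ d ∣ R v * v - 1) :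
    e ^ d ∣ v - 1 := by
  suffices H : ∀ j, j + 1 ≤ d → e ^ (j+1) ∣ v - 1 by
    rcases d with _ | d
    · simp
    · exact H d le_rfl
  intro j
  induction j with
  | zero => intro _; simpa using h1
  | succ j ih =>
    intro hj
    obtain ⟨w, hw⟩ := ih (by omega)
    have hv : v = 1 + e ^ (j+1) * w := by rw [← hw]; ring
    have k := (hRe (j+1) w).2
    rw [← hv] at k
    have e1 : (v - 1) + (v - 1) = (R v * v - 1) - (R v - v) * v - (v - 1) * (v - 1) := by ring
    apply dvd_of_two
    rw [e1]
    refine dvd_sub (dvd_sub (dvd_trans (pow_dvd_pow _ hj) h) (Dvd.dvd.mul_right k _)) ?_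
    rw [hw]
    refine ⟨e ^ j * w * w, ?_⟩
    ring

end Sqrt
end KR

set_option linter.unusedSectionVars false

namespace KR
open MvPolynomial

lemma jac_chain' {R : Type*} [CommRing R] (φ : P2 R ≃ₐ[R] P2 R) (f g : P2 R) :
    jacD (φ f) (φ g) = φ (jacD f g) * jacD (φ (X 0)) (φ (X 1)) := jac_chain (φ : P2 R →ₐ[R] P2 R) f g

lemma pderiv_comm {R : Type*} [CommRing R] (i j : Fin 2) (f : P2 R) :
    pderiv i (pderiv j f) = pderiv j (pderiv i f) := by
  have : ⁅(pderiv i : Derivation R (P2 R) (P2 R)), (pderiv j : Derivation R (P2 R) (P2 R))⁆ = 0 := by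
    apply MvPolynomial.derivation_ext
    intro k
    rw [Derivation.commutator_apply]
    simp only [pderiv_def, mkDerivation_X, Pi.single_apply, Derivation.zero_apply]
    split_ifs <;> simp
  have h := DFunLike.congr_fun this f
  rw [Derivation.commutator_apply] at h
  exact sub_eq_zero.mp h

section Lift
variable {κ : Type*} [Field κ] [CharZero κ]

/-- evaluate the base variable at `0` -/
noncomputable def ev0 : P2 (Polynomial κ) →+* P2 κ := MvPolynomial.map (Polynomial.evalRingHom 0)
noncomputable def emb : P2 κ →+* P2 (Polynomial κ) := MvPolynomial.map Polynomial.C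
variable (κ) in
noncomputable def xx : P2 (Polynomial κ) := C Polynomial.X

lemma ev0_emb (f : P2 κ) : ev0 (emb f) = f := by
  rw [ev0, emb, MvPolynomial.map_map]
  have : (Polynomial.evalRingHom (0:κ)).comp Polynomial.C = RingHom.id κ := by ext a; simp
  rw [this, MvPolynomial.map_id]

lemma xpow_dvd_iff (n : ℕ) (f : P2 (Polynomial κ)) :
    xx κ ^ n ∣ f ↔ ∀ m i, i < n → (f.coeff m).coeff i = 0 := by
  rw [xx, ← C_pow, C_dvd_iff_dvd_coeff]
  simp only [Polynomial.X_pow_dvd_iff]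

lemma x_dvd_iff (f : P2 (Polynomial κ)) : xx κ ∣ f ↔ ev0 f = 0 := by
  have := xpow_dvd_iff 1 f
  rw [pow_one] at this
  rw [this]
  constructor
  · intro h
    ext m
    rw [ev0, coeff_map, Polynomial.coe_evalRingHom, ← Polynomial.coeff_zero_eq_eval_zero, h m 0 (by omega)]
    simp
  · intro h m i hi
    obtain rfl : i = 0 := by omega
    have := congrArg (fun g => coeff m g) h
    simpa [ev0, coeff_map, ← Polynomial.coeff_zero_eq_eval_zero] using this

lemma xx_ne : xx κ ≠ 0 := by
  rw [xx]; simp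

lemma x_dvd_emb (f : P2 (Polynomial κ)) : xx κ ∣ emb (ev0 f) - f := by
  rw [x_dvd_iff, map_sub, ev0_emb, sub_self]

lemma jac_self_apply {R : Type*} [CommRing R] (f g : P2 R) :
    jacD f g = pderiv 0 f * pderiv 1 g - pderiv 1 f * pderiv 0 g := by
  rw [jacD_apply]

lemma id_mod {R : Type*} [CommRing R] (e : P2 R) (E : P2 R →ₐ[R] P2 R) (h0 : e ∣ E (X 0) - X 0) (h1 : e ∣ E (X 1) - X 1)
    (f : P2 R) : e ∣ E f - f := by
  induction f using MvPolynomial.induction_on with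
  | C a => rw [MvPolynomial.algHom_C, MvPolynomial.algebraMap_eq, sub_self]; exact dvd_zero _
  | add p q hp hq =>
    have : E (p + q) - (p + q) = (E p - p) + (E q - q) := by rw [map_add]; ring
    rw [this]; exact dvd_add hp hq
  | mul_X p i hp =>
    have hi : e ∣ E (X i) - X i := by fin_cases i <;> assumption
    have : E (p * X i) - p * X i = (E p - p) * E (X i) + p * (E (X i) - X i) := by rw [map_mul]; ring
    rw [this]; exact dvd_add (Dvd.dvd.mul_right hp _) (Dvd.dvd.mul_left hi _)

/-- elementary symplectic step realised -/
def PH (n : ℕ) (H : P2 κ) : Prop :=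
  ∃ E : P2 (Polynomial κ) ≃ₐ[Polynomial κ] P2 (Polynomial κ), jacD (E (X 0)) (E (X 1)) = 1 ∧
    xx κ ^ (n+1) ∣ E (X 0) - (X 0 + xx κ ^ n * emb (pderiv 1 H)) ∧
    xx κ ^ (n+1) ∣ E (X 1) - (X 1 - xx κ ^ n * emb (pderiv 0 H))

lemma PH.add {n : ℕ} (hn : 1 ≤ n) {H G : P2 κ} (h1 : PH n H) (h2 : PH n G) : PH n (H + G) := by
  obtain ⟨E, j1, a1, b1⟩ := h1
  obtain ⟨E', j2, a2, b2⟩ := h2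
  have hx : xx κ ∣ xx κ ^ n := dvd_pow_self _ (by omega)
  have hx' : xx κ ∣ xx κ ^ (n+1) := dvd_pow_self _ (by omega)
  have hEx : ∀ n, E (xx κ ^ n) = xx κ ^ n := by
    intro n; rw [map_pow, xx]; congr 1; exact E.commutes _
  have eid : ∀ f, xx κ ∣ E f - f := by
    apply id_mod (xx κ) E.toAlgHom
    · have := dvd_add (hx'.trans a1) (Dvd.dvd.mul_right hx (emb (pderiv 1 H)))
      convert this using 1; change E (X _) - X _ = _; ring
    · have := dvd_sub (hx'.trans b1) (Dvd.dvd.mul_right hx (emb (pderiv 0 H)))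
      convert this using 1; change E (X _) - X _ = _; ring
  have key : ∀ f g : P2 (Polynomial κ), xx κ ^ (n+1) ∣ f - g → xx κ ^ (n+1) ∣ E f - E g := by
    intro f g h
    have := map_dvd E h
    rwa [hEx, map_sub] at this
  have key2 : ∀ f, xx κ ^ (n+1) ∣ xx κ ^ n * E f - xx κ ^ n * f := by
    intro f; rw [← mul_sub, pow_succ]; exact mul_dvd_mul_left _ (eid f)
  refine ⟨E'.trans E, ?_, ?_, ?_⟩
  · have := jac_chain' E (E' (X 0)) (E' (X 1))
    simp only [AlgEquiv.trans_apply]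
    rw [this, j1, j2]; simp
  · have := dvd_add (dvd_add (key _ _ a2) a1) (key2 (emb (pderiv 1 G)))
    convert this using 1
    simp only [AlgEquiv.trans_apply, map_add, map_mul, hEx]; ring
  · have := dvd_sub (dvd_add (key _ _ b2) b1) (key2 (emb (pderiv 0 G)))
    convert this using 1
    simp only [AlgEquiv.trans_apply, map_add, map_sub, map_mul, hEx]; ring

lemma PH.shear (n : ℕ) (c α β : κ) (m : ℕ) : PH n (C c * (C α * X 0 + C β * X 1) ^ (m+1)) := by
  let a : P2 (Polynomial κ) := emb (C α)
  let b : P2 (Polynomial κ) := emb (C β)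
  let L : P2 (Polynomial κ) := a * X 0 + b * X 1
  let r : P2 (Polynomial κ) := C (Polynomial.X ^ n * Polynomial.C (c * (m+1)))
  have ha : a = C (Polynomial.C α) := by simp [a, emb]
  have hb : b = C (Polynomial.C β) := by simp [b, emb]
  let τ : P2 (Polynomial κ) → P2 (Polynomial κ) →ₐ[Polynomial κ] P2 (Polynomial κ) := fun g =>
    aeval ![X 0 + b * g, X 1 - a * g]
  have τC : ∀ g s, τ g (C s) = C s := by intro g s; simp [τ, MvPolynomial.algebraMap_eq]
  have τ0 : ∀ g, τ g (X 0) = X 0 + b * g := by intro g; simp [τ]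
  have τ1 : ∀ g, τ g (X 1) = X 1 - a * g := by intro g; simp [τ]
  have τL : ∀ g, τ g L = L := by
    intro g; simp only [L, map_add, map_mul, τ0, τ1]; rw [ha, hb]; simp only [τC]; ring
  let g := r * L ^ m
  have τg : ∀ h, τ h g = g := by intro h; simp only [g, map_mul, map_pow, τL]; simp only [r, τC]
  have inv : ∀ s : P2 (Polynomial κ), s = g ∨ s = -g → (τ s).comp (τ (-s)) = AlgHom.id _ _ := by
    intro s hs
    have hs' : τ s s = s := by rcases hs with rfl | rfl <;> simp [τg]
    have ta : τ s a = a := by rw [ha, τC]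
    have tb : τ s b = b := by rw [hb, τC]
    apply MvPolynomial.algHom_ext
    intro i
    fin_cases i
    · simp only [Fin.zero_eta, AlgHom.comp_apply, τ0, map_add, map_mul, map_neg, hs', tb, AlgHom.id_apply]; ring
    · simp only [Fin.mk_one, AlgHom.comp_apply, τ1, map_sub, map_mul, map_neg, hs', ta, AlgHom.id_apply]; ring
  let E : P2 (Polynomial κ) ≃ₐ[Polynomial κ] P2 (Polynomial κ) := AlgEquiv.ofAlgHom (τ g) (τ (-g)) (inv g (Or.inl rfl))
    (by have := inv (-g) (Or.inr rfl); rwa [neg_neg] at this)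
  have E0 : E (X 0) = X 0 + b * g := τ0 g
  have E1 : E (X 1) = X 1 - a * g := τ1 g
  have er : r = xx κ ^ n * emb (C (c * (m+1))) := by simp [r, xx, emb]
  have eL : L = emb (C α * X 0 + C β * X 1) := by simp [L, a, b, emb]
  refine ⟨E, ?_, ?_, ?_⟩
  · rw [E0, E1, jac_self_apply]
    have d1 : pderiv 0 g = r * (m * L ^ (m-1) * a) := by
      simp only [g, L, r, ha, hb, pderiv_mul, pderiv_C, Derivation.leibniz_pow, map_add, pderiv_X_self, smul_eq_mul, nsmul_eq_mul]
      rw [pderiv_X_of_ne (by decide)]; ring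
    have d2 : pderiv 1 g = r * (m * L ^ (m-1) * b) := by
      simp only [g, L, r, ha, hb, pderiv_mul, pderiv_C, Derivation.leibniz_pow, map_add, pderiv_X_self, smul_eq_mul, nsmul_eq_mul]
      rw [pderiv_X_of_ne (by decide)]; ring
    simp only [map_add, map_sub, pderiv_mul, d1, d2, pderiv_X_self]
    rw [pderiv_X_of_ne (by decide), pderiv_X_of_ne (by decide), ha, hb]
    simp only [pderiv_C]; ring
  · have : pderiv 1 (C c * (C α * X 0 + C β * X 1) ^ (m+1) : P2 κ) = C (c * (m+1)) * C β * (C α * X 0 + C β * X 1) ^ m := by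
      simp only [pderiv_mul, pderiv_C, Derivation.leibniz_pow, map_add, pderiv_X_self, smul_eq_mul, nsmul_eq_mul]
      rw [pderiv_X_of_ne (by decide)]; simp; ring
    rw [this, E0]
    convert dvd_zero _ using 1
    simp only [g, er, eL, map_mul, map_pow, b]; ring
  · have : pderiv 0 (C c * (C α * X 0 + C β * X 1) ^ (m+1) : P2 κ) = C (c * (m+1)) * C α * (C α * X 0 + C β * X 1) ^ m := by
      simp only [pderiv_mul, pderiv_C, Derivation.leibniz_pow, map_add, pderiv_X_self, smul_eq_mul, nsmul_eq_mul]
      rw [pderiv_X_of_ne (by decide)]; simp; ring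
    rw [this, E1]
    convert dvd_zero _ using 1
    simp only [g, er, eL, map_mul, map_pow, a]; ring

lemma PH.const (n : ℕ) (c : κ) : PH n (C c) := by
  refine ⟨AlgEquiv.refl, ?_, ?_, ?_⟩
  · simp [jac_XX]
  · simp
  · simp

lemma vander {V : Type*} [AddCommGroup V] [Module κ V] (W : Submodule κ V) (N : ℕ) : ∀ (w : ℕ → V),
    (∀ s : κ, ∑ a ∈ Finset.range (N+1), s ^ a • w a ∈ W) → ∀ a ≤ N, w a ∈ W := by
  induction N with
  | zero =>
    intro w h a ha
    obtain rfl : a = 0 := by omega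
    simpa using h 0
  | succ N ih =>
    intro w h
    have h1 : ∀ a ≤ N, w a ∈ W := by
      intro a ha
      have := ih (fun a => ((2:κ) ^ a - 2 ^ (N+1)) • w a) (by
        intro s
        have h2 := W.sub_mem (h (2 * s)) (W.smul_mem ((2:κ) ^ (N+1)) (h s))
        rw [Finset.smul_sum, ← Finset.sum_sub_distrib, Finset.sum_range_succ] at h2
        convert h2 using 1
        rw [show (2 * s) ^ (N+1) • w (N+1) - (2:κ) ^ (N+1) • s ^ (N+1) • w (N+1) = 0 by
          rw [smul_smul, mul_pow, sub_self], add_zero]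
        apply Finset.sum_congr rfl
        intro a _
        rw [smul_smul, smul_smul, ← sub_smul]; congr 1; ring) a ha
      have hne : ((2:κ) ^ a - 2 ^ (N+1)) ≠ 0 := by
        rw [sub_ne_zero]
        intro h
        have h3 : (2:ℕ) ^ a = 2 ^ (N+1) := by exact_mod_cast h
        have := Nat.pow_right_injective (le_refl 2) h3
        omega
      exact (W.smul_mem_iff hne).mp this
    intro a ha
    rcases Nat.lt_or_ge a (N+1) with h2 | h2
    · exact h1 a (by omega)
    · obtain rfl : a = N + 1 := by omega
      have := h 1
      rw [Finset.sum_range_succ] at this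
      simp only [one_pow, one_smul] at this
      exact (W.add_mem_iff_right (W.sum_mem fun i hi => h1 i (by simp at hi; omega))).mp this

lemma PH.all {n : ℕ} (hn : 1 ≤ n) (H : P2 κ) : PH n H := by
  let W : Submodule κ (P2 κ) :=
    { carrier := {H | ∀ c : κ, PH n (c • H)}
      add_mem' := by
        intro a b ha hb c
        rw [smul_add]; exact (ha c).add hn (hb c)
      zero_mem' := by
        intro c; rw [smul_zero, ← C_0]; exact PH.const n 0
      smul_mem' := by
        intro c x hx c'
        rw [smul_smul]; exact hx _ }
  suffices H1 : H ∈ W by have := H1 1; rwa [one_smul] at this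
  have hL : ∀ (s : κ) N, (X 0 + C s * X 1 : P2 κ) ^ N ∈ W := by
    intro s N c
    rcases N with _ | N
    · rw [pow_zero, smul_eq_C_mul, mul_one]; exact PH.const n c
    · have := PH.shear n c 1 s N
      rw [C_1, one_mul] at this
      rwa [smul_eq_C_mul]
  have hm : ∀ N, ∀ a ≤ N, (X 1 ^ a * X 0 ^ (N - a) : P2 κ) ∈ W := by
    intro N a ha
    have := vander W N (fun a => (N.choose a : κ) • (X 1 ^ a * X 0 ^ (N - a) : P2 κ)) (by
      intro s
      have := hL s N
      rw [add_comm, add_pow] at this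
      convert this using 1
      apply Finset.sum_congr rfl
      intro a _
      simp only [smul_eq_C_mul, mul_pow, map_pow, map_natCast]; ring) a ha
    refine (W.smul_mem_iff ?_).mp this
    exact_mod_cast (Nat.choose_pos ha).ne'
  induction H using MvPolynomial.induction_on' with
  | add p q hp hq => exact W.add_mem hp hq
  | monomial u a =>
    have := W.smul_mem a (hm (u 1 + u 0) (u 1) (by omega))
    convert this using 1
    rw [monomial_eq, smul_eq_C_mul, Finsupp.prod_fintype _ _ (by simp), Fin.prod_univ_two, Nat.add_sub_cancel_left]
    ring

lemma anti0 (f : P2 κ) : ∃ g, pderiv 0 g = f := by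
  induction f using MvPolynomial.induction_on' with
  | add p q hp hq =>
    obtain ⟨g, rfl⟩ := hp
    obtain ⟨h, rfl⟩ := hq
    exact ⟨g + h, by simp⟩
  | monomial u a =>
    refine ⟨monomial (u + Finsupp.single 0 1) (a / (u 0 + 1)), ?_⟩
    rw [pderiv_monomial]
    have : (u 0 : κ) + 1 ≠ 0 := by exact_mod_cast Nat.succ_ne_zero (u 0)
    simp; field_simp

lemma anti1 (f : P2 κ) (hf : pderiv 0 f = 0) : ∃ g, pderiv 0 g = 0 ∧ pderiv 1 g = f := by
  have := mem_adjoin_X1 hf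
  rw [Algebra.adjoin_singleton_eq_range_aeval] at this
  obtain ⟨p, rfl⟩ := this
  clear hf
  induction p using Polynomial.induction_on' with
  | add p q hp hq =>
    obtain ⟨g, g0, g1⟩ := hp
    obtain ⟨h, h0, h1⟩ := hq
    exact ⟨g + h, by simp [g0, h0], by simp_all⟩
  | monomial n a =>
    refine ⟨C (a / (n + 1)) * X 1 ^ (n+1), ?_, ?_⟩
    · simp only [pderiv_mul, pderiv_C, Derivation.leibniz_pow]
      rw [pderiv_X_of_ne (by decide)]; simp
    · simp only [pderiv_mul, pderiv_C, Derivation.leibniz_pow, pderiv_X_self]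
      have h : (n : κ) + 1 ≠ 0 := by exact_mod_cast Nat.succ_ne_zero n
      have h2 : C (a / (n+1)) * ((n:P2 κ) + 1) = C a := by
        rw [show ((n:P2 κ) + 1) = C ((n:κ) + 1) by simp, ← C_mul]; congr 1; field_simp
      simp only [AlgHom.toRingHom_eq_coe, RingHom.coe_coe, Polynomial.aeval_monomial, MvPolynomial.algebraMap_eq]
      rw [← h2]; simp; ring

lemma lift_sympl {d : ℕ} {z t : P2 (Polynomial κ)} (hz : xx κ ∣ z - X 0) (ht : xx κ ∣ t - X 1)
    (hj : xx κ ^ d ∣ jacD z t - 1) :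
    ∃ χ : P2 (Polynomial κ) ≃ₐ[Polynomial κ] P2 (Polynomial κ), jacD (χ (X 0)) (χ (X 1)) = 1 ∧
      xx κ ^ d ∣ χ (X 0) - z ∧ xx κ ^ d ∣ χ (X 1) - t := by
  suffices H : ∀ n, n + 1 ≤ d → ∃ χ : P2 (Polynomial κ) ≃ₐ[Polynomial κ] P2 (Polynomial κ), jacD (χ (X 0)) (χ (X 1)) = 1 ∧
      xx κ ^ (n+1) ∣ χ (X 0) - z ∧ xx κ ^ (n+1) ∣ χ (X 1) - t by
    rcases d with _ | d
    · exact ⟨AlgEquiv.refl, by simp [jac_XX], by simp, by simp⟩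
    · exact H d le_rfl
  intro n
  induction n with
  | zero =>
    intro _
    refine ⟨AlgEquiv.refl, by simp [jac_XX], ?_, ?_⟩
    · rw [zero_add, pow_one, ← neg_sub, dvd_neg]; exact hz
    · rw [zero_add, pow_one, ← neg_sub, dvd_neg]; exact ht
  | succ n ih =>
    intro hn
    obtain ⟨χ, j, ⟨p, hp⟩, ⟨q, hq⟩⟩ := ih (by omega)
    set N := n + 1 with hN
    let p' := -χ.symm p
    let q' := -χ.symm q
    have hχx : ∀ n, χ (xx κ ^ n) = xx κ ^ n := by
      intro n; rw [map_pow, xx]; congr 1; exact χ.commutes _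
    have ez : z = χ (X 0 + xx κ ^ N * p') := by
      simp only [p', map_add, map_mul, hχx, map_neg, AlgEquiv.apply_symm_apply]
      linear_combination -hp
    have et : t = χ (X 1 + xx κ ^ N * q') := by
      simp only [q', map_add, map_mul, hχx, map_neg, AlgEquiv.apply_symm_apply]
      linear_combination -hq
    have hjj : xx κ ^ (N+1) ∣ jacD (X 0 + xx κ ^ N * p') (X 1 + xx κ ^ N * q') - 1 := by
      have h1 := jac_chain' χ (X 0 + xx κ ^ N * p') (X 1 + xx κ ^ N * q')
      rw [j, mul_one, ← ez, ← et] at h1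
      have h2 : xx κ ^ (N+1) ∣ jacD z t - 1 := dvd_trans (pow_dvd_pow _ hn) hj
      rw [h1] at h2
      have h3 := map_dvd χ.symm h2
      rw [← hχx, AlgEquiv.symm_apply_apply, map_sub, AlgEquiv.symm_apply_apply, map_one] at h3
      exact h3
    have hdiv : xx κ ∣ pderiv 0 p' + pderiv 1 q' := by
      have hpx : ∀ i n, pderiv i (xx κ ^ n) = 0 := by
        intro i n; rw [xx, ← C_pow, pderiv_C]
      have h1 : jacD (X 0 + xx κ ^ N * p') (X 1 + xx κ ^ N * q') - 1 =
          xx κ ^ N * (pderiv 0 p' + pderiv 1 q' + xx κ * (xx κ ^ n * jacD p' q')) := by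
        simp only [jac_self_apply, map_add, pderiv_mul, hpx, pderiv_X_self]
        rw [pderiv_X_of_ne (by decide), pderiv_X_of_ne (by decide), hN, pow_succ]; ring
      rw [h1, pow_succ] at hjj
      have h2 := (mul_dvd_mul_iff_left (pow_ne_zero N xx_ne)).mp hjj
      exact (dvd_add_left (Dvd.intro _ rfl)).mp h2
    have hd0 : pderiv 0 (ev0 p') + pderiv 1 (ev0 q') = 0 := by
      rw [x_dvd_iff] at hdiv
      rw [← hdiv]; simp [ev0, pderiv_map]
    obtain ⟨H0, h0⟩ := anti0 (-ev0 q')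
    obtain ⟨H1, h1, h1'⟩ := anti1 (ev0 p' - pderiv 1 H0) (by
      have hc : pderiv 0 (pderiv 1 H0) = pderiv 1 (pderiv 0 H0) := by
        exact pderiv_comm 0 1 H0
      rw [map_sub, hc, h0, ← hd0, sub_eq_add_neg, ← map_neg, neg_neg])
    obtain ⟨E, jE, e0, e1⟩ := PH.all (n := N) (by omega) (H0 + H1)
    rw [map_add, h1'] at e0
    rw [map_add, h1, h0] at e1
    refine ⟨E.trans χ, ?_, ?_, ?_⟩
    · have h1 := jac_chain' χ (E (X 0)) (E (X 1))
      simp only [AlgEquiv.trans_apply]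
      rw [h1, j, jE]; simp
    · have h2 : xx κ ^ (N+1) ∣ E (X 0) - (X 0 + xx κ ^ N * p') := by
        have h3 : xx κ ^ (N+1) ∣ xx κ ^ N * (emb (ev0 p') - p') := by
          rw [pow_succ]; exact mul_dvd_mul_left _ (x_dvd_emb p')
        have := dvd_add e0 h3
        convert this using 1
        rw [add_sub_cancel]; ring
      have h3 := map_dvd χ h2
      rwa [hχx, map_sub, ← ez] at h3
    · have h2 : xx κ ^ (N+1) ∣ E (X 1) - (X 1 + xx κ ^ N * q') := by
        have h3 : xx κ ^ (N+1) ∣ xx κ ^ N * (emb (ev0 q') - q') := by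
          rw [pow_succ]; exact mul_dvd_mul_left _ (x_dvd_emb q')
        have := dvd_add e1 h3
        convert this using 1
        rw [add_zero, map_neg]; ring
      have h3 := map_dvd χ h2
      rwa [hχx, map_sub, ← et] at h3

end Lift
end KR

set_option linter.unusedSectionVars false

namespace KR
open MvPolynomial

section Cong
variable {M : Type*} [CommRing M] {e : M}

/-- congruence -/
def Cg (e a b : M) : Prop := e ∣ a - b

lemma Cg.refl (a : M) : Cg e a a := by simp [Cg]
lemma Cg.symm {a b : M} (h : Cg e a b) : Cg e b a := by
  unfold Cg at *; rw [← neg_sub, dvd_neg]; exact h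
lemma Cg.trans {a b c : M} (h : Cg e a b) (h' : Cg e b c) : Cg e a c := by
  unfold Cg at *; rw [← sub_add_sub_cancel a b c]; exact dvd_add h h'
lemma Cg.add {a b a' b' : M} (h : Cg e a b) (h' : Cg e a' b') : Cg e (a + a') (b + b') := by
  unfold Cg at *; rw [add_sub_add_comm]; exact dvd_add h h'
lemma Cg.sub {a b a' b' : M} (h : Cg e a b) (h' : Cg e a' b') : Cg e (a - a') (b - b') := by
  unfold Cg at *
  have : a - a' - (b - b') = (a - b) - (a' - b') := by ring
  rw [this]; exact dvd_sub h h'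
lemma Cg.mul {a b a' b' : M} (h : Cg e a b) (h' : Cg e a' b') : Cg e (a * a') (b * b') := by
  unfold Cg at *
  have : a * a' - b * b' = (a - b) * a' + b * (a' - b') := by ring
  rw [this]; exact dvd_add (Dvd.dvd.mul_right h _) (Dvd.dvd.mul_left h' _)
lemma Cg.map {F : Type*} [FunLike F M M] [RingHomClass F M M] (φ : F) (hφ : φ e = e) {a b : M} (h : Cg e a b) :
    Cg e (φ a) (φ b) := by
  unfold Cg at *
  have := map_dvd φ h
  rwa [hφ, map_sub] at this
lemma Cg.mono {e' a b : M} (he : e' ∣ e) (h : Cg e a b) : Cg e' a b := he.trans h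
lemma Cg.mem {a b : M} {I : Ideal M} (h : Cg e a b) (he : e ∈ I) (hb : b ∈ I) : a ∈ I := by
  obtain ⟨c, hc⟩ := h
  have : a = e * c + b := by rw [← hc]; ring
  rw [this]; exact I.add_mem (I.mul_mem_right _ he) hb

end Cong

lemma hom_mod {R : Type*} [CommRing R] {e : P2 R} (E E' : P2 R →ₐ[R] P2 R) (h0 : Cg e (E (X 0)) (E' (X 0)))
    (h1 : Cg e (E (X 1)) (E' (X 1))) (f : P2 R) : Cg e (E f) (E' f) := by
  induction f using MvPolynomial.induction_on with
  | C a => rw [MvPolynomial.algHom_C, MvPolynomial.algHom_C]; exact Cg.refl _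
  | add p q hp hq => rw [map_add, map_add]; exact hp.add hq
  | mul_X p i hp =>
    have hi : Cg e (E (X i)) (E' (X i)) := by fin_cases i <;> assumption
    rw [map_mul, map_mul]; exact hp.mul hi

lemma Cg.pderiv {R : Type*} [CommRing R] {r : R} {f g : P2 R} (i : Fin 2) (h : Cg (C r) f g) :
    Cg (C r) (pderiv i f) (pderiv i g) := by
  obtain ⟨c, hc⟩ := h
  refine ⟨MvPolynomial.pderiv i c, ?_⟩
  rw [← map_sub, hc, pderiv_C_mul]

lemma Cg.jac {R : Type*} [CommRing R] {r : R} {f g f' g' : P2 R} (h : Cg (C r) f g) (h' : Cg (C r) f' g') :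
    Cg (C r) (jacD f f') (jacD g g') := by
  rw [jacD_apply, jacD_apply]
  exact ((h.pderiv 0).mul (h'.pderiv 1)).sub ((h.pderiv 1).mul (h'.pderiv 0))

/-- conjugation -/
noncomputable abbrev cM : P2 CX →+* P2 CX := MvPolynomial.map cj

lemma cM_cM (f : P2 CX) : cM (cM f) = f := by
  rw [MvPolynomial.map_map]
  have : cj.comp cj = RingHom.id CX := by ext p <;> simp
  rw [this, MvPolynomial.map_id]

lemma cM_xx : cM (xx ℂ) = xx ℂ := by simp [xx]
lemma cM_xp (d : ℕ) : cM (xx ℂ ^ d) = xx ℂ ^ d := by rw [map_pow, cM_xx]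
lemma xp_C (d : ℕ) : xx ℂ ^ d = C (Polynomial.X ^ d) := by simp [xx]

lemma eq_xp {F : Type*} [FunLike F (P2 CX) (P2 CX)] [AlgHomClass F CX (P2 CX) (P2 CX)] (φ : F) (d : ℕ) :
    φ (xx ℂ ^ d) = xx ℂ ^ d := by
  rw [xp_C]; exact AlgHomClass.commutes φ _

noncomputable def emR : P2 (Polynomial ℝ) →+* P2 CX := MvPolynomial.map (Polynomial.mapRingHom Complex.ofRealHom)

lemma emR_range {z : P2 CX} (h : cM z = z) : ∃ w, emR w = z := by
  have : z ∈ Set.range (MvPolynomial.map (σ := Fin 2) (Polynomial.mapRingHom Complex.ofRealHom)) := by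
    rw [mem_range_map_iff_coeffs_subset]
    intro p hp
    obtain ⟨m, _, rfl⟩ := mem_coeffs_iff.mp (Finset.mem_coe.mp hp)
    have : coeff m z ∈ (Polynomial.mapRingHom Complex.ofRealHom).range := by
      rw [Polynomial.mem_map_range]
      intro n
      have h1 := congrArg (fun f => (coeff m f).coeff n) h
      simp only [coeff_map, Polynomial.coe_mapRingHom, Polynomial.coeff_map] at h1
      obtain ⟨r, hr⟩ := Complex.conj_eq_iff_real.mp h1
      exact ⟨r, hr.symm⟩
    exact this
  exact this

lemma emR_dvd {n : ℕ} {f : P2 (Polynomial ℝ)} : xx ℂ ^ n ∣ emR f ↔ xx ℝ ^ n ∣ f := by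
  rw [xpow_dvd_iff, xpow_dvd_iff]
  simp [emR, coeff_map]

lemma cM_emR (f : P2 (Polynomial ℝ)) : cM (emR f) = emR f := by
  rw [emR, MvPolynomial.map_map]
  congr 1
  ext n <;> simp

lemma lift_real {d : ℕ} {z t : P2 CX} (cz : cM z = z) (ct : cM t = t) (hz : xx ℂ ∣ z - X 0) (ht : xx ℂ ∣ t - X 1)
    (hj : xx ℂ ^ d ∣ jacD z t - 1) :
    ∃ χ : P2 CX ≃ₐ[CX] P2 CX, cM (χ (X 0)) = χ (X 0) ∧ cM (χ (X 1)) = χ (X 1) ∧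
      xx ℂ ^ d ∣ χ (X 0) - z ∧ xx ℂ ^ d ∣ χ (X 1) - t := by
  obtain ⟨z, rfl⟩ := emR_range cz
  obtain ⟨t, rfl⟩ := emR_range ct
  have eX : ∀ i, emR (X i) = X i := by intro i; simp [emR]
  obtain ⟨χ, _, h0, h1⟩ := lift_sympl (d := d) (z := z) (t := t)
    (by rw [← pow_one (xx ℝ), ← emR_dvd, map_sub, eX, pow_one]; exact hz)
    (by rw [← pow_one (xx ℝ), ← emR_dvd, map_sub, eX, pow_one]; exact ht)
    (by rw [← emR_dvd, map_sub, map_one, emR, ← jacD_map]; exact hj)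
  have key : ∀ f, χ f = aeval ![χ (X 0), χ (X 1)] f := by
    intro f
    have : (χ : P2 (Polynomial ℝ) →ₐ[Polynomial ℝ] P2 (Polynomial ℝ)) = aeval ![χ (X 0), χ (X 1)] := by
      apply MvPolynomial.algHom_ext
      intro i; fin_cases i <;> simp
    exact DFunLike.congr_fun this f
  have mem : ∀ i, X i ∈ Algebra.adjoin CX {emR (χ (X 0)), emR (χ (X 1))} := by
    intro i
    rw [mem_pair]
    refine ⟨emR (χ.symm (X i)), ?_⟩
    rw [emR, ← map_aeval2, ← key, AlgEquiv.apply_symm_apply, map_X]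
  obtain ⟨φ, f0, f1⟩ := exists_equiv _ _ (mem 0) (mem 1)
  refine ⟨φ, ?_, ?_, ?_, ?_⟩
  · rw [f0, cM_emR]
  · rw [f1, cM_emR]
  · rw [f0, ← map_sub, emR_dvd]; exact h0
  · rw [f1, ← map_sub, emR_dvd]; exact h1

lemma equiv_aeval {R : Type*} [CommRing R] (χ : P2 R ≃ₐ[R] P2 R) (f : P2 R) : χ f = aeval ![χ (X 0), χ (X 1)] f := by
  have : (χ : P2 R →ₐ[R] P2 R) = aeval ![χ (X 0), χ (X 1)] := by
    apply MvPolynomial.algHom_ext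
    intro i; fin_cases i <;> simp
  exact DFunLike.congr_fun this f

lemma jac_one (φ : P2 CX ≃ₐ[CX] P2 CX) (h0 : Cg (xx ℂ) (φ (X 0)) (X 0)) (h1 : Cg (xx ℂ) (φ (X 1)) (X 1)) :
    jacD (φ (X 0)) (φ (X 1)) = 1 := by
  have hu := jac_unit φ
  rw [isUnit_iff_eq_C_of_isReduced] at hu
  obtain ⟨r, hr, h⟩ := hu
  obtain ⟨a, _, rfl⟩ := Polynomial.isUnit_iff.mp hr
  have := Cg.jac (r := (Polynomial.X : CX)) h0 h1
  rw [jac_XX, h] at this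
  have h2 : xx ℂ ∣ C (Polynomial.C a) - 1 := this
  rw [x_dvd_iff] at h2
  have h3 : a = 1 := by
    have : (C a : P2 ℂ) = C 1 := by
      rw [C_1]; apply sub_eq_zero.mp; rw [← h2]; simp [ev0]
    exact C_injective _ _ this
  rw [h, h3]; simp

lemma mem_map_span (φ : P2 CX ≃ₐ[CX] P2 CX) {d : ℕ} {f g : P2 CX} (h : f ∈ Ideal.span {xx ℂ ^ d, g}) :
    φ f ∈ Ideal.span {xx ℂ ^ d, φ g} := by
  rw [Ideal.mem_span_pair] at *
  obtain ⟨a, b, rfl⟩ := h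
  exact ⟨φ a, φ b, by rw [map_add, map_mul, map_mul, eq_xp]⟩

lemma step3_aux {d : ℕ} (hd : 1 ≤ d) (ψ : P2 CX ≃ₐ[CX] P2 CX) (F : P2 CX) (hF : cM F = F)
    (h0 : Cg (xx ℂ) (ψ (X 0)) (X 0)) (h1 : Cg (xx ℂ) (ψ (X 1)) (X 1))
    (hI : cM (ψ F) ∈ Ideal.span {xx ℂ ^ d, ψ F}) :
    ∃ χ : P2 CX ≃ₐ[CX] P2 CX, cM (χ (X 0)) = χ (X 0) ∧ cM (χ (X 1)) = χ (X 1) ∧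
      χ F ∈ Ideal.span {xx ℂ ^ d, ψ F} ∧ ψ F ∈ Ideal.span {xx ℂ ^ d, χ F} := by
  have hcX : ∀ i, cM (X i) = X i := fun i => by simp
  let c' : P2 CX ≃+* P2 CX := RingEquiv.ofRingHom cM cM (RingHom.ext cM_cM) (RingHom.ext cM_cM)
  let ψc : P2 CX ≃ₐ[CX] P2 CX := AlgEquiv.ofRingEquiv (f := (c'.trans ψ.toRingEquiv).trans c') (by
    intro p
    change cM (ψ (cM (C p))) = C p
    have e1 : cM (C p) = C (cj p) := by simp
    have e2 : ψ (C (cj p)) = C (cj p) := ψ.commutes _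
    rw [e1, e2, ← e1, cM_cM])
  have hψc : ∀ f, ψc f = cM (ψ (cM f)) := fun f => rfl
  let θ : P2 CX ≃ₐ[CX] P2 CX := ψc.trans ψ.symm
  have hθ : ∀ f, θ f = ψ.symm (cM (ψ (cM f))) := fun f => rfl
  have hψid : ∀ i, Cg (xx ℂ) (ψ (X i)) (X i) := by intro i; fin_cases i <;> assumption
  have xsub : ∀ f g : P2 CX, Cg (xx ℂ) f g → ∀ φ : P2 CX ≃ₐ[CX] P2 CX, Cg (xx ℂ) (φ f) (φ g) := by
    intro f g h φ
    exact h.map φ (by have := eq_xp φ 1; rwa [pow_one] at this)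
  have xsubd : ∀ f g : P2 CX, Cg (xx ℂ ^ d) f g → ∀ φ : P2 CX ≃ₐ[CX] P2 CX, Cg (xx ℂ ^ d) (φ f) (φ g) := by
    intro f g h φ
    exact h.map φ (eq_xp φ d)
  have hθid : ∀ i, Cg (xx ℂ) (θ (X i)) (X i) := by
    intro i
    have h2 : Cg (xx ℂ) (cM (ψ (X i))) (ψ (X i)) := by
      have := (hψid i).map cM cM_xx
      rw [hcX] at this
      exact this.trans (hψid i).symm
    have := xsub _ _ h2 ψ.symm
    rw [AlgEquiv.symm_apply_apply] at this
    rw [hθ, hcX]; exact this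
  have hθall : ∀ f, xx ℂ ∣ θ f - f := fun f => id_mod (xx ℂ) (θ : P2 CX →ₐ[CX] P2 CX) (hθid 0) (hθid 1) f
  obtain ⟨R, Rlin, Rfix, R1, RR, Rmul, Rsub, Rc⟩ := exists_sqrt (xx ℂ) d θ.toRingEquiv
    (by have := eq_xp θ 1; rwa [pow_one] at this) hθall
  replace Rfix : ∀ a, θ a = a → R a = a := Rfix
  replace RR : ∀ a, Cg (xx ℂ ^ d) (R (R a)) (θ a) := RR
  replace Rmul : ∀ a b, Cg (xx ℂ ^ d) (R (a * b)) (R a * R b) := Rmul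
  replace R1 : ∀ a, Cg (xx ℂ) (R a) a := R1
  replace Rc : ∀ a, Cg (xx ℂ ^ d) (R (cM (R (cM a)))) a := Rc cM cM_cM cM_xx (by
    intro a
    change cM (θ (cM (θ a))) = a
    rw [hθ (cM _), cM_cM, hθ a, AlgEquiv.apply_symm_apply, cM_cM, AlgEquiv.symm_apply_apply, cM_cM])
  have RC : ∀ p a, R (C p * a) = C p * R a := by
    intro p a
    apply Rlin
    intro b
    change θ (C p * b) = C p * θ b
    rw [map_mul]; congr 1; exact θ.commutes p
  have Rx : ∀ a, R (xx ℂ ^ d * a) = xx ℂ ^ d * R a := by intro a; rw [xp_C, RC]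
  have Rcg : ∀ a b, Cg (xx ℂ ^ d) a b → Cg (xx ℂ ^ d) (R a) (R b) := by
    rintro a b ⟨q, hq⟩
    exact ⟨R q, by rw [← map_sub, hq, Rx]⟩
  have RI : ∀ a ∈ Ideal.span {xx ℂ ^ d, F}, R a ∈ Ideal.span {xx ℂ ^ d, F} := by
    apply Rsub (Submodule.restrictScalars ℚ (Ideal.span {xx ℂ ^ d, F}))
    intro a ha
    change θ a ∈ Ideal.span {xx ℂ ^ d, F}
    have hF' : θ F ∈ Ideal.span {xx ℂ ^ d, F} := by
      have := mem_map_span ψ.symm hI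
      rw [AlgEquiv.symm_apply_apply] at this
      rw [hθ, hF]; exact this
    have ha' : a ∈ Ideal.span {xx ℂ ^ d, F} := ha
    rw [Ideal.mem_span_pair] at ha'
    obtain ⟨p, q, rfl⟩ := ha'
    rw [map_add, map_mul, map_mul, eq_xp]
    exact Ideal.add_mem _ (Ideal.mul_mem_left _ _ (Ideal.subset_span (by simp))) (Ideal.mul_mem_left _ _ hF')
  let Rt : P2 CX →ₐ[CX] P2 CX := aeval ![R (X 0), R (X 1)]
  have Rt0 : Rt (X 0) = R (X 0) := by simp [Rt]
  have Rt1 : Rt (X 1) = R (X 1) := by simp [Rt]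
  have Rtall : ∀ f, Cg (xx ℂ ^ d) (Rt f) (R f) := by
    intro f
    induction f using MvPolynomial.induction_on with
    | C a =>
      rw [Rfix (C a) (θ.commutes a), MvPolynomial.algHom_C, MvPolynomial.algebraMap_eq]; exact Cg.refl _
    | add p q hp hq => rw [map_add, map_add]; exact hp.add hq
    | mul_X p i hp =>
      have hi : Rt (X i) = R (X i) := by fin_cases i <;> assumption
      rw [map_mul, hi]
      exact (hp.mul (Cg.refl _)).trans (Rmul p (X i)).symm
  have Rtid : ∀ f, xx ℂ ∣ Rt f - f := by
    apply id_mod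
    · rw [Rt0]; exact R1 _
    · rw [Rt1]; exact R1 _
  have hxd : xx ℂ ∣ xx ℂ ^ d := dvd_pow_self _ (by omega)
  have hj : xx ℂ ^ d ∣ jacD (R (X 0)) (R (X 1)) - 1 := by
    apply jac_sqrt (xx ℂ) d Rt
    · intro j w
      refine ⟨Rtid _, ?_⟩
      have : Rt (1 + xx ℂ ^ j * w) - (1 + xx ℂ ^ j * w) = xx ℂ ^ j * (Rt w - w) := by
        rw [map_add, map_one, map_mul, eq_xp]; ring
      rw [this, pow_succ]; exact mul_dvd_mul_left _ (Rtid w)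
    · have : Cg (C Polynomial.X) (jacD (R (X 0)) (R (X 1))) (jacD (X 0) (X 1)) := Cg.jac (R1 _) (R1 _)
      rw [jac_XX] at this; exact this
    · have h2 := jac_chain Rt (R (X 0)) (R (X 1))
      rw [Rt0, Rt1] at h2
      rw [← h2, ← jac_one θ (hθid 0) (hθid 1), xp_C]
      have k : ∀ i, Cg (C (Polynomial.X ^ d)) (Rt (R (X i))) (θ (X i)) := by
        intro i; rw [← xp_C]; exact (Rtall _).trans (RR _)
      exact Cg.jac (k 0) (k 1)
  have czk : ∀ i, Cg (xx ℂ ^ d) (cM (ψ (R (X i)))) (ψ (R (X i))) := by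
    intro i
    have e1 : cM (ψ (R (X i))) = ψ (θ (cM (R (X i)))) := by
      rw [hθ, cM_cM, AlgEquiv.apply_symm_apply]
    rw [e1]
    apply xsubd
    refine (RR _).symm.trans (Rcg _ _ ?_)
    have := Rc (X i)
    rwa [hcX] at this
  have h2inv : ∀ f : P2 CX, C (Polynomial.C (1/2 : ℂ)) * (f + f) = f := by
    intro f
    rw [← two_mul, ← mul_assoc, show (2 : P2 CX) = C (Polynomial.C 2) by rw [map_ofNat, map_ofNat], ← C_mul, ← Polynomial.C_mul]; norm_num
  let rp : P2 CX → P2 CX := fun f => C (Polynomial.C (1/2 : ℂ)) * (f + cM f)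
  have rpc : ∀ f, cM (rp f) = rp f := by
    intro f
    have : cM (C (Polynomial.C (1/2 : ℂ))) = C (Polynomial.C (1/2)) := by
      have h2 : starRingEnd ℂ 2 = 2 := map_ofNat _ 2
      simp [h2]
    simp only [rp, map_mul, map_add, cM_cM, this]; ring
  have rpcg : ∀ i, Cg (xx ℂ ^ d) (rp (ψ (R (X i)))) (ψ (R (X i))) := by
    intro i
    have := (Cg.refl (e := xx ℂ ^ d) (C (Polynomial.C (1/2 : ℂ)))).mul ((Cg.refl (ψ (R (X i)))).add (czk i))
    rw [h2inv] at this
    exact this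
  have rpx : ∀ i, Cg (xx ℂ) (rp (ψ (R (X i)))) (X i) := by
    intro i
    exact ((rpcg i).mono hxd).trans ((xsub _ _ (R1 _) ψ).trans (hψid i))
  have hjz : xx ℂ ^ d ∣ jacD (rp (ψ (R (X 0)))) (rp (ψ (R (X 1)))) - 1 := by
    have h2 : Cg (xx ℂ ^ d) (jacD (rp (ψ (R (X 0)))) (rp (ψ (R (X 1))))) (jacD (ψ (R (X 0))) (ψ (R (X 1)))) := by
      rw [xp_C]; exact Cg.jac (by rw [← xp_C]; exact rpcg 0) (by rw [← xp_C]; exact rpcg 1)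
    have h3 := jac_chain' ψ (R (X 0)) (R (X 1))
    rw [jac_one ψ h0 h1, mul_one] at h3
    rw [h3] at h2
    refine h2.trans ?_
    have h4 : Cg (xx ℂ ^ d) (jacD (R (X 0)) (R (X 1))) 1 := hj
    have := xsubd _ _ h4 ψ
    rwa [map_one] at this
  obtain ⟨χ, c0, c1, x0, x1⟩ := lift_real (rpc _) (rpc _) (rpx 0) (rpx 1) hjz
  have χF : ∀ f, Cg (xx ℂ ^ d) (χ f) (ψ (R f)) := by
    intro f
    have e1 := hom_mod (e := xx ℂ ^ d) (χ : P2 CX →ₐ[CX] P2 CX) ((ψ : P2 CX →ₐ[CX] P2 CX).comp Rt)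
      (by
        have : Cg (xx ℂ ^ d) (χ (X 0)) (ψ (Rt (X 0))) := by
          rw [Rt0]; exact Cg.trans x0 (rpcg 0)
        exact this)
      (by
        have : Cg (xx ℂ ^ d) (χ (X 1)) (ψ (Rt (X 1))) := by
          rw [Rt1]; exact Cg.trans x1 (rpcg 1)
        exact this) f
    have e2 : Cg (xx ℂ ^ d) (χ f) (ψ (Rt f)) := e1
    exact e2.trans (xsubd _ _ (Rtall f) ψ)
  have memx : ∀ g, xx ℂ ^ d ∈ Ideal.span {xx ℂ ^ d, g} := fun g => Ideal.subset_span (by simp)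
  have memF : ∀ g, g ∈ Ideal.span {xx ℂ ^ d, g} := fun g => Ideal.subset_span (by simp)
  have RFI := RI F (memF F)
  refine ⟨χ, c0, c1, ?_, ?_⟩
  · exact (χF F).mem (memx _) (mem_map_span ψ RFI)
  · rw [Ideal.mem_span_pair] at RFI
    obtain ⟨a, b, hab⟩ := RFI
    have e1 := Rc F
    rw [hF, ← hab] at e1
    simp only [map_add, map_mul, cM_xp, hF] at e1
    rw [mul_comm (cM a), Rx] at e1
    have e2 : Cg (xx ℂ ^ d) F (R (cM b) * R F) := by
      refine e1.symm.trans ?_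
      have e3 : Cg (xx ℂ ^ d) (xx ℂ ^ d * R (cM a)) 0 := by unfold Cg; rw [sub_zero]; exact Dvd.intro _ rfl
      have := e3.add (Rmul (cM b) F)
      rwa [zero_add] at this
    have e4 := xsubd _ _ e2 ψ
    rw [map_mul] at e4
    have e5 : Cg (xx ℂ ^ d) (ψ F) (ψ (R (cM b)) * χ F) := e4.trans ((Cg.refl _).mul (χF F).symm)
    exact e5.mem (memx _) (Ideal.mul_mem_left _ _ (memF _))

theorem step3 {d : ℕ} (hd : 1 ≤ d) (ψ : P2 CX ≃ₐ[CX] P2 CX) (F : P2 CX) (hF : cM F = F)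
    (h : ∀ i, Cg (xx ℂ) (cM (ψ (X i))) (ψ (X i)))
    (hI : cM (ψ F) ∈ Ideal.span {xx ℂ ^ d, ψ F}) :
    ∃ χ : P2 CX ≃ₐ[CX] P2 CX, cM (χ (X 0)) = χ (X 0) ∧ cM (χ (X 1)) = χ (X 1) ∧
      χ F ∈ Ideal.span {xx ℂ ^ d, ψ F} ∧ ψ F ∈ Ideal.span {xx ℂ ^ d, χ F} := by
  let ρ0 : CX →+* CX := Polynomial.C.comp (Polynomial.evalRingHom 0)
  let ρ : P2 CX →+* P2 CX := MvPolynomial.map ρ0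
  have hρ : ∀ f, ρ f = emb (ev0 f) := by
    intro f; simp only [ρ, ρ0, emb, ev0, MvPolynomial.map_map]
  have mem : ∀ i, X i ∈ Algebra.adjoin CX {ρ (ψ (X 0)), ρ (ψ (X 1))} := by
    intro i
    rw [mem_pair]
    refine ⟨ρ (ψ.symm (X i)), ?_⟩
    simp only [ρ]
    rw [← map_aeval2, ← equiv_aeval, AlgEquiv.apply_symm_apply, map_X]
  obtain ⟨P, p0, p1⟩ := exists_equiv _ _ (mem 0) (mem 1)
  have pX : ∀ i, P (X i) = ρ (ψ (X i)) := by intro i; fin_cases i <;> assumption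
  have cemb : ∀ f : P2 ℂ, cM (emb f) = emb (MvPolynomial.map (starRingEnd ℂ) f) := by
    intro f; simp only [emb, MvPolynomial.map_map]
    have : cj.comp Polynomial.C = Polynomial.C.comp (starRingEnd ℂ) := by ext a; simp
    rw [this]
  have evc : ∀ f : P2 CX, ev0 (cM f) = MvPolynomial.map (starRingEnd ℂ) (ev0 f) := by
    intro f; simp only [ev0, MvPolynomial.map_map]; congr 1; ext a <;> simp
  have cP : ∀ i, cM (P (X i)) = P (X i) := by
    intro i
    rw [pX, hρ, cemb, ← evc]
    congr 1
    have := h i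
    rw [Cg, x_dvd_iff, map_sub, sub_eq_zero] at this
    exact this
  have cP' : ∀ f, cM (P f) = P (cM f) := by
    intro f
    rw [equiv_aeval P f, map_aeval2, cP, cP, ← equiv_aeval]
  have cPs : ∀ f, cM (P.symm f) = P.symm (cM f) := by
    intro f
    apply P.injective
    rw [← cP', AlgEquiv.apply_symm_apply, AlgEquiv.apply_symm_apply]
  have hx : ∀ i, Cg (xx ℂ) ((ψ.trans P.symm) (X i)) (X i) := by
    intro i
    have e1 : Cg (xx ℂ) (ψ (X i)) (P (X i)) := by
      rw [pX, hρ]; exact Cg.symm (x_dvd_emb _)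
    have := e1.map P.symm (by have := eq_xp P.symm 1; rwa [pow_one] at this)
    rw [AlgEquiv.symm_apply_apply] at this
    exact this
  obtain ⟨χ, c0, c1, m0, m1⟩ := step3_aux hd (ψ.trans P.symm) F hF (hx 0) (hx 1) (by
    have := mem_map_span P.symm hI
    rw [← cPs] at this
    exact this)
  refine ⟨χ.trans P, ?_, ?_, ?_, ?_⟩
  · rw [AlgEquiv.trans_apply, cP', c0]
  · rw [AlgEquiv.trans_apply, cP', c1]
  · have := mem_map_span P m0
    simpa using this
  · have := mem_map_span P m1
    simpa using this

end KR

set_option linter.unusedSectionVars false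

namespace KR
open MvPolynomial

section W
variable {κ G Γ : Type*} [Field κ] [AddCommGroup G] [AddCommGroup Γ] [LinearOrder Γ]
  [IsOrderedAddMonoid Γ] (w : G →+ Γ)

lemma pow_LE {γ : Γ} {f : AddMonoidAlgebra κ G} (hf : f ∈ LE w γ) (n : ℕ) :
    f ^ n ∈ LE w (n • γ) ∧ comp w (n • γ) (f ^ n) = comp w γ f ^ n := by
  induction n with
  | zero =>
    have h1 : (1 : AddMonoidAlgebra κ G) = AddMonoidAlgebra.single 0 1 := rfl
    rw [zero_smul, pow_zero, pow_zero, h1]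
    exact ⟨single_mem_LE w 1 (by simp), comp_single_eq w (by simp) 1⟩
  | succ n ih =>
    rw [succ_nsmul, pow_succ, pow_succ]
    exact ⟨mul_mem_LE w ih.1 hf, by rw [comp_mul w ih.1 hf, ih.2]⟩

lemma top_unique {γ γ' : Γ} {f : AddMonoidAlgebra κ G} (h1 : f ∈ LE w γ) (h2 : comp w γ f ≠ 0)
    (h3 : f ∈ LE w γ') (h4 : comp w γ' f ≠ 0) : γ = γ' := by
  rcases lt_trichotomy γ γ' with h | h | h
  · exact absurd (comp_of_lt w h h1) h4
  · exact h
  · exact absurd (comp_of_lt w h h3) h2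

lemma comp_comp (γ : Γ) (f : AddMonoidAlgebra κ G) : comp w γ (comp w γ f) = comp w γ f := by
  classical
  ext g
  rw [coeff_comp, coeff_comp]; split_ifs <;> rfl

lemma comp_weight_unique {γ γ' : Γ} {f : AddMonoidAlgebra κ G} (h0 : f ≠ 0)
    (h1 : comp w γ f = f) (h2 : comp w γ' f = f) : γ = γ' := by
  classical
  by_contra h
  apply h0
  rw [← h2, ← h1]
  ext g
  rw [coeff_comp, coeff_comp]
  split_ifs with h3 h4
  · exact absurd (h4.symm.trans h3) h
  · rfl
  · rfl
end W

/-- the lexicographic weight -/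
def wL (k l : ℕ) : (Fin 3 → ℤ) →+ ℤ ×ₗ ℤ where
  toFun g := toLex (-g 0, l * g 1 + k * g 2)
  map_zero' := by simp
  map_add' := by
    intro a b
    rw [← toLex_add, Prod.mk_add_mk]
    simp only [Pi.add_apply]
    congr 2 <;> ring

lemma lx_LE (k l : ℕ) (i : Fin 3) : lx ℂ i ∈ LE (wL k l) (wL k l (Pi.single i 1)) := mon_mem _ _
lemma lx_comp (k l : ℕ) (i : Fin 3) :
  comp (wL k l) (wL k l (Pi.single i 1)) (lx ℂ i) = lx ℂ i := comp_mon _ _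

lemma wL0 (k l : ℕ) : wL k l (Pi.single 0 1) = toLex (-1, 0) := by simp [wL]
lemma wL1 (k l : ℕ) : wL k l (Pi.single 1 1) = toLex (0, (l:ℤ)) := by simp [wL]
lemma wL2 (k l : ℕ) : wL k l (Pi.single 2 1) = toLex (0, (k:ℤ)) := by simp [wL]

/-- polynomials in `z,t`. -/
noncomputable def rho : P2 ℂ →ₐ[ℂ] Lau ℂ 3 := aeval ![lx ℂ 1, lx ℂ 2]

lemma nsmul_lex (n : ℕ) (a b : ℤ) : n • (toLex (a, b) : ℤ ×ₗ ℤ) = toLex (n * a, n * b) := by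
  induction n with
  | zero => simp; rfl
  | succ n ih =>
    rw [succ_nsmul, ih, ← toLex_add, Prod.mk_add_mk]
    push_cast
    congr 2 <;> ring

lemma monz (k l a b : ℕ) : (lx ℂ 1 ^ a * lx ℂ 2 ^ b : Lau ℂ 3) ∈ LE (wL k l) (toLex (0, (l:ℤ)*a+k*b)) ∧
    ∀ γ, comp (wL k l) γ (lx ℂ 1 ^ a * lx ℂ 2 ^ b : Lau ℂ 3) =
      if toLex (0, (l:ℤ)*a+k*b) = γ then (lx ℂ 1 ^ a * lx ℂ 2 ^ b : Lau ℂ 3) else 0 := by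
  have h : (lx ℂ 1 ^ a * lx ℂ 2 ^ b : Lau ℂ 3) = AddMonoidAlgebra.single
      (a • Pi.single 1 1 + b • Pi.single 2 1) 1 := by
    rw [lx, lx, ← mon_nsmul, ← mon_nsmul, ← mon_add]; rfl
  have h2 : wL k l (a • Pi.single 1 1 + b • Pi.single 2 1) = toLex (0, (l:ℤ)*a+k*b) := by
    rw [map_add, map_nsmul, map_nsmul, wL1, wL2, nsmul_lex, nsmul_lex, ← toLex_add, Prod.mk_add_mk]
    congr 2
    ring
  rw [h, ← h2]
  refine ⟨single_mem_LE _ 1 le_rfl, fun γ => ?_⟩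
  rw [comp_single]

lemma rho_eq (r : P2 ℂ) : rho r = ∑ s ∈ r.support, r.coeff s • (lx ℂ 1 ^ (s 0) * lx ℂ 2 ^ (s 1)) := by
  rw [rho, aeval_def, eval₂_eq']
  refine Finset.sum_congr rfl fun s _ => ?_
  rw [Algebra.smul_def]; simp [Fin.prod_univ_two]

lemma comp_rho (k l : ℕ) (r : P2 ℂ) (γ) : comp (wL k l) γ (rho r) =
    ∑ s ∈ r.support.filter (fun s => toLex (0, (l:ℤ)*(s 0 : ℕ)+k*(s 1 : ℕ)) = γ),
      r.coeff s • (lx ℂ 1 ^ (s 0) * lx ℂ 2 ^ (s 1)) := by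
  rw [rho_eq, map_sum, Finset.sum_filter]
  refine Finset.sum_congr rfl fun s _ => ?_
  rw [map_smul, (monz k l _ _).2]
  split_ifs <;> simp

/-- `g` in the Laurent ring -/
noncomputable def gL (k l : ℕ) : Lau ℂ 3 := lx ℂ 1 ^ k + lx ℂ 2 ^ l
/-- `y` -/
noncomputable def yL (d k l : ℕ) : Lau ℂ 3 := - (mon ℂ (-Pi.single 0 1) ^ d * (gL k l + lx ℂ 0))
/-- top of `y` -/
noncomputable def YL (d k l : ℕ) : Lau ℂ 3 := - (mon ℂ (-Pi.single 0 1) ^ d * gL k l)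

lemma xinv : (mon ℂ (-Pi.single 0 1) : Lau ℂ 3) * lx ℂ 0 = 1 := mon_neg_mul _

lemma yL_rel (d k l : ℕ) : lx ℂ 0 ^ d * yL d k l = - (gL k l + lx ℂ 0) := by
  rw [yL, mul_neg, ← mul_assoc, ← mul_pow, mul_comm (lx ℂ 0), xinv, one_pow, one_mul]
lemma YL_rel (d k l : ℕ) : lx ℂ 0 ^ d * YL d k l = - gL k l := by
  rw [YL, mul_neg, ← mul_assoc, ← mul_pow, mul_comm (lx ℂ 0), xinv, one_pow, one_mul]

lemma gL_LE (k l : ℕ) : gL k l ∈ LE (wL k l) (toLex (0, (k:ℤ)*l)) ∧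
    comp (wL k l) (toLex (0, (k:ℤ)*l)) (gL k l) = gL k l := by
  have h1 := monz k l k 0
  have h2 := monz k l 0 l
  simp only [pow_zero, mul_one, one_mul, Nat.cast_zero, mul_zero, add_zero, zero_add] at h1 h2
  rw [mul_comm (l:ℤ)] at h1
  refine ⟨Submodule.add_mem _ h1.1 h2.1, ?_⟩
  rw [gL, map_add, h1.2, h2.2, if_pos rfl, if_pos rfl]

lemma xd_LE (d k l : ℕ) : (mon ℂ (-Pi.single 0 1) ^ d : Lau ℂ 3) ∈ LE (wL k l) (toLex ((d:ℤ), 0)) ∧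
    comp (wL k l) (toLex ((d:ℤ), 0)) (mon ℂ (-Pi.single 0 1) ^ d : Lau ℂ 3) =
      (mon ℂ (-Pi.single 0 1) ^ d : Lau ℂ 3) := by
  have h := pow_LE (wL k l) (mon_mem (κ := ℂ) (wL k l) (-Pi.single 0 1)) d
  rw [comp_mon, map_neg, wL0, ← toLex_neg, nsmul_lex] at h
  simpa using h

lemma yL_LE (d k l : ℕ) : yL d k l ∈ LE (wL k l) (toLex ((d:ℤ), (k:ℤ)*l)) ∧
    comp (wL k l) (toLex ((d:ℤ), (k:ℤ)*l)) (yL d k l) = YL d k l := by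
  have e : (toLex ((d:ℤ), (k:ℤ)*l) : ℤ ×ₗ ℤ) = toLex ((d:ℤ), 0) + toLex (0, (k:ℤ)*l) := by
    rw [← toLex_add]; simp
  have hlt : wL k l (Pi.single 0 1) < toLex (0, (k:ℤ)*l) := by
    rw [wL0, Prod.Lex.toLex_lt_toLex]; left; norm_num
  have hx := LE_mono (κ := ℂ) (wL k l) hlt.le (lx_LE k l 0)
  have hg := Submodule.add_mem _ (gL_LE k l).1 hx
  rw [e, yL, YL]
  refine ⟨Submodule.neg_mem _ (mul_mem_LE _ (xd_LE d k l).1 hg), ?_⟩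
  rw [map_neg, comp_mul _ (xd_LE d k l).1 hg, (xd_LE d k l).2, map_add, (gL_LE k l).2,
    comp_of_lt _ hlt (lx_LE k l 0), add_zero]

lemma YL_comp (d k l : ℕ) :
    comp (wL k l) (toLex ((d:ℤ), (k:ℤ)*l)) (YL d k l) = YL d k l := by
  have e : (toLex ((d:ℤ), (k:ℤ)*l) : ℤ ×ₗ ℤ) = toLex ((d:ℤ), 0) + toLex (0, (k:ℤ)*l) := by
    rw [← toLex_add]; simp
  rw [e, YL, map_neg, comp_mul _ (xd_LE d k l).1 (gL_LE k l).1, (xd_LE d k l).2, (gL_LE k l).2]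

lemma YL_mem (d k l : ℕ) : YL d k l ∈ LE (wL k l) (toLex ((d:ℤ), (k:ℤ)*l)) := by
  rw [← YL_comp]; exact comp_mem_LE _ _ _

lemma lx_ne (i : Fin 3) : lx ℂ i ≠ 0 := mon_ne_zero _

lemma rho_inj : Function.Injective rho := by
  have : rho = (lau ℂ 3).comp (rename (Fin.succ : Fin 2 → Fin 3)) := by
    apply MvPolynomial.algHom_ext
    intro i
    fin_cases i <;> simp [rho, lau]
  rw [this]
  exact (lau_injective ℂ 3).comp (rename_injective _ (Fin.succ_injective 2))

lemma lincomb_ne (k l : ℕ) (hk : 2 ≤ k) (μ : ℂ) : lx ℂ 1 ^ k - μ • lx ℂ 2 ^ l ≠ (0 : Lau ℂ 3) := by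
  intro h
  have : rho (X 0 ^ k - C μ * X 1 ^ l) = 0 := by
    rw [← h]; simp [rho, Algebra.smul_def]
  rw [map_eq_zero_iff _ rho_inj] at this
  have h2 := congrArg (aeval (![1, 0] : Fin 2 → ℂ)) this
  have h3 := congrArg (aeval (![1, 1] : Fin 2 → ℂ)) this
  have h4 := congrArg (aeval (![2, 1] : Fin 2 → ℂ)) this
  simp at h2 h3 h4
  rw [← h3] at h4
  have h5 : (2:ℂ)^k = 1 := by linear_combination h4
  have h6 : ((2^k : ℕ):ℂ) = ((1:ℕ):ℂ) := by push_cast; exact h5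
  have h7 := Nat.cast_injective (R := ℂ) h6
  have := Nat.one_lt_two_pow (n := k) (by omega)
  omega

lemma gL_ne (k l : ℕ) (hk : 2 ≤ k) : gL k l ≠ 0 := by
  have := lincomb_ne k l hk (-1)
  rwa [neg_smul, one_smul, sub_neg_eq_add] at this

lemma YL_ne (d k l : ℕ) (hk : 2 ≤ k) : YL d k l ≠ 0 :=
  neg_ne_zero.2 (mul_ne_zero (pow_ne_zero _ (mon_ne_zero _)) (gL_ne k l hk))
end KR

set_option linter.unusedSectionVars false

namespace KR
open MvPolynomial

/-- A Koras-Russell presentation inside the Laurent ring. -/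
structure Pres (d k l : ℕ) (B : Type*) [CommRing B] [Algebra ℂ B] where
  ι : B →ₐ[ℂ] Lau ℂ 3
  inj : Function.Injective ι
  x : B
  y : B
  z : B
  t : B
  hx : ι x = lx ℂ 0
  hy : ι y = yL d k l
  hz : ι z = lx ℂ 1
  ht : ι t = lx ℂ 2
  gen : Algebra.adjoin ℂ {x, y, z, t} = ⊤

namespace Pres
variable {d k l : ℕ} {B : Type*} [CommRing B] [Algebra ℂ B] (P : Pres d k l B)

/-- the subring `R` -/
def R : Subalgebra ℂ B := Algebra.adjoin ℂ {P.x, P.z, P.t}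

lemma xR : P.x ∈ P.R := Algebra.subset_adjoin (by simp)
lemma zR : P.z ∈ P.R := Algebra.subset_adjoin (by simp)
lemma tR : P.t ∈ P.R := Algebra.subset_adjoin (by simp)

lemma rel : P.x ^ d * P.y + P.z ^ k + P.x + P.t ^ l = 0 := by
  apply P.inj
  simp only [map_add, map_mul, map_pow, P.hx, P.hy, P.hz, P.ht, yL_rel, map_zero, gL]
  ring
end Pres

/-- index set for the normal form -/
abbrev NI (d : ℕ) := {p : ℕ × ℕ // p.1 < d ∨ p.2 = 0}

/-- basis element -/
noncomputable def eL (d k l : ℕ) (j : NI d) : Lau ℂ 3 := lx ℂ 0 ^ j.1.1 * yL d k l ^ j.1.2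

/-- normal forms -/
noncomputable def NF (d k l : ℕ) : Submodule rho.range (Lau ℂ 3) :=
  Submodule.span _ (Set.range (eL d k l))

lemma eL_mem (d k l : ℕ) (a i : ℕ) (h : a < d ∨ i = 0) : lx ℂ 0 ^ a * yL d k l ^ i ∈ NF d k l :=
  Submodule.subset_span ⟨⟨(a, i), h⟩, rfl⟩

lemma rho_mul_mem {d k l : ℕ} (r : P2 ℂ) {v : Lau ℂ 3} (hv : v ∈ NF d k l) :
    rho r * v ∈ NF d k l :=
  Submodule.smul_mem _ (⟨rho r, r, rfl⟩ : rho.range) hv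

lemma gL_rho (k l : ℕ) : gL k l = rho (X 0 ^ k + X 1 ^ l) := by simp [gL, rho]

lemma x_mul_mem {d k l : ℕ} (hd : 2 ≤ d) {v : Lau ℂ 3} (hv : v ∈ NF d k l) :
    lx ℂ 0 * v ∈ NF d k l := by
  induction hv using Submodule.span_induction with
  | mem v hv =>
    obtain ⟨⟨⟨a, i⟩, h⟩, rfl⟩ := hv
    simp only [eL]
    rw [← mul_assoc, ← pow_succ']
    rcases Nat.eq_zero_or_pos i with rfl | hi
    · exact eL_mem _ _ _ _ _ (Or.inr rfl)
    · have ha : a < d := by rcases h with h | h; exact h; simp at h; omega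
      rcases Nat.lt_or_ge (a+1) d with h1 | h1
      · exact eL_mem _ _ _ _ _ (Or.inl h1)
      · obtain ⟨j, rfl⟩ := Nat.exists_eq_succ_of_ne_zero hi.ne'
        have : a + 1 = d := by omega
        rw [this, pow_succ', ← mul_assoc, yL_rel, neg_mul, add_mul]
        refine Submodule.neg_mem _ (Submodule.add_mem _ ?_ ?_)
        · rw [gL_rho]
          apply rho_mul_mem
          have := eL_mem d k l 0 j (Or.inl (by omega))
          simpa using this
        · have := eL_mem d k l 1 j (Or.inl (by omega))
          simpa using this
  | zero => simp
  | add a b _ _ ha hb => rw [mul_add]; exact Submodule.add_mem _ ha hb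
  | smul r a _ ha => rw [mul_smul_comm]; exact Submodule.smul_mem _ _ ha

lemma y_mul_mem {d k l : ℕ} (hd : 2 ≤ d) {v : Lau ℂ 3} (hv : v ∈ NF d k l) :
    yL d k l * v ∈ NF d k l := by
  induction hv using Submodule.span_induction with
  | mem v hv =>
    obtain ⟨⟨⟨a, i⟩, h⟩, rfl⟩ := hv
    simp only [eL]
    rcases Nat.lt_or_ge a d with h1 | h1
    · rw [mul_left_comm, ← pow_succ']
      exact eL_mem _ _ _ _ _ (Or.inl h1)
    · have hi : i = 0 := by rcases h with h | h; simp at h; omega; exact h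
      subst hi
      obtain ⟨c, rfl⟩ := Nat.exists_eq_add_of_le h1
      have e : yL d k l * (lx ℂ 0 ^ (d + c) * yL d k l ^ 0) =
          -(gL k l * lx ℂ 0 ^ c + lx ℂ 0 * lx ℂ 0 ^ c) := by
        rw [pow_add, pow_zero, mul_one]
        linear_combination lx ℂ 0 ^ c * yL_rel d k l
      have hc : lx ℂ 0 ^ c ∈ NF d k l := by
        have := eL_mem d k l c 0 (Or.inr rfl); simpa using this
      rw [e]
      refine Submodule.neg_mem _ (Submodule.add_mem _ ?_ (x_mul_mem hd hc))
      rw [gL_rho]; exact rho_mul_mem _ hc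
  | zero => simp
  | add a b _ _ ha hb => rw [mul_add]; exact Submodule.add_mem _ ha hb
  | smul r a _ ha => rw [mul_smul_comm]; exact Submodule.smul_mem _ _ ha

namespace Pres
variable {d k l : ℕ} {B : Type*} [CommRing B] [Algebra ℂ B] (P : Pres d k l B)

lemma mem_NF (hd : 2 ≤ d) (b : B) : P.ι b ∈ NF d k l := by
  have key : ∀ b : B, b ∈ Algebra.adjoin ℂ {P.x, P.y, P.z, P.t} →
      ∀ v ∈ NF d k l, P.ι b * v ∈ NF d k l := by
    intro b hb
    induction hb using Algebra.adjoin_induction with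
    | mem b hb =>
      intro v hv
      rcases hb with rfl | rfl | rfl | rfl
      · rw [P.hx]; exact x_mul_mem hd hv
      · rw [P.hy]; exact y_mul_mem hd hv
      · rw [P.hz]
        have : lx ℂ 1 = rho (X 0) := by simp [rho]
        rw [this]; exact rho_mul_mem _ hv
      · rw [P.ht]
        have : lx ℂ 2 = rho (X 1) := by simp [rho]
        rw [this]; exact rho_mul_mem _ hv
    | algebraMap r =>
      intro v hv
      have : P.ι (algebraMap ℂ B r) = rho (C r) := by
        rw [AlgHom.commutes, ← algebraMap_eq, AlgHom.commutes]
      rw [this]; exact rho_mul_mem _ hv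
    | add a b _ _ ha hb =>
      intro v hv
      rw [map_add, add_mul]; exact Submodule.add_mem _ (ha v hv) (hb v hv)
    | mul a b _ _ ha hb =>
      intro v hv
      rw [map_mul, mul_assoc]; exact ha _ (hb v hv)
  have h1 : (1 : Lau ℂ 3) ∈ NF d k l := by
    have := eL_mem d k l 0 0 (Or.inr rfl); simpa using this
  have := key b (by rw [P.gen]; trivial) 1 h1
  rwa [mul_one] at this

lemma rho_R (r : P2 ℂ) : rho r = P.ι (aeval ![P.z, P.t] r) := by
  have : rho = P.ι.comp (aeval ![P.z, P.t]) := by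
    apply MvPolynomial.algHom_ext
    intro i
    fin_cases i <;> simp [rho, P.hz, P.ht]
  rw [this]; rfl

lemma aeval_R (r : P2 ℂ) : aeval ![P.z, P.t] r ∈ P.R := by
  have h : aeval ![P.z, P.t] r ∈ (aeval (R := ℂ) ![P.z, P.t]).range := ⟨r, rfl⟩
  rw [← Algebra.adjoin_range_eq_range_aeval] at h
  refine Algebra.adjoin_mono ?_ h
  rintro _ ⟨i, rfl⟩
  fin_cases i <;> simp

/-- Leading components. -/
lemma star (hd : 2 ≤ d) (hk : 2 ≤ k) (b : B) (γ : ℤ ×ₗ ℤ) (h1 : P.ι b ∈ LE (wL k l) γ)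
    (h2 : comp (wL k l) γ (P.ι b) ≠ 0) :
    ∃ (a i : ℕ) (γ' : ℤ ×ₗ ℤ) (r : P2 ℂ),
      comp (wL k l) γ (P.ι b) = lx ℂ 0 ^ a * YL d k l ^ i * comp (wL k l) γ' (rho r) ∧
      (i = 0 → b ∈ P.R) := by
  classical
  have hm := P.mem_NF hd b
  rw [NF, Finsupp.mem_span_range_iff_exists_finsupp] at hm
  obtain ⟨c, hc⟩ := hm
  have hb : P.ι b ≠ 0 := by rintro h; rw [h] at h2; simp at h2
  have hne : c.support.Nonempty := by
    rw [Finsupp.support_nonempty_iff]; rintro rfl; exact hb (by rw [← hc]; simp)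
  let s : NI d → ℤ := fun j => d * j.1.2 - j.1.1
  obtain ⟨j0, hj0, hmax⟩ := Finset.exists_max_image c.support s hne
  have hinj : ∀ j j', s j = s j' → j = j' := by
    rintro ⟨⟨a, i⟩, h⟩ ⟨⟨a', i'⟩, h'⟩ hs
    simp only [s] at hs h h' ⊢
    have hii : i = i' := by
      rcases lt_trichotomy i i' with hlt | heq | hlt
      · exfalso
        have h3 : a' < d := by omega
        have : (d:ℤ) * (i + 1) ≤ d * i' := mul_le_mul_of_nonneg_left (by omega) (by omega)
        rw [mul_add] at this
        omega
      · exact heq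
      · exfalso
        have h3 : a < d := by omega
        have : (d:ℤ) * (i' + 1) ≤ d * i := mul_le_mul_of_nonneg_left (by omega) (by omega)
        rw [mul_add] at this
        omega
    subst hii
    have : a = a' := by omega
    subst this; rfl
  have he : ∀ j : NI d, eL d k l j ∈ LE (wL k l) (toLex (s j, ((j.1.2:ℕ):ℤ) * ((k:ℤ) * l))) ∧
      comp (wL k l) (toLex (s j, ((j.1.2:ℕ):ℤ) * ((k:ℤ) * l))) (eL d k l j) =
        lx ℂ 0 ^ j.1.1 * YL d k l ^ j.1.2 := by
    intro j
    have e : (toLex (s j, ((j.1.2:ℕ):ℤ) * ((k:ℤ) * l)) : ℤ ×ₗ ℤ) =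
      j.1.1 • wL k l (Pi.single 0 1) + j.1.2 • toLex ((d:ℤ), (k:ℤ)*l) := by
      rw [wL0, nsmul_lex, nsmul_lex, ← toLex_add, Prod.mk_add_mk]
      simp only [s]
      congr 2 <;> ring
    have p1 := pow_LE _ (lx_LE k l 0) j.1.1
    have p2 := pow_LE _ (yL_LE d k l).1 j.1.2
    rw [e, eL]
    exact ⟨mul_mem_LE _ p1.1 p2.1, by rw [comp_mul _ p1.1 p2.1, p1.2, p2.2, lx_comp, (yL_LE d k l).2]⟩
  have hr : ∀ r : rho.range, ∃ m : ℤ, (r : Lau ℂ 3) ∈ LE (wL k l) (toLex (0, m)) ∧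
      (r ≠ 0 → comp (wL k l) (toLex (0, m)) (r : Lau ℂ 3) ≠ 0) := by
    rintro ⟨_, r, rfl⟩
    by_cases h0 : rho r = 0
    · refine ⟨0, ?_, fun h => absurd (Subtype.ext h0) h⟩
      have : ((rho : P2 ℂ →+* Lau ℂ 3) r) = 0 := h0
      change rho r ∈ _
      rw [h0]; exact Submodule.zero_mem _
    · obtain ⟨γ', h3, h4⟩ := exists_top (wL k l) h0
      have h5 := h4
      rw [comp_rho] at h5
      obtain ⟨s, hs, _⟩ := Finset.exists_ne_zero_of_sum_ne_zero h5
      rw [Finset.mem_filter] at hs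
      rw [← hs.2] at h3 h4
      exact ⟨_, h3, fun _ => h4⟩
  obtain ⟨m0, hm0, hm0'⟩ := hr (c j0)
  replace hm0' := hm0' (Finsupp.mem_support_iff.1 hj0)
  set γ0 : ℤ ×ₗ ℤ := toLex (0, m0) + toLex (s j0, ((j0.1.2:ℕ):ℤ) * ((k:ℤ) * l)) with hγ0
  have hγ0' : γ0 = toLex (s j0, m0 + ((j0.1.2:ℕ):ℤ) * ((k:ℤ) * l)) := by
    rw [hγ0, ← toLex_add]; simp
  have hsum : P.ι b = (c j0 : Lau ℂ 3) * eL d k l j0 +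
      ∑ j ∈ c.support.erase j0, (c j : Lau ℂ 3) * eL d k l j := by
    rw [← hc, Finsupp.sum, ← Finset.add_sum_erase _ _ hj0]
    rfl
  have hrest : ∀ j ∈ c.support.erase j0, ∃ γ1 < γ0, (c j : Lau ℂ 3) * eL d k l j ∈ LE (wL k l) γ1 := by
    intro j hj
    rw [Finset.mem_erase] at hj
    obtain ⟨m, hm, -⟩ := hr (c j)
    refine ⟨_, ?_, mul_mem_LE _ hm (he j).1⟩
    rw [hγ0', ← toLex_add, Prod.mk_add_mk, Prod.Lex.toLex_lt_toLex]
    left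
    have : s j ≠ s j0 := fun h => hj.1 (hinj _ _ h)
    have := hmax j hj.2
    show 0 + s j < s j0
    omega
  have hmem : P.ι b ∈ LE (wL k l) γ0 := by
    rw [hsum]
    refine Submodule.add_mem _ (mul_mem_LE _ hm0 (he j0).1) (Submodule.sum_mem _ fun j hj => ?_)
    obtain ⟨γ1, hlt, hm⟩ := hrest j hj
    exact LE_mono _ hlt.le hm
  have hcomp : comp (wL k l) γ0 (P.ι b) =
      comp (wL k l) (toLex (0, m0)) (c j0 : Lau ℂ 3) * (lx ℂ 0 ^ j0.1.1 * YL d k l ^ j0.1.2) := by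
    rw [hsum, map_add, map_sum, Finset.sum_eq_zero, add_zero, hγ0, comp_mul _ hm0 (he j0).1, (he j0).2]
    intro j hj
    obtain ⟨γ1, hlt, hm⟩ := hrest j hj
    exact comp_of_lt _ hlt hm
  have hγ : γ = γ0 := by
    rcases lt_trichotomy γ γ0 with h | h | h
    · exfalso
      have h3 := comp_of_lt _ h h1
      rw [hcomp] at h3
      have hY : YL d k l ≠ 0 := YL_ne d k l hk
      exact (mul_ne_zero hm0' (mul_ne_zero (pow_ne_zero _ (lx_ne 0)) (pow_ne_zero _ hY))) h3
    · exact h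
    · exact absurd (comp_of_lt _ h hmem) h2
  subst hγ
  obtain ⟨r, hr0⟩ := (c j0).2
  refine ⟨j0.1.1, j0.1.2, toLex (0, m0), r, ?_, ?_⟩
  · rw [hcomp]
    have : (c j0 : Lau ℂ 3) = rho r := hr0.symm
    rw [this, mul_comm]
  · intro hi
    have : ∀ j ∈ c.support, j.1.2 = 0 := by
      intro j hj
      by_contra hne
      have h3 := hmax j hj
      have h4 : j.1.1 < d := by rcases j.2 with h | h; exact h; exact absurd h hne
      have h5 : (d:ℤ) * 1 ≤ d * j.1.2 := mul_le_mul_of_nonneg_left (by omega) (by omega)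
      simp only [s, hi] at h3
      push_cast at h3
      omega
    have hb' : P.ι b ∈ P.R.map P.ι := by
      rw [← hc, Finsupp.sum]
      refine Subalgebra.sum_mem _ fun j hj => ?_
      change (c j : Lau ℂ 3) * eL d k l j ∈ _
      refine Subalgebra.mul_mem _ ?_ ?_
      · obtain ⟨r, hr0⟩ := (c j).2
        have : (c j : Lau ℂ 3) = rho r := hr0.symm
        rw [this, P.rho_R]
        exact ⟨_, P.aeval_R r, rfl⟩
      · rw [eL, this j hj, pow_zero, mul_one, ← P.hx, ← map_pow]
        exact ⟨_, Subalgebra.pow_mem _ P.xR _, rfl⟩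
    obtain ⟨b', hb1, hb2⟩ := hb'
    rwa [← P.inj hb2]

end Pres
end KR

set_option linter.unusedSectionVars false

namespace KR
open MvPolynomial

instance : CharZero (Lau ℂ 3) := charZero_of_injective_algebraMap (algebraMap ℂ (Lau ℂ 3)).injective

lemma all_killed {d k l : ℕ} (hd : 2 ≤ d) (hk : 2 ≤ k) (hl : 2 ≤ l)
    (D : Derivation ℂ (Lau ℂ 3) (Lau ℂ 3)) (hn : ∀ i, Nil D (lx ℂ i)) (hY : D (YL d k l) = 0)
    (h : D (lx ℂ 0) = 0 ∨ D (lx ℂ 1) = 0 ∨ D (lx ℂ 2) = 0 ∨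
      ∃ μ : ℂ, μ ≠ 0 ∧ D (lx ℂ 1 ^ k - μ • lx ℂ 2 ^ l) = 0) (i : Fin 3) : D (lx ℂ i) = 0 := by
  have hrel : YL d k l * lx ℂ 0 ^ d + lx ℂ 1 ^ k + lx ℂ 2 ^ l = 0 := by
    have := YL_rel d k l
    rw [gL] at this
    linear_combination this
  have hY0 := YL_ne d k l hk
  have h1 : D (1 : Lau ℂ 3) = 0 := by simp
  have hp : ∀ (a : Lau ℂ 3) (n : ℕ), D a = 0 → D (a ^ n) = 0 := by
    intro a n ha; rw [Derivation.leibniz_pow, ha]; simp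
  have hz : D (lx ℂ 1) = 0 → ∀ i, D (lx ℂ i) = 0 := by
    intro hz
    have := mason D (hn 0) (hn 2) (α := YL d k l) (β := 1) (γ := -lx ℂ 1 ^ k) (p := d) (q := l) hY h1
      (by rw [map_neg, hp _ _ hz, neg_zero]) hY0 one_ne_zero
      (neg_ne_zero.2 (pow_ne_zero _ (lx_ne 1))) hd hl (by linear_combination hrel)
    intro i; fin_cases i
    exacts [this.1, hz, this.2]
  rcases h with h | h | h | ⟨μ, hμ, h⟩
  · have := mason D (hn 1) (hn 2) (α := 1) (β := 1) (γ := -(YL d k l * lx ℂ 0 ^ d)) (p := k) (q := l) h1 h1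
      (by rw [map_neg, Derivation.leibniz, hp _ _ h, hY]; simp) one_ne_zero one_ne_zero
      (neg_ne_zero.2 (mul_ne_zero hY0 (pow_ne_zero _ (lx_ne 0)))) hk hl (by linear_combination hrel)
    exact hz this.1 i
  · exact hz h i
  · have := mason D (hn 0) (hn 1) (α := YL d k l) (β := 1) (γ := -lx ℂ 2 ^ l) (p := d) (q := k) hY h1
      (by rw [map_neg, hp _ _ h, neg_zero]) hY0 one_ne_zero
      (neg_ne_zero.2 (pow_ne_zero _ (lx_ne 2))) hd hk (by linear_combination hrel)
    exact hz this.2 i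
  · have := mason D (hn 1) (hn 2) (α := 1) (β := algebraMap ℂ (Lau ℂ 3) (-μ))
      (γ := lx ℂ 1 ^ k - μ • lx ℂ 2 ^ l) (p := k) (q := l) h1 (D.map_algebraMap _) h one_ne_zero
      (by rw [Ne, map_eq_zero_iff _ (algebraMap ℂ (Lau ℂ 3)).injective]; simpa using hμ)
      (lincomb_ne k l hk μ) hk hl (by rw [← Algebra.smul_def, neg_smul, one_mul, sub_eq_add_neg])
    exact hz this.1 i

lemma prod_ker {L : Type*} [CommRing L] [IsDomain L] [CharZero L] [Algebra ℂ L]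
    (D : Derivation ℂ L L) (T : Multiset ℂ) (f : ℂ → L)
    (hf : ∀ μ, Nil D (f μ)) (h : D (T.map f).prod = 0) (h0 : (T.map f).prod ≠ 0) :
    ∀ μ ∈ T, D (f μ) = 0 := by
  have hnil : ∀ T : Multiset ℂ, Nil D (T.map f).prod := by
    intro T
    induction T using Multiset.induction_on with
    | empty => exact Nil.of_ker D (by simp)
    | cons a T ih => rw [Multiset.map_cons, Multiset.prod_cons]; exact (hf a).mul D ih
  intro μ hμ
  obtain ⟨T', rfl⟩ := Multiset.exists_cons_of_mem hμ
  rw [Multiset.map_cons, Multiset.prod_cons] at h h0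
  exact (ker_of_mul D (hf μ) (hnil _) h h0).1

lemma claimB {d k l : ℕ} (hd : 2 ≤ d) (hk : 2 ≤ k) (hl : 2 ≤ l) (hcop : Nat.Coprime k l)
    (D : Derivation ℂ (Lau ℂ 3) (Lau ℂ 3)) (hn : ∀ i, Nil D (lx ℂ i)) (hY : D (YL d k l) = 0)
    (hne : ∃ i : Fin 3, D (lx ℂ i) ≠ 0) (a i : ℕ) (γ : ℤ ×ₗ ℤ) (r : P2 ℂ)
    (h0 : lx ℂ 0 ^ a * YL d k l ^ i * comp (wL k l) γ (rho r) ≠ 0)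
    (h1 : D (lx ℂ 0 ^ a * YL d k l ^ i * comp (wL k l) γ (rho r)) = 0) :
    ∃ c : ℂ, c ≠ 0 ∧ lx ℂ 0 ^ a * YL d k l ^ i * comp (wL k l) γ (rho r) = c • YL d k l ^ i := by
  obtain ⟨j, hj⟩ := hne
  have hall := fun h => hj (all_killed hd hk hl D hn hY h j)
  have hr0 := right_ne_zero_of_mul h0
  have hNr : Nil D (comp (wL k l) γ (rho r)) := by
    rw [comp_rho, ← mem_nilSub]
    exact Subalgebra.sum_mem _ fun s _ => Subalgebra.smul_mem _ (Subalgebra.mul_mem _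
      (Subalgebra.pow_mem _ (hn 1) _) (Subalgebra.pow_mem _ (hn 2) _)) _
  have hNx := (hn 0).pow D a
  have hNY := (Nil.of_ker D hY).pow D i
  obtain ⟨h2, h3⟩ := ker_of_mul D (hNx.mul D hNY) hNr h1 h0
  obtain ⟨h4, -⟩ := ker_of_mul D hNx hNY h2 (left_ne_zero_of_mul h0)
  have ha : a = 0 := by
    by_contra ha
    exact hall (Or.inl (ker_of_pow D (hn 0) ha h4))
  subst ha
  rw [comp_rho] at hr0 h3 ⊢
  set S := r.support.filter (fun s => toLex (0, (l:ℤ)*(s 0 : ℕ)+k*(s 1 : ℕ)) = γ) with hS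
  have hSne : S.Nonempty := by
    by_contra h
    rw [Finset.not_nonempty_iff_eq_empty] at h
    rw [h] at hr0; simp at hr0
  obtain ⟨s0, hs0⟩ := hSne
  have hN : ∀ s ∈ S, l * s 0 + k * s 1 = l * s0 0 + k * s0 1 := by
    intro s hs
    rw [hS, Finset.mem_filter] at hs hs0
    have := hs.2.trans hs0.2.symm
    have := congrArg (fun x => (ofLex x).2) this
    simp at this
    exact_mod_cast this
  have hinj : Set.InjOn (fun s : Fin 2 →₀ ℕ => s 0) (S : Set (Fin 2 →₀ ℕ)) := by
    intro s hs s' hs' h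
    simp only at h
    have h1 := (hN s hs).trans (hN s' hs').symm
    rw [h] at h1
    have h2 : s 1 = s' 1 := Nat.eq_of_mul_eq_mul_left (by omega : 0 < k) (by omega)
    ext i; fin_cases i
    · exact h
    · exact h2
  obtain ⟨i', j', c0, T, hc0, hT, -, -, -, hfac⟩ := lemW (L := Lau ℂ 3) S ⟨s0, hs0⟩ (fun s => r.coeff s)
    (fun s hs => by rw [hS, Finset.mem_filter] at hs; exact mem_support_iff.1 hs.1)
    (fun s => s 0) (fun s => s 1) hinj hcop (by omega) hN
  rw [hfac] at hr0 h3 ⊢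
  have hNp : ∀ T : Multiset ℂ, Nil D (T.map (fun μ => (lx ℂ 1 : Lau ℂ 3)^k - μ • lx ℂ 2 ^l)).prod := by
    intro T
    induction T using Multiset.induction_on with
    | empty => exact Nil.of_ker D (by simp)
    | cons a T ih =>
      rw [Multiset.map_cons, Multiset.prod_cons]
      refine Nil.mul D (Nil.sub D ((hn 1).pow D k) ?_) ih
      exact (nilSub D).smul_mem ((hn 2).pow D l) a
  rw [Derivation.map_smul, smul_eq_zero_iff_right hc0] at h3
  rw [smul_ne_zero_iff] at hr0
  obtain ⟨-, hr0⟩ := hr0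
  have hz := (hn 1).pow D i'
  have ht := (hn 2).pow D j'
  obtain ⟨h5, h6⟩ := ker_of_mul D (hz.mul D ht) (hNp T) h3 hr0
  obtain ⟨h7, h8⟩ := ker_of_mul D hz ht h5 (left_ne_zero_of_mul hr0)
  have hi : i' = 0 := by
    by_contra h
    exact hall (Or.inr (Or.inl (ker_of_pow D (hn 1) h h7)))
  have hj' : j' = 0 := by
    by_contra h
    exact hall (Or.inr (Or.inr (Or.inl (ker_of_pow D (hn 2) h h8))))
  have hT0 : T = 0 := by
    rw [Multiset.eq_zero_iff_forall_notMem]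
    intro μ hμ
    refine hall (Or.inr (Or.inr (Or.inr ⟨μ, hT μ hμ, ?_⟩)))
    refine prod_ker D T _ (fun μ => ?_) h6 (right_ne_zero_of_mul hr0) μ hμ
    refine Nil.sub D ((hn 1).pow D k) ?_
    exact (nilSub D).smul_mem ((hn 2).pow D l) μ
  refine ⟨c0, hc0, ?_⟩
  subst hi hj' hT0
  simp [Algebra.smul_def, mul_comm]

namespace Pres
variable {d k l : ℕ} {B : Type*} [CommRing B] [Algebra ℂ B] (P : Pres d k l B)

theorem lemma1 (hd : 2 ≤ d) (hk : 2 ≤ k) (hl : 2 ≤ l) (hcop : Nat.Coprime k l)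
    (D : Derivation ℂ B B) (hD : ∀ b, Nil D b) (hD0 : D ≠ 0) {f : B} (hf : D f = 0) : f ∈ P.R := by
  by_contra hfR
  let tt : Fin 3 → B := ![P.x, P.z, P.t]
  have htt : ∀ i, P.ι (tt i) = lx ℂ i := by
    intro i; fin_cases i
    exacts [P.hx, P.hz, P.ht]
  have : IsDomain B := P.inj.isDomain P.ι.toRingHom
  have hx0 : P.x ≠ 0 := by
    intro h; have := P.hx; rw [h, map_zero] at this; exact lx_ne 0 this.symm
  have hrelD : P.x ^ d * D P.y + (d * P.x ^ (d-1) * D P.x) * P.y + k * P.z ^ (k-1) * D P.z + D P.x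
      + l * P.t ^ (l-1) * D P.t = 0 := by
    have h := congrArg D P.rel
    simp only [map_add, Derivation.leibniz, Derivation.leibniz_pow, map_zero, smul_eq_mul,
      nsmul_eq_mul] at h
    linear_combination h
  have hcomm : ∀ b, derOf (mulOf (logF P.ι tt D)) (P.ι b) = P.ι (D b) := by
    intro b
    have h3 : ∀ i, derOf (mulOf (logF P.ι tt D)) (P.ι (tt i)) = P.ι (D (tt i)) :=
      fun i => derOf_tt P.ι tt D htt i
    have h0 : derOf (mulOf (logF P.ι tt D)) (P.ι P.x) = P.ι (D P.x) := h3 0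
    have h1 : derOf (mulOf (logF P.ι tt D)) (P.ι P.z) = P.ι (D P.z) := h3 1
    have h2 : derOf (mulOf (logF P.ι tt D)) (P.ι P.t) = P.ι (D P.t) := h3 2
    refine derOf_comm_adjoin P.ι D _ {P.x, P.y, P.z, P.t} ?_ (by rw [P.gen]; trivial)
    rintro _ (rfl | rfl | rfl | rfl)
    · exact h0
    · have h4 := congrArg (fun b => derOf (mulOf (logF P.ι tt D)) (P.ι b)) P.rel
      have h5 := congrArg P.ι hrelD
      simp only [map_add, map_mul, map_pow, map_zero, Derivation.leibniz, Derivation.leibniz_pow,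
        smul_eq_mul, nsmul_eq_mul, h0, h1, h2, map_natCast] at h4 h5
      have hx : P.ι P.x ^ d ≠ 0 := by rw [P.hx]; exact pow_ne_zero _ (lx_ne 0)
      apply mul_left_cancel₀ hx
      linear_combination h4 - h5
    · exact h1
    · exact h2
  have hne : ∃ i, D (tt i) ≠ 0 := by
    by_contra h
    push Not at h
    have h0 : D P.x = 0 := h 0
    have h1 : D P.z = 0 := h 1
    have h2 : D P.t = 0 := h 2
    have hy : D P.y = 0 := by
      have h3 := hrelD
      rw [h0, h1, h2] at h3
      simp only [mul_zero, add_zero, zero_mul] at h3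
      exact (mul_eq_zero.1 h3).resolve_left (pow_ne_zero _ hx0)
    apply hD0
    apply Derivation.ext_of_adjoin_eq_top _ P.gen
    rintro _ (rfl | rfl | rfl | rfl)
    · exact h0
    · exact hy
    · exact h1
    · exact h2
  obtain ⟨δ, D', hne', htr⟩ := transport P.ι P.inj tt D hne hcomm (wL k l)
  have hnil : ∀ γ b, P.ι b ∈ LE (wL k l) γ → Nil D' (comp (wL k l) γ (P.ι b)) := by
    intro γ b hb
    obtain ⟨n, hn⟩ := hD b
    exact ⟨n, by rw [← (htr n γ b hb).2, hn]; simp⟩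
  have hn : ∀ i, Nil D' (lx ℂ i) := by
    intro i
    rw [← lx_comp k l i, ← htt i]
    exact hnil _ _ (by rw [htt]; exact lx_LE k l i)
  have hNY : Nil D' (YL d k l) := by
    rw [← (yL_LE d k l).2, ← P.hy]
    exact hnil _ _ (by rw [P.hy]; exact (yL_LE d k l).1)
  have hY : D' (YL d k l) = 0 := by
    have hf0 : P.ι f ≠ 0 := by
      rw [Ne, map_eq_zero_iff _ P.inj]; rintro rfl; exact hfR (Subalgebra.zero_mem _)
    obtain ⟨γ, h1, h2⟩ := exists_top (wL k l) hf0
    obtain ⟨a, i, γ', r, h3, h4⟩ := P.star hd hk f γ h1 h2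
    have h5 : D' (comp (wL k l) γ (P.ι f)) = 0 := by
      have := (htr 1 γ f h1).2
      simp only [Function.iterate_one] at this
      rw [← this, hf]; simp
    rw [h3] at h5 h2
    have hNr : Nil D' (comp (wL k l) γ' (rho r)) := by
      rw [comp_rho, ← mem_nilSub]
      exact Subalgebra.sum_mem _ fun s _ => Subalgebra.smul_mem _ (Subalgebra.mul_mem _
        (Subalgebra.pow_mem _ (hn 1) _) (Subalgebra.pow_mem _ (hn 2) _)) _
    have h6 := (ker_of_mul D' (((hn 0).pow D' a).mul D' (hNY.pow D' i)) hNr h5 h2).1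
    have h7 := (ker_of_mul D' ((hn 0).pow D' a) (hNY.pow D' i) h6 (left_ne_zero_of_mul h2)).2
    exact ker_of_pow D' hNY (fun hi => hfR (h4 hi)) h7
  -- last derivatives
  have claimC : ∀ b : B, ∀ γ, P.ι b ∈ LE (wL k l) γ → comp (wL k l) γ (P.ι b) ≠ 0 →
      ∃ (n i : ℕ) (c : ℂ), c ≠ 0 ∧ D'^[n] (comp (wL k l) γ (P.ι b)) = c • YL d k l ^ i ∧
        D'^[n+1] (comp (wL k l) γ (P.ι b)) = 0 ∧
        γ + n • δ = i • toLex ((d:ℤ), (k:ℤ)*l) := by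
    intro b γ h1 h2
    obtain ⟨n, h3, h4⟩ := (hnil γ b h1).exists_isDeg D' h2
    obtain ⟨h5, h6⟩ := htr n γ b h1
    have h7 : comp (wL k l) (γ + n • δ) (P.ι (D^[n] b)) ≠ 0 := by rw [h6]; exact h3
    obtain ⟨a, i, γ', r, h8, -⟩ := P.star hd hk _ _ h5 h7
    have h9 : D' (comp (wL k l) (γ + n • δ) (P.ι (D^[n] b))) = 0 := by
      rw [h6]; rw [Function.iterate_succ_apply'] at h4; exact h4
    have h10 := h9
    have h7' := h7
    rw [h8] at h9 h7'
    obtain ⟨c, hc, hc'⟩ := claimB hd hk hl hcop D' hn hY hne' a i γ' r h7' h9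
    refine ⟨n, i, c, hc, by rw [← h6, h8, hc'], h4, ?_⟩
    have hY' : (YL d k l ^ i) ≠ 0 := pow_ne_zero _ (YL_ne d k l hk)
    apply comp_weight_unique (wL k l) hY'
    · have := comp_comp (wL k l) (γ + n • δ) (P.ι (D^[n] b))
      rw [h8, hc', map_smul] at this
      exact smul_right_injective _ hc this
    · rw [(pow_LE _ (YL_mem d k l) i).2, YL_comp]
  set γ0 : ℤ ×ₗ ℤ := toLex (0, (k:ℤ)*l) with hγ0
  have hz1 := monz k l k 0
  have ht1 := monz k l 0 l
  simp only [pow_zero, mul_one, one_mul, Nat.cast_zero, mul_zero, add_zero, zero_add] at hz1 ht1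
  rw [mul_comm (l:ℤ)] at hz1
  have ez : P.ι (P.z ^ k) = lx ℂ 1 ^ k := by rw [map_pow, P.hz]
  have et : P.ι (P.t ^ l) = lx ℂ 2 ^ l := by rw [map_pow, P.ht]
  have e3 : ∀ μ : ℂ, P.ι (P.z ^ k - μ • P.t ^ l) = lx ℂ 1 ^ k - μ • lx ℂ 2 ^ l := by
    intro μ; rw [map_sub, map_smul, ez, et]
  have cz := hz1.2 γ0
  have ct := ht1.2 γ0
  rw [if_pos rfl] at cz ct
  have c3 : ∀ μ : ℂ, comp (wL k l) γ0 (lx ℂ 1 ^ k - μ • lx ℂ 2 ^ l) =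
      lx ℂ 1 ^ k - μ • lx ℂ 2 ^ l := by
    intro μ; rw [map_sub, map_smul, cz, ct]
  have wuniq : ∀ n1 i1 n2 i2 : ℕ, γ0 + n1 • δ = i1 • toLex ((d:ℤ), (k:ℤ)*l) →
      γ0 + n2 • δ = i2 • toLex ((d:ℤ), (k:ℤ)*l) → n1 = n2 ∧ i1 = i2 := by
    intro n1 i1 n2 i2 h1 h2
    obtain ⟨⟨δ1, δ2⟩, rfl⟩ := toLex.surjective δ
    rw [hγ0, nsmul_lex, nsmul_lex, ← toLex_add, Prod.mk_add_mk, toLex_inj, Prod.mk.injEq] at h1 h2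
    obtain ⟨a1, a2⟩ := h1
    obtain ⟨b1, b2⟩ := h2
    have hd' : (0:ℤ) < d := by omega
    have hkl : (0:ℤ) < (k:ℤ) * l := by positivity
    have e1 : ((n2:ℤ) * i1 - n1 * i2) * d = 0 := by linear_combination n1 * b1 - n2 * a1
    have e2 : (n2:ℤ) * i1 - n1 * i2 = 0 := (mul_eq_zero.1 e1).resolve_right hd'.ne'
    have e4 : ((n2:ℤ) - n1) * (k * l) = 0 := by
      linear_combination n2 * a2 - n1 * b2 + (k * l) * e2
    have e5 := (mul_eq_zero.1 e4).resolve_right hkl.ne'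
    have e6 : n1 = n2 := by omega
    subst e6
    refine ⟨rfl, ?_⟩
    have e7 : ((i1:ℤ) - i2) * d = 0 := by linear_combination b1 - a1
    have := (mul_eq_zero.1 e7).resolve_right hd'.ne'
    omega
  obtain ⟨n1, i1, c1, hc1, h11, h12, h13⟩ := claimC (P.z ^ k) γ0 (by rw [ez]; exact hz1.1)
    (by rw [ez, cz]; exact pow_ne_zero _ (lx_ne 1))
  obtain ⟨n2, i2, c2, hc2, h21, h22, h23⟩ := claimC (P.t ^ l) γ0 (by rw [et]; exact ht1.1)
    (by rw [et, ct]; exact pow_ne_zero _ (lx_ne 2))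
  obtain ⟨rfl, rfl⟩ := wuniq _ _ _ _ h13 h23
  obtain ⟨n3, i3, c3', hc3, h31, h32, h33⟩ := claimC (P.z ^ k - (c1 / c2) • P.t ^ l) γ0
    (by rw [e3]; exact Submodule.sub_mem _ hz1.1 (Submodule.smul_mem _ _ ht1.1))
    (by rw [e3, c3]; exact lincomb_ne k l hk _)
  obtain ⟨rfl, rfl⟩ := wuniq _ _ _ _ h13 h33
  rw [e3, c3, sub_eq_add_neg, iter_add, iter_neg, iter_smul] at h31
  rw [ez, cz] at h11
  rw [et, ct] at h21
  rw [h11, h21, smul_smul, div_mul_cancel₀ _ hc2, add_neg_cancel] at h31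
  exact (smul_ne_zero hc3 (pow_ne_zero _ (YL_ne d k l hk))) h31.symm

end Pres
end KR

set_option linter.unusedSectionVars false

namespace KR
open MvPolynomial

lemma dom_deg2 {κ : Type*} [Field κ] (i : Fin 2) {A B f : P2 κ} {n s : ℕ} {c μ : κ} (hf : Form f n s c μ) (hs : 1 ≤ s)
    (hn : 1 ≤ n) (hc : c ≠ 0) (hμ : μ ≠ 0) (hB0 : B ≠ 0) (hAB : s * degreeOf i B < degreeOf i A) :
    degreeOf i (aeval ![A, B] f) = n * degreeOf i A := by
  set b := degreeOf i B with hb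
  set a := degreeOf i A with ha
  have ha0 : 1 ≤ a := by omega
  have h := dom _ hf hs ((deg_mem i A _).2 ha.symm.le) ((deg_mem i B _).2 hb.symm.le)
    (M := (a : ℤ)) (by exact_mod_cast ha0) le_rfl (by exact_mod_cast hAB.le)
  have hpos : 1 ≤ n * a := Nat.mul_pos hn ha0
  have e1 : ((n : ℤ) * (a : ℤ) - 1) = ((n * a - 1 : ℕ) : ℤ) := by
    rw [Nat.cast_sub hpos]; push_cast; ring
  rw [e1, deg_mem] at h
  set T : P2 κ := A - C μ * B ^ s
  have hT : degreeOf i T = a := by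
    have h1 : degreeOf i (-(C μ * B ^ s)) = s * b := by
      have : -(C μ * B ^ s) = C (-μ) * B ^ s := by rw [C_neg]; ring
      rw [this, degreeOf_C_mul _ _ (mem_nonZeroDivisors_of_ne_zero (neg_ne_zero.2 hμ)),
        degreeOf_pow_eq _ _ _ hB0]
    have : T = A + -(C μ * B^s) := by simp only [T]; ring
    rw [this, degreeOf_add_eq_of_degreeOf_lt (by rw [h1]; exact hAB)]
  have hT0 : T ≠ 0 := ne_zero_of_degreeOf_ne_zero (i := i) (by rw [hT]; omega)
  have h2 : degreeOf i (C c * T ^ n) = n * a := by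
    rw [degreeOf_C_mul _ _ (mem_nonZeroDivisors_of_ne_zero hc), degreeOf_pow_eq _ _ _ hT0, hT]
  have h3 : aeval ![A, B] f = C c * T ^ n + (aeval ![A, B] f - C c * T ^ n) := by ring
  rw [h3, degreeOf_add_eq_of_degreeOf_lt (by rw [h2]; omega), h2]

lemma unit_C {f : P2 ℂ} (h : IsUnit f) : ∃ c : ℂ, c ≠ 0 ∧ f = C c := by
  rw [MvPolynomial.isUnit_iff_eq_C_of_isReduced] at h
  obtain ⟨c, hc, h⟩ := h
  exact ⟨c, hc.ne_zero, h⟩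

lemma coord_LNJ (ψ : P2 ℂ ≃ₐ[ℂ] P2 ℂ) (j : Fin 2) : LNJ (ψ (X j)) := by
  have key : ∀ ψ : P2 ℂ ≃ₐ[ℂ] P2 ℂ, LNJ (ψ (X 1)) := by
    intro ψ
    obtain ⟨J, -, hJ⟩ := unit_C (jac_unit ψ)
    exact LNJ_of_unit ψ J hJ
  fin_cases j
  · have := key ((swp ℂ).trans ψ)
    simpa [swp_X1] using this
  · exact key ψ

lemma noCusp (φ : P2 ℂ ≃ₐ[ℂ] P2 ℂ) (i : Fin 2) (hp : 1 ≤ degreeOf i (φ (X 0)))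
    (hq : 1 ≤ degreeOf i (φ (X 1))) (h1 : ∀ s, degreeOf i (φ (X 0)) ≠ s * degreeOf i (φ (X 1)))
    (h2 : degreeOf i (φ (X 1)) < degreeOf i (φ (X 0))) : False := by
  have hj : ∃ j : Fin 2, j ≠ i := by fin_cases i; exacts [⟨1, by simp⟩, ⟨0, by simp⟩]
  obtain ⟨j, hj⟩ := hj
  set ζ := φ.symm (X j) with hζ
  have hζ' : aeval ![φ (X 0), φ (X 1)] ζ = X j := by
    rw [← equiv_aeval, hζ, AlgEquiv.apply_symm_apply]
  have hdX : degreeOf i (X j : P2 ℂ) = 0 := by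
    rw [degreeOf_X, if_neg hj.symm]
  have hL : LNJ ζ := coord_LNJ φ.symm j
  have hjac : ∀ f : P2 ℂ, 1 ≤ degreeOf i f → jacD (X j) f ≠ 0 := by
    intro f hf h0
    have hpd : pderiv i f = 0 := by
      fin_cases i <;> fin_cases j <;> first | exact absurd rfl hj | skip
      · simpa [jacD_apply] using h0
      · simpa [jacD_apply] using h0
    have h3 := pderiv_eq_zero_iff.1 hpd
    have : degreeOf i f ≤ 0 := degreeOf_le_iff.2 fun s hs => (h3 s hs).le
    omega
  have hjφ : ∀ m : Fin 2, jacD (X j) (φ (X m)) = φ (jacD ζ (X m)) * jacD (φ (X 0)) (φ (X 1)) := by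
    intro m
    rw [← jac_chain', hζ, AlgEquiv.apply_symm_apply]
  have d0 : 1 ≤ degreeOf 0 ζ := by
    by_contra h
    have := pderiv_of_degreeOf (f := ζ) (i := 0) (by omega)
    refine hjac _ hq ?_
    rw [hjφ, jacD_X1, this]; simp
  have d1 : 1 ≤ degreeOf 1 ζ := by
    by_contra h
    have := pderiv_of_degreeOf (f := ζ) (i := 1) (by omega)
    refine hjac _ hp ?_
    rw [hjφ, jacD_X0, this]; simp
  obtain ⟨s, c, μ, hs, hc, hμ, hh | hh⟩ := lemJ_closed ζ hL d0 d1
  · rcases lt_trichotomy (degreeOf i (φ (X 0))) (s * degreeOf i (φ (X 1))) with h | h | h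
    · have := dom_deg i hh.1 hs d0 hc hμ h
      rw [hζ', hdX] at this
      have h5 : 0 < degreeOf 0 ζ * (s * degreeOf i (φ (X 1))) := by positivity
      omega
    · exact h1 s h
    · have := dom_deg2 i hh.1 hs d0 hc hμ (ne_zero_of_degreeOf_ne_zero (i := i) (by omega)) h
      rw [hζ', hdX] at this
      have h5 : 0 < degreeOf 0 ζ * degreeOf i (φ (X 0)) := by positivity
      omega
  · have hlt : degreeOf i (φ (X 1)) < s * degreeOf i (φ (X 0)) := by nlinarith
    have := dom_deg i hh.2.1 hs d1 hc hμ hlt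
    rw [aeval_swp, hζ', hdX] at this
    have h5 : 0 < degreeOf 1 ζ * (s * degreeOf i (φ (X 0))) := by positivity
    omega

lemma pow_lin {f : P2 ℂ} {m : ℕ} (hm : m ≠ 0) {a b : ℂ} (ha : a ≠ 0) (hb : b ≠ 0) (i : Fin 2)
    (h : f ^ m * C a = C b * X i ^ m) : ∃ c : ℂ, c ≠ 0 ∧ f = C c * X i := by
  have hpr : Prime (X i : P2 ℂ) := X_prime
  have ha' : (C a : P2 ℂ) ≠ 0 := by rwa [Ne, C_eq_zero]
  have h1 : (X i : P2 ℂ) ∣ f ^ m := by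
    have h2 : f ^ m = C (b / a) * X i ^ m := by
      apply mul_right_cancel₀ ha'
      rw [h, mul_right_comm, ← C_mul, div_mul_cancel₀ _ ha]
    rw [h2]; exact (dvd_pow_self _ hm).mul_left _
  obtain ⟨u, rfl⟩ := hpr.dvd_of_dvd_pow h1
  have h3 : u ^ m * C a = C b := by
    apply mul_right_cancel₀ (pow_ne_zero m hpr.ne_zero)
    rw [← h]; ring
  have hu : IsUnit u := by
    have h4 : IsUnit (u ^ m) := by
      refine IsUnit.of_mul_eq_one (C a * C b⁻¹) ?_
      rw [← mul_assoc, h3, ← C_mul, mul_inv_cancel₀ hb, C_1]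
    exact (isUnit_pow_iff hm).1 h4
  obtain ⟨c, hc, rfl⟩ := unit_C hu
  exact ⟨c, hc, mul_comm _ _⟩

lemma cusp_lin {k l : ℕ} (hk : 2 ≤ k) (hkl : k < l) (hcop : Nat.Coprime k l)
    (φ : P2 ℂ ≃ₐ[ℂ] P2 ℂ) {ρ : ℂ} (hρ : ρ ≠ 0)
    (h : φ (X 0) ^ k + φ (X 1) ^ l = C ρ * (X 0 ^ k + X 1 ^ l)) :
    ∃ α β : ℂ, α ≠ 0 ∧ β ≠ 0 ∧ φ (X 0) = C α * X 0 ∧ φ (X 1) = C β * X 1 := by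
  have hkdvd : ¬ k ∣ l := fun hd => by
    have := Nat.Coprime.eq_one_of_dvd hcop hd; omega
  have n0 : φ (X 0) ≠ 0 := by rw [Ne, EmbeddingLike.map_eq_zero_iff]; exact X_ne_zero _
  have n1 : φ (X 1) ≠ 0 := by rw [Ne, EmbeddingLike.map_eq_zero_iff]; exact X_ne_zero _
  have dX : ∀ (i j : Fin 2) (n : ℕ), degreeOf i (X j ^ n : P2 ℂ) = if i = j then n else 0 := by
    intro i j n
    rw [degreeOf_pow_eq _ _ _ (X_ne_zero j), degreeOf_X]; split_ifs <;> simp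
  have g0 : degreeOf 0 (C ρ * (X 0 ^ k + X 1 ^ l) : P2 ℂ) = k := by
    rw [degreeOf_C_mul _ _ (mem_nonZeroDivisors_of_ne_zero hρ),
      degreeOf_add_eq_of_degreeOf_lt (by rw [dX, dX]; simp; omega), dX]; simp
  have g1 : degreeOf 1 (C ρ * (X 0 ^ k + X 1 ^ l) : P2 ℂ) = l := by
    rw [degreeOf_C_mul _ _ (mem_nonZeroDivisors_of_ne_zero hρ), add_comm,
      degreeOf_add_eq_of_degreeOf_lt (by rw [dX, dX]; simp; omega), dX]; simp
  have dP : ∀ i, degreeOf i (φ (X 0) ^ k) = k * degreeOf i (φ (X 0)) := fun i => degreeOf_pow_eq _ _ _ n0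
  have dQ : ∀ i, degreeOf i (φ (X 1) ^ l) = l * degreeOf i (φ (X 1)) := fun i => degreeOf_pow_eq _ _ _ n1
  have neq : ∀ i, k * degreeOf i (φ (X 0)) ≠ l * degreeOf i (φ (X 1)) := by
    intro i heq
    have hpos : 1 ≤ degreeOf i (φ (X 0)) := by
      by_contra h0
      have h0 : degreeOf i (φ (X 0)) = 0 := by omega
      have h1 := degreeOf_add_le i (φ (X 0) ^ k) (φ (X 1) ^ l)
      rw [h, dP, dQ, ← heq, h0] at h1
      fin_cases i
      · simp only [Fin.zero_eta] at h1; rw [g0] at h1; simp at h1; omega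
      · simp only [Fin.mk_one] at h1; rw [g1] at h1; simp at h1; omega
    have hqpos : 1 ≤ degreeOf i (φ (X 1)) := by
      by_contra h0
      have h0 : degreeOf i (φ (X 1)) = 0 := by omega
      rw [h0] at heq
      have : 0 < k * degreeOf i (φ (X 0)) := by positivity
      omega
    refine noCusp φ i hpos hqpos (fun s hs => hkdvd ⟨s, ?_⟩) ?_
    · rw [hs, ← mul_assoc] at heq
      exact (Nat.eq_of_mul_eq_mul_right (by omega) heq).symm
    · by_contra hle
      have : k * degreeOf i (φ (X 0)) ≤ k * degreeOf i (φ (X 1)) := Nat.mul_le_mul_left _ (by omega)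
      have : k * degreeOf i (φ (X 1)) < l * degreeOf i (φ (X 1)) := Nat.mul_lt_mul_of_pos_right hkl (by omega)
      omega
  have q0 : degreeOf 0 (φ (X 1)) = 0 := by
    rcases lt_or_gt_of_ne (neq 0) with hlt | hlt
    · have := degreeOf_add_eq_of_degreeOf_lt (i := 0) (p := φ (X 1) ^ l) (q := φ (X 0) ^ k) (by rwa [dP, dQ])
      rw [add_comm, h, g0, dQ] at this
      by_contra h0
      have : l * 1 ≤ l * degreeOf 0 (φ (X 1)) := Nat.mul_le_mul_left _ (by omega)
      omega
    · have := degreeOf_add_eq_of_degreeOf_lt (i := 0) (p := φ (X 0) ^ k) (q := φ (X 1) ^ l) (by rwa [dP, dQ])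
      rw [h, g0, dP] at this
      by_contra h0
      have : l * 1 ≤ l * degreeOf 0 (φ (X 1)) := Nat.mul_le_mul_left _ (by omega)
      omega
  have hdQ : pderiv 0 (φ (X 1)) = 0 := pderiv_of_degreeOf q0
  have hj := jac_unit φ
  rw [jacD_apply, hdQ, mul_zero, sub_zero] at hj
  obtain ⟨a, ha, ha'⟩ := unit_C (isUnit_of_mul_isUnit_left hj)
  obtain ⟨b, hb, hb'⟩ := unit_C (isUnit_of_mul_isUnit_right hj)
  have e0 : φ (X 0) ^ (k-1) * C (k * a) = C (ρ * k) * X 0 ^ (k-1) := by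
    have := congrArg (pderiv 0) h
    simp only [map_add, pderiv_pow, pderiv_C_mul, hdQ, ha', pderiv_X_self, mul_zero, add_zero,
      pderiv_X_of_ne (show (1 : Fin 2) ≠ 0 by simp)] at this
    simp only [C_mul, map_natCast]
    linear_combination this
  obtain ⟨α, hα, hα'⟩ := pow_lin (by omega) (mul_ne_zero (by norm_cast; omega) ha)
    (mul_ne_zero hρ (by norm_cast; omega)) 0 e0
  have e1 : φ (X 1) ^ (l-1) * C (l * b) = C (ρ * l) * X 1 ^ (l-1) := by
    have := congrArg (pderiv 1) h
    simp only [map_add, pderiv_pow, pderiv_C_mul, hα', hb', pderiv_X_self, mul_zero, zero_add,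
      pderiv_X_of_ne (show (0 : Fin 2) ≠ 1 by simp)] at this
    simp only [C_mul, map_natCast]
    linear_combination this
  obtain ⟨β, hβ, hβ'⟩ := pow_lin (by omega) (mul_ne_zero (by norm_cast; omega) hb)
    (mul_ne_zero hρ (by norm_cast; omega)) 1 e1
  exact ⟨α, β, hα, hβ, hα', hβ'⟩
end KR

set_option linter.unusedSectionVars false

namespace KR
open MvPolynomial

theorem stepM' {d : ℕ} (hd : 1 ≤ d) {σ : P2 CX →+* P2 CX} (hσ : AInv σ) (F : P2 CX) (hF : cM F = F)
    (h : ∀ i, Cg (xx ℂ) (σ (X i)) (X i)) (hI : σ F ∈ Ideal.span {xx ℂ ^ d, F}) :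
    ∃ U : P2 CX ≃ₐ[CX] P2 CX, σ (U (X 0)) = U (X 0) ∧ σ (U (X 1)) = U (X 1) ∧
      U F ∈ Ideal.span {xx ℂ ^ d, F} ∧ F ∈ Ideal.span {xx ℂ ^ d, U F} := by
  obtain ⟨S, h0, h1⟩ := step2 hσ
  have hS : ∀ f, σ (S f) = S (cM f) := by
    have : σ.comp (S : P2 CX →+* P2 CX) = (S : P2 CX →+* P2 CX).comp cM := by
      apply MvPolynomial.ringHom_ext
      · intro p
        have e : ∀ q, S (C q) = C q := fun q => S.commutes q
        simp [e, hσ.onC]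
      · intro i; fin_cases i <;> simp [h0, h1]
    exact fun f => DFunLike.congr_fun this f
  have hS' : ∀ f, cM (S.symm f) = S.symm (σ f) := by
    intro f
    apply S.injective
    rw [← hS, S.apply_symm_apply, S.apply_symm_apply]
  obtain ⟨χ, c0, c1, m1, m2⟩ := step3 hd S.symm F hF (by
    intro i; rw [hS']
    exact (h i).map S.symm (by simpa using eq_xp S.symm 1)) (by
    rw [hS']; exact mem_map_span _ hI)
  refine ⟨χ.trans S, ?_, ?_, ?_, ?_⟩
  · simp only [AlgEquiv.trans_apply, hS, c0]
  · simp only [AlgEquiv.trans_apply, hS, c1]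
  · have := mem_map_span S m1
    simpa using this
  · have := mem_map_span S m2
    simpa using this

/-- complex constants -/
noncomputable def cc : ℂ →+* P2 CX := C.comp Polynomial.C

lemma hom_ext {S : Type*} [CommRing S] {f g : P2 CX →+* S} (hc : ∀ a, f (cc a) = g (cc a))
    (hx : f (xx ℂ) = g (xx ℂ)) (h0 : f (X 0) = g (X 0)) (h1 : f (X 1) = g (X 1)) : f = g := by
  apply MvPolynomial.ringHom_ext
  · intro p
    have : f.comp C = g.comp C := by
      apply Polynomial.ringHom_ext
      · exact hc
      · exact hx
    exact DFunLike.congr_fun this p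
  · intro i; fin_cases i
    · exact h0
    · exact h1

/-- torus action -/
noncomputable def sc (p q r : ℂ) : P2 CX →+* P2 CX :=
  eval₂Hom (C.comp (Polynomial.eval₂RingHom Polynomial.C (Polynomial.C p * Polynomial.X)))
    ![cc q * X 0, cc r * X 1]

section
variable (p q r : ℂ)
@[simp] lemma sc_cc (a : ℂ) : sc p q r (cc a) = cc a := by simp [sc, cc]
@[simp] lemma sc_xx : sc p q r (xx ℂ) = cc p * xx ℂ := by simp [sc, cc, xx]
@[simp] lemma sc_X0 : sc p q r (X 0) = cc q * X 0 := by simp [sc]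
@[simp] lemma sc_X1 : sc p q r (X 1) = cc r * X 1 := by simp [sc]
end

lemma sc_sc {p q r p' q' r' : ℂ} (hp : p * p' = 1) (hq : q * q' = 1) (hr : r * r' = 1) (f : P2 CX) :
    sc p q r (sc p' q' r' f) = f := by
  have : (sc p q r).comp (sc p' q' r') = RingHom.id _ := by
    apply hom_ext
    · simp
    · rw [RingHom.comp_apply, sc_xx, map_mul, sc_cc, sc_xx, ← mul_assoc, ← map_mul, mul_comm p', hp]; simp
    · rw [RingHom.comp_apply, sc_X0, map_mul, sc_cc, sc_X0, ← mul_assoc, ← map_mul, mul_comm q', hq]; simp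
    · rw [RingHom.comp_apply, sc_X1, map_mul, sc_cc, sc_X1, ← mul_assoc, ← map_mul, mul_comm r', hr]; simp
  exact DFunLike.congr_fun this f

/-- the equation -/
noncomputable def FF (k l : ℕ) : P2 CX := X 0 ^ k + X 1 ^ l + xx ℂ

lemma cM_FF (k l : ℕ) : cM (FF k l) = FF k l := by
  simp only [FF, map_add, map_pow, MvPolynomial.map_X, cM_xx]

lemma ev0_xx : ev0 (xx ℂ) = 0 := by simp [ev0, xx]
lemma ev0_cc (a : ℂ) : ev0 (cc a) = C a := by simp [ev0, cc]
lemma emb_C (a : ℂ) : emb (C a) = cc a := by simp [emb, cc]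
lemma ev0_X (i : Fin 2) : ev0 (X i : P2 CX) = X i := by simp [ev0]
lemma ev0_FF (k l : ℕ) : ev0 (FF k l) = X 0 ^ k + X 1 ^ l := by
  simp only [FF, map_add, map_pow, ev0_X, ev0_xx, add_zero]

lemma bez {k l : ℕ} (hcop : Nat.Coprime k l) {α β : ℂ} (ha : starRingEnd ℂ α * α = 1)
    (hb : starRingEnd ℂ β * β = 1) (h : α ^ k = β ^ l) :
    ∃ e : ℂ, starRingEnd ℂ e * e = 1 ∧ e ^ (2 * l) = α ∧ e ^ (2 * k) = β := by
  have ha0 : α ≠ 0 := by rintro rfl; simp at ha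
  have hb0 : β ≠ 0 := by rintro rfl; simp at hb
  have nrm : ∀ z : ℂ, starRingEnd ℂ z * z = 1 ↔ ‖z‖ = 1 := by
    intro z
    rw [mul_comm, Complex.mul_conj, Complex.normSq_eq_norm_sq]
    norm_cast
    exact pow_eq_one_iff_of_nonneg (norm_nonneg z) (by norm_num)
  rw [nrm] at ha hb
  obtain ⟨b, a, hab⟩ : ∃ b a : ℤ, b * k + a * l = 1 := by
    have := (Nat.isCoprime_iff_coprime.mpr hcop)
    exact this
  obtain ⟨e, he⟩ := IsAlgClosed.exists_pow_nat_eq (α ^ a * β ^ b) (n := 2) (by norm_num)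
  have hz : α ^ (k : ℤ) = β ^ (l : ℤ) := by exact_mod_cast h
  refine ⟨e, ?_, ?_, ?_⟩
  · rw [nrm]
    have := congrArg norm he
    rw [norm_pow, norm_mul, norm_zpow, norm_zpow, ha, hb] at this
    simp only [one_zpow, mul_one] at this
    exact (pow_eq_one_iff_of_nonneg (norm_nonneg e) (by norm_num)).mp this
  · rw [pow_mul, he, mul_pow, ← zpow_natCast, ← zpow_natCast, ← zpow_mul, ← zpow_mul, mul_comm b, zpow_mul β, ← hz,
      ← zpow_mul, ← zpow_add₀ ha0, show a * (l:ℤ) + k * b = 1 by rw [← hab]; ring, zpow_one]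
  · rw [pow_mul, he, mul_pow, ← zpow_natCast, ← zpow_natCast, ← zpow_mul, ← zpow_mul, mul_comm a, zpow_mul α, hz,
      ← zpow_mul, ← zpow_add₀ hb0, show (l:ℤ) * a + b * k = 1 by rw [← hab]; ring, zpow_one]

lemma coef1 {k l d : ℕ} (hk : 2 ≤ k) (hl : 2 ≤ l) (hd : 2 ≤ d) {P Q a b : CX} {lam : ℂ} (hP : P.coeff 0 = 0)
    (hQ : Q.coeff 0 = 0) (h : P ^ k + Q ^ l + Polynomial.C lam * Polynomial.X = a * Polynomial.X ^ d + b * Polynomial.X) :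
    lam = b.coeff 0 := by
  obtain ⟨P, rfl⟩ := Polynomial.X_dvd_iff.mpr hP
  obtain ⟨Q, rfl⟩ := Polynomial.X_dvd_iff.mpr hQ
  have := congrArg (fun f => Polynomial.coeff f 1) h
  simp only [mul_pow, Polynomial.coeff_add, Polynomial.coeff_X_pow_mul', Polynomial.coeff_mul_X_pow'] at this
  rw [if_neg (by omega), if_neg (by omega), if_neg (by omega)] at this
  have e : ∀ p : CX, (p * Polynomial.X).coeff 1 = p.coeff 0 := fun p => Polynomial.coeff_mul_X p 0
  simpa [e] using this
end KR

set_option linter.unusedSectionVars false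

namespace KR
open MvPolynomial

/-- conjugation on the fibre -/
noncomputable abbrev cP : P2 ℂ →+* P2 ℂ := MvPolynomial.map (starRingEnd ℂ)
lemma cP_cP (f : P2 ℂ) : cP (cP f) = f := by
  rw [MvPolynomial.map_map]
  have : (starRingEnd ℂ).comp (starRingEnd ℂ) = RingHom.id ℂ := by ext p; simp
  rw [this, MvPolynomial.map_id]

/-- analysis of the fibre over zero -/
lemma fibre {d k l : ℕ} (hd : 2 ≤ d) (hk : 2 ≤ k) (hkl : k < l) (hcop : Nat.Coprime k l)
    (τ : P2 CX →+* P2 CX) (hc : ∀ a, τ (cc a) = cc (starRingEnd ℂ a)) (hτ : ∀ f, τ (τ f) = f)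
    (lam : ℂ) (hx : τ (xx ℂ) = cc lam * xx ℂ)
    (hF : τ (FF k l) ∈ Ideal.span {xx ℂ ^ d, FF k l}) :
    ∃ α β : ℂ, starRingEnd ℂ α * α = 1 ∧ starRingEnd ℂ β * β = 1 ∧ α ^ k = lam ∧ β ^ l = lam ∧
      Cg (xx ℂ) (τ (X 0)) (cc α * X 0) ∧ Cg (xx ℂ) (τ (X 1)) (cc β * X 1) := by
  let τb : P2 ℂ →+* P2 ℂ := ev0.comp (τ.comp emb)
  have t1 : ∀ m, τb (ev0 m) = ev0 (τ m) := by
    intro m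
    obtain ⟨q, hq⟩ := x_dvd_emb (κ := ℂ) m
    have h2 := congrArg (fun z => ev0 (τ z)) hq
    simp only [map_sub, map_mul, hx, ev0_xx, mul_zero, zero_mul] at h2
    exact sub_eq_zero.mp h2
  have t2 : ∀ f, τb (τb f) = f := by
    intro f
    have : τb f = ev0 (τ (emb f)) := rfl
    rw [this, t1, hτ, ev0_emb]
  have tC : ∀ a, τb (C a) = C (starRingEnd ℂ a) := by
    intro a
    change ev0 (τ (emb (C a))) = _
    rw [emb_C, hc, ev0_cc]
  have tX : ∀ i, τb (X i) = ev0 (τ (X i)) := by intro i; rw [← t1, ev0_X]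
  let φ0 : P2 ℂ →ₐ[ℂ] P2 ℂ := { τb.comp cP with
    commutes' := by
      intro r
      change τb (cP (C r)) = C r
      rw [MvPolynomial.map_C, tC]; simp }
  have hφ0 : ∀ f, φ0 f = τb (cP f) := fun f => rfl
  have hbij : Function.Bijective φ0 := by
    constructor
    · intro f g h
      rw [hφ0, hφ0] at h
      have := congrArg (fun z => cP (τb z)) h
      simpa only [t2, cP_cP] using this
    · intro f
      exact ⟨cP (τb f), by rw [hφ0, cP_cP, t2]⟩
  let φ := AlgEquiv.ofBijective φ0 hbij
  have hφX : ∀ i, φ (X i) = τb (X i) := by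
    intro i; change τb (cP (X i)) = _; rw [MvPolynomial.map_X]
  obtain ⟨a, b, hab⟩ := Ideal.mem_span_pair.mp hF
  set g : P2 ℂ := X 0 ^ k + X 1 ^ l with hg
  have hg0 : g ≠ 0 := by
    intro h
    have := congrArg (eval ![1, 0]) h
    simp [hg, show l ≠ 0 by omega] at this
  have eg : τb g = ev0 b * g := by
    rw [hg, ← ev0_FF, t1, ← hab]
    simp only [map_add, map_mul, map_pow, ev0_xx]
    rw [zero_pow (by omega)]; ring
  have ub : IsUnit (ev0 b) := by
    have h2 := t2 g
    rw [eg, map_mul, eg, ← mul_assoc] at h2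
    have : τb (ev0 b) * ev0 b = 1 := mul_right_cancel₀ hg0 (by rw [h2, one_mul])
    exact IsUnit.of_mul_eq_one _ (by rw [mul_comm]; exact this)
  obtain ⟨ρ, hρ, hb⟩ := unit_C ub
  obtain ⟨α, β, hα, hβ, e0, e1⟩ := cusp_lin hk hkl hcop φ hρ (by
    rw [hφX, hφX, ← map_pow, ← map_pow, ← map_add, ← hg, eg, hb])
  rw [hφX] at e0 e1
  have eg' : (C α * X 0) ^ k + (C β * X 1) ^ l = C ρ * (X 0 ^ k + X 1 ^ l : P2 ℂ) := by
    rw [← e0, ← e1, ← map_pow, ← map_pow, ← map_add, ← hg, eg, hb]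
  have ak : α ^ k = ρ := by
    have := congrArg (eval ![1, 0]) eg'
    simpa [show l ≠ 0 by omega] using this
  have bl : β ^ l = ρ := by
    have := congrArg (eval ![0, 1]) eg'
    simpa [show k ≠ 0 by omega] using this
  have cst : ∀ m : P2 CX, (constantCoeff m).coeff 0 = constantCoeff (ev0 m) := by
    intro m
    rw [ev0, constantCoeff_map, Polynomial.coe_evalRingHom, ← Polynomial.coeff_zero_eq_eval_zero]
  have hlam : lam = ρ := by
    have := congrArg constantCoeff hab
    simp only [FF, map_add, map_mul, hx] at this
    simp only [constantCoeff_X, xx, cc, RingHom.comp_apply, constantCoeff_C, zero_pow (show k ≠ 0 by omega),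
      map_pow, zero_pow (show l ≠ 0 by omega), zero_add] at this
    rw [coef1 hk (by omega) hd (by rw [cst, ← tX, e0]; simp) (by rw [cst, ← tX, e1]; simp) this.symm, cst, hb]
    simp
  have cj1 : ∀ i a, τb (X i) = C a * X i → starRingEnd ℂ a * a = 1 := by
    intro i a h
    have h2 := t2 (X i)
    rw [h, map_mul, tC, h, ← mul_assoc, ← C_mul] at h2
    have := congrArg (eval (fun _ => 1)) h2
    simpa using this
  have fin : ∀ i a, τb (X i) = C a * X i → Cg (xx ℂ) (τ (X i)) (cc a * X i) := by
    intro i a h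
    rw [Cg, x_dvd_iff, map_sub, ← tX, h, map_mul, ev0_cc, ev0_X, sub_self]
  exact ⟨α, β, cj1 _ _ e0, cj1 _ _ e1, by rw [ak, hlam], by rw [bl, hlam], fin _ _ e0, fin _ _ e1⟩

lemma mem_span_map (f : P2 CX →+* P2 CX) {u v w u' v' : P2 CX} (h : w ∈ Ideal.span {u, v})
    (hu : f u ∈ Ideal.span {u', v'}) (hv : f v ∈ Ideal.span {u', v'}) : f w ∈ Ideal.span {u', v'} := by
  obtain ⟨a, b, rfl⟩ := Ideal.mem_span_pair.mp h
  rw [map_add, map_mul, map_mul]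
  exact Ideal.add_mem _ (Ideal.mul_mem_left _ _ hu) (Ideal.mul_mem_left _ _ hv)

theorem stepM {d k l : ℕ} (hd : 2 ≤ d) (hk : 2 ≤ k) (hkl : k < l) (hcop : Nat.Coprime k l)
    (τ : P2 CX →+* P2 CX) (hc : ∀ a, τ (cc a) = cc (starRingEnd ℂ a)) (hτ : ∀ f, τ (τ f) = f)
    (lam : ℂ) (hx : τ (xx ℂ) = cc lam * xx ℂ)
    (hF : τ (FF k l) ∈ Ideal.span {xx ℂ ^ d, FF k l}) :
    ∃ V : P2 CX →+* P2 CX, Function.Surjective V ∧ (∀ a, V (cc a) = cc a) ∧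
      (∃ c, c ≠ 0 ∧ V (xx ℂ) = cc c * xx ℂ) ∧ τ (V (xx ℂ)) = V (xx ℂ) ∧ (∀ i, τ (V (X i)) = V (X i)) ∧
      V (FF k l) ∈ Ideal.span {xx ℂ ^ d, FF k l} ∧ FF k l ∈ Ideal.span {xx ℂ ^ d, V (FF k l)} := by
  obtain ⟨α, β, hα, hβ, ak, bl, g0, g1⟩ := fibre hd hk hkl hcop τ hc hτ lam hx hF
  obtain ⟨e, he, el, ek⟩ := bez hcop hα hβ (by rw [ak, bl])
  have e0 : e ≠ 0 := by rintro rfl; simp at he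
  set e' := starRingEnd ℂ e with he'
  have inv : ∀ n, e' ^ n * e ^ n = 1 := by intro n; rw [← mul_pow, he, one_pow]
  have inv' : ∀ n, e ^ n * e' ^ n = 1 := by intro n; rw [mul_comm, inv]
  have cje : ∀ n, starRingEnd ℂ (e ^ n) = e' ^ n := by intro n; rw [map_pow]
  let T := sc (e ^ (k * l)) (e ^ l) (e ^ k)
  let T' := sc (e' ^ (k * l)) (e' ^ l) (e' ^ k)
  have TT' : ∀ f, T (T' f) = f := sc_sc (inv' _) (inv' _) (inv' _)
  have T'T : ∀ f, T' (T f) = f := sc_sc (inv _) (inv _) (inv _)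
  have TF : T (FF k l) = cc (e ^ (k * l)) * FF k l := by
    simp only [T, FF, map_add, map_pow, sc_X0, sc_X1, sc_xx, mul_pow]
    rw [← pow_mul, ← pow_mul, mul_comm l k]; ring
  have T'F : T' (FF k l) = cc (e' ^ (k * l)) * FF k l := by
    simp only [T', FF, map_add, map_pow, sc_X0, sc_X1, sc_xx, mul_pow]
    rw [← pow_mul, ← pow_mul, mul_comm l k]; ring
  have Txp : T (xx ℂ ^ d) = cc (e ^ (k * l)) ^ d * xx ℂ ^ d := by simp [T, mul_pow]
  have T'xp : T' (xx ℂ ^ d) = cc (e' ^ (k * l)) ^ d * xx ℂ ^ d := by simp [T', mul_pow]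
  have Tc : ∀ a, T (cc a) = cc a := sc_cc _ _ _
  have T'c : ∀ a, T' (cc a) = cc a := sc_cc _ _ _
  let σ := T'.comp (τ.comp T)
  have hs : ∀ f, σ f = T' (τ (T f)) := fun f => rfl
  have Tσ : ∀ f, T (σ f) = τ (T f) := by intro f; rw [hs, TT']
  have sx : σ (xx ℂ) = xx ℂ := by
    rw [hs]
    simp only [T, sc_xx, map_mul, hc, cje, hx, T'c]
    simp only [T', sc_xx, ← mul_assoc, ← map_mul]
    rw [← ak, ← el, ← pow_mul, show 2 * l * k = k * l + k * l by ring, pow_add,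
      show e' ^ (k*l) * (e ^ (k*l) * e ^ (k*l)) * e' ^ (k*l) = (e' ^ (k*l) * e ^ (k*l)) * (e' ^ (k*l) * e ^ (k*l)) by ring,
      inv]; simp
  have scc : ∀ a, σ (cc a) = cc (starRingEnd ℂ a) := by
    intro a; rw [hs, Tc, hc, T'c]
  have hσ : AInv σ := by
    constructor
    · intro p
      have : σ.comp C = (C : CX →+* P2 CX).comp cj := by
        apply Polynomial.ringHom_ext
        · intro a
          have := scc a
          simp only [cc, RingHom.comp_apply] at this ⊢
          rw [this]; simp
        · have := sx
          rw [xx] at this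
          simp only [RingHom.comp_apply]
          rw [this]; simp
      exact DFunLike.congr_fun this p
    · intro f
      rw [hs, Tσ, hτ, T'T]
  have dT' : ∀ u v, Cg (xx ℂ) u v → Cg (xx ℂ) (T' u) (T' v) := by
    intro u v h
    have := map_dvd T' h
    rw [map_sub] at this
    refine Dvd.dvd.trans ?_ this
    exact ⟨cc (e' ^ (k*l)), by simp only [T', sc_xx]; ring⟩
  have fix : ∀ i, Cg (xx ℂ) (σ (X i)) (X i) := by
    intro i
    fin_cases i
    · have h := (Cg.refl (e := xx ℂ) (cc (e' ^ l))).mul (dT' _ _ g0)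
      rw [map_mul, T'c] at h
      simp only [T', sc_X0] at h
      rw [← mul_assoc, ← mul_assoc, ← map_mul, ← map_mul, ← el, show 2 * l = l + l by ring, pow_add,
        show e' ^ l * (e ^ l * e ^ l) * e' ^ l = (e' ^ l * e ^ l) * (e' ^ l * e ^ l) by ring, inv, mul_one, map_one, one_mul] at h
      convert h using 1
      simp only [Fin.zero_eta, hs, T, sc_X0, map_mul, hc, cje, T'c]; rfl
      rfl
    · have h := (Cg.refl (e := xx ℂ) (cc (e' ^ k))).mul (dT' _ _ g1)
      rw [map_mul, T'c] at h
      simp only [T', sc_X1] at h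
      rw [← mul_assoc, ← mul_assoc, ← map_mul, ← map_mul, ← ek, show 2 * k = k + k by ring, pow_add,
        show e' ^ k * (e ^ k * e ^ k) * e' ^ k = (e' ^ k * e ^ k) * (e' ^ k * e ^ k) by ring, inv, mul_one, map_one, one_mul] at h
      convert h using 1
      simp only [Fin.mk_one, hs, T, sc_X1, map_mul, hc, cje, T'c]; rfl
      rfl
  have hI : σ (FF k l) ∈ Ideal.span {xx ℂ ^ d, FF k l} := by
    rw [hs, TF, map_mul, map_mul]
    apply Ideal.mul_mem_left
    refine mem_span_map T' hF ?_ ?_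
    · rw [T'xp]; exact Ideal.mul_mem_left _ _ (Ideal.subset_span (by simp))
    · rw [T'F]; exact Ideal.mul_mem_left _ _ (Ideal.subset_span (by simp))
  obtain ⟨U, u0, u1, m1, m2⟩ := stepM' (by omega) hσ (FF k l) (cM_FF k l) fix hI
  have Uc : ∀ p, U (C p) = C p := fun p => U.commutes p
  refine ⟨T.comp (U : P2 CX →+* P2 CX), ?_, ?_, ?_, ?_, ?_, ?_, ?_⟩
  · intro f
    exact ⟨U.symm (T' f), by simp [TT']⟩
  · intro a
    change T (U (cc a)) = _
    rw [cc, RingHom.comp_apply, Uc]; exact Tc a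
  · refine ⟨e ^ (k * l), pow_ne_zero _ e0, ?_⟩
    change T (U (xx ℂ)) = _
    rw [xx, Uc]; exact sc_xx _ _ _
  · change τ (T (U (xx ℂ))) = T (U (xx ℂ))
    rw [xx, Uc]; change τ (T (xx ℂ)) = T (xx ℂ)
    rw [← Tσ, sx]
  · intro i
    change τ (T (U (X i))) = T (U (X i))
    rw [← Tσ]
    fin_cases i
    · exact congrArg T u0
    · exact congrArg T u1
  · change T (U (FF k l)) ∈ _
    refine mem_span_map T m1 ?_ ?_
    · rw [Txp]; exact Ideal.mul_mem_left _ _ (Ideal.subset_span (by simp))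
    · rw [TF]; exact Ideal.mul_mem_left _ _ (Ideal.subset_span (by simp))
  · change _ ∈ Ideal.span {xx ℂ ^ d, T (U (FF k l))}
    have : T (FF k l) ∈ Ideal.span {xx ℂ ^ d, T (U (FF k l))} := by
      refine mem_span_map T m2 ?_ ?_
      · rw [Txp]; exact Ideal.mul_mem_left _ _ (Ideal.subset_span (by simp))
      · exact Ideal.subset_span (by simp)
    rw [TF] at this
    have := Ideal.mul_mem_left _ (cc (e' ^ (k*l))) this
    rwa [← mul_assoc, ← map_mul, inv, map_one, one_mul] at this
end KR

set_option linter.unusedSectionVars false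

namespace KR
open MvPolynomial

lemma restrict_der {B L : Type*} [CommRing B] [Algebra ℂ B] [CommRing L] [Algebra ℂ L] (ι : B →ₐ[ℂ] L)
    (hι : Function.Injective ι) (E : Derivation ℂ L L) (S : Set B) (gen : Algebra.adjoin ℂ S = ⊤)
    (h : ∀ b ∈ S, ∃ c, E (ι b) = ι c) : ∃ D : Derivation ℂ B B, ∀ b, ι (D b) = E (ι b) := by
  have h' : ∀ b, ∃ c, ι c = E (ι b) := by
    intro b
    have hb : b ∈ Algebra.adjoin ℂ S := by rw [gen]; trivial
    induction hb using Algebra.adjoin_induction with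
    | mem b hb => obtain ⟨c, hc⟩ := h b hb; exact ⟨c, hc.symm⟩
    | algebraMap r => exact ⟨0, by simp⟩
    | add a b _ _ ha hb =>
      obtain ⟨u, hu⟩ := ha; obtain ⟨v, hv⟩ := hb
      exact ⟨u + v, by simp [hu, hv]⟩
    | mul a b _ _ ha hb =>
      obtain ⟨u, hu⟩ := ha; obtain ⟨v, hv⟩ := hb
      exact ⟨a * v + b * u, by simp [hu, hv]⟩
  choose f hf using h'
  let D0 : B →ₗ[ℂ] B :=
    { toFun := f
      map_add' := by intro a b; apply hι; simp [hf]
      map_smul' := by intro a b; apply hι; simp [hf] }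
  refine ⟨Derivation.mk' D0 ?_, ?_⟩
  · intro a b
    apply hι
    change ι (f (a * b)) = ι (a • f b + b • f a)
    simp [hf]
  · intro b; exact hf b

namespace Pres
variable {d k l : ℕ} {B : Type*} [CommRing B] [Algebra ℂ B] (P : Pres d k l B)

lemma dom (P : Pres d k l B) : IsDomain B := P.inj.isDomain P.ι.toRingHom

lemma x_ne : P.x ≠ 0 := by
  intro h
  have := P.hx
  rw [h, map_zero] at this
  exact lx_ne 0 this.symm

lemma exists_lnd (a b : ℂ) : ∃ D : Derivation ℂ B B, (∀ f, Nil D f) ∧ D P.x = 0 ∧ D P.z = a • P.x ^ d ∧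
    D P.t = b • P.x ^ d := by
  let F : Fin 3 → Lau ℂ 3 := ![0, mon ℂ (-(Pi.single 1 1)) * a • lx ℂ 0 ^ d, mon ℂ (-(Pi.single 2 1)) * b • lx ℂ 0 ^ d]
  let E := derOf (mulOf F)
  have E0 : E (lx ℂ 0) = 0 := by
    rw [lx, mon]; simp only [E]; rw [derOf_X]; simp [F]
  have E1 : E (lx ℂ 1) = a • lx ℂ 0 ^ d := by
    rw [lx, mon]; simp only [E]; rw [derOf_X]; simp only [F, Matrix.cons_val]
    rw [← mul_assoc]
    change mon ℂ _ * mon ℂ _ * _ = _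
    rw [mul_comm (mon ℂ _), mon_neg_mul, one_mul]
  have E2 : E (lx ℂ 2) = b • lx ℂ 0 ^ d := by
    rw [lx, mon]; simp only [E]; rw [derOf_X]; simp only [F, Matrix.cons_val]
    rw [← mul_assoc]
    change mon ℂ _ * mon ℂ _ * _ = _
    rw [mul_comm (mon ℂ _), mon_neg_mul, one_mul]
  have Ey : E (yL d k l) = -(a • ((k:ℂ) • lx ℂ 1 ^ (k-1)) + b • ((l : ℂ) • lx ℂ 2 ^ (l-1))) := by
    have h := congrArg E (yL_rel d k l)
    rw [gL] at h
    simp only [Derivation.leibniz, Derivation.leibniz_pow, map_neg, map_add, E0, E1, E2, smul_zero, add_zero,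
      smul_eq_mul, mul_smul_comm, mul_zero] at h
    apply mul_left_cancel₀ (pow_ne_zero d (lx_ne 0))
    rw [h]
    simp only [nsmul_eq_mul]
    simp only [Algebra.smul_def, map_natCast]; ring
  obtain ⟨D, hD⟩ := restrict_der P.ι P.inj E {P.x, P.y, P.z, P.t} P.gen (by
    intro b' hb'
    simp only [Set.mem_insert_iff, Set.mem_singleton_iff] at hb'
    rcases hb' with rfl | rfl | rfl | rfl
    · exact ⟨0, by rw [P.hx, E0, map_zero]⟩
    · exact ⟨-(a • ((k:ℂ) • P.z ^ (k-1)) + b • ((l : ℂ) • P.t ^ (l-1))), by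
        rw [P.hy, Ey]; simp only [map_neg, map_add, map_smul, map_pow, P.hz, P.ht]⟩
    · exact ⟨a • P.x ^ d, by rw [P.hz, E1, map_smul, map_pow, P.hx]⟩
    · exact ⟨b • P.x ^ d, by rw [P.ht, E2, map_smul, map_pow, P.hx]⟩)
  have D0 : D P.x = 0 := by apply P.inj; rw [hD, P.hx, E0, map_zero]
  have D1 : D P.z = a • P.x ^ d := by apply P.inj; rw [hD, P.hz, E1, map_smul, map_pow, P.hx]
  have D2 : D P.t = b • P.x ^ d := by apply P.inj; rw [hD, P.ht, E2, map_smul, map_pow, P.hx]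
  have Dy : D P.y = -(a • ((k:ℂ) • P.z ^ (k-1)) + b • ((l : ℂ) • P.t ^ (l-1))) := by
    apply P.inj; rw [hD, P.hy, Ey]; simp only [map_neg, map_add, map_smul, map_pow, P.hz, P.ht]
  have step : ∀ f, D f ∈ nilSub D → f ∈ nilSub D := by
    rintro f ⟨n, hn⟩
    exact ⟨n+1, by rw [Function.iterate_succ_apply]; exact hn⟩
  have nx : P.x ∈ nilSub D := Nil.of_ker D D0
  have nz : P.z ∈ nilSub D := step _ (by rw [D1]; exact Subalgebra.smul_mem _ (Subalgebra.pow_mem _ nx _) _)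
  have nt : P.t ∈ nilSub D := step _ (by rw [D2]; exact Subalgebra.smul_mem _ (Subalgebra.pow_mem _ nx _) _)
  have ny : P.y ∈ nilSub D := step _ (by
    rw [Dy]
    exact Subalgebra.neg_mem _ (Subalgebra.add_mem _
      (Subalgebra.smul_mem _ (Subalgebra.smul_mem _ (Subalgebra.pow_mem _ nz _) _) _)
      (Subalgebra.smul_mem _ (Subalgebra.smul_mem _ (Subalgebra.pow_mem _ nt _) _) _)))
  refine ⟨D, ?_, D0, D1, D2⟩
  have : Algebra.adjoin ℂ {P.x, P.y, P.z, P.t} ≤ nilSub D := by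
    rw [Algebra.adjoin_le_iff]
    intro f hf
    simp only [Set.mem_insert_iff, Set.mem_singleton_iff] at hf
    rcases hf with rfl | rfl | rfl | rfl <;> assumption
  rw [P.gen] at this
  intro f
  exact this (Algebra.mem_top)

/-- antilinear involutions -/
structure Anti (σ : B →+* B) : Prop where
  c : ∀ a : ℂ, σ (algebraMap ℂ B a) = algebraMap ℂ B (starRingEnd ℂ a)
  inv : ∀ f, σ (σ f) = f

variable {P} {σ : B →+* B}

lemma Anti.ker (hσ : Anti σ) (hd : 2 ≤ d) (hk : 2 ≤ k) (hl : 2 ≤ l) (hcop : Nat.Coprime k l)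
    (D : Derivation ℂ B B) (hD : ∀ b, Nil D b) (hD0 : D ≠ 0) {f : B} (hf : D f = 0) : σ f ∈ P.R := by
  let D0 : B →ₗ[ℂ] B :=
    { toFun := fun b => σ (D (σ b))
      map_add' := by intro a b; simp
      map_smul' := by
        intro a b
        simp only [Algebra.smul_def, map_mul, hσ.c, Derivation.leibniz, Derivation.map_algebraMap,
          RingHom.id_apply]
        rw [mul_zero, add_zero, Algebra.algebraMap_self_apply, map_mul, hσ.c, Complex.conj_conj] }
  let D' : Derivation ℂ B B := Derivation.mk' D0 (by
    intro a b
    change σ (D (σ (a * b))) = a • σ (D (σ b)) + b • σ (D (σ a))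
    simp [hσ.inv])
  have hD' : ∀ b, D' b = σ (D (σ b)) := fun b => rfl
  have it : ∀ n b, D'^[n] b = σ (D^[n] (σ b)) := by
    intro n
    induction n with
    | zero => intro b; simp [hσ.inv]
    | succ n ih => intro b; rw [Function.iterate_succ_apply, ih, hD', hσ.inv, Function.iterate_succ_apply]
  apply P.lemma1 hd hk hl hcop D'
  · intro b
    obtain ⟨n, hn⟩ := hD (σ b)
    exact ⟨n, by rw [it, hn, map_zero]⟩
  · intro h
    apply hD0
    ext b
    have := DFunLike.congr_fun h (σ b)
    rw [hD', hσ.inv] at this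
    have := congrArg σ this
    simpa [hσ.inv] using this
  · rw [hD', hσ.inv, hf, map_zero]

lemma Anti.mem (hσ : Anti σ) (P : Pres d k l B) (hd : 2 ≤ d) (hk : 2 ≤ k) (hl : 2 ≤ l) (hcop : Nat.Coprime k l) :
    σ P.x ∈ P.R ∧ σ P.z ∈ P.R ∧ σ P.t ∈ P.R := by
  have := P.dom
  have hx := pow_ne_zero d P.x_ne
  obtain ⟨D, n, a, b, c⟩ := P.exists_lnd 1 0
  obtain ⟨D', n', a', b', c'⟩ := P.exists_lnd 0 1
  have h0 : D ≠ 0 := by rintro rfl; simp at b; exact hx b.symm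
  have h0' : D' ≠ 0 := by rintro rfl; simp at c'; exact hx c'.symm
  exact ⟨hσ.ker hd hk hl hcop D n h0 a, hσ.ker hd hk hl hcop D' n' h0' (by simpa using b'),
    hσ.ker hd hk hl hcop D n h0 (by simpa using c)⟩

end Pres
end KR

set_option linter.unusedSectionVars false

namespace KR
open MvPolynomial

lemma M_ind {T : Type*} [CommRing T] [Algebra ℂ T] (S : Subalgebra ℂ T) (f : P2 CX →+* T) (hc : ∀ a, f (cc a) ∈ S)
    (hx : f (xx ℂ) ∈ S) (h0 : f (X 0) ∈ S) (h1 : f (X 1) ∈ S) (m : P2 CX) : f m ∈ S := by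
  induction m using MvPolynomial.induction_on with
  | C p =>
    induction p using Polynomial.induction_on' with
    | add p q hp hq => rw [C_add, map_add]; exact S.add_mem hp hq
    | monomial n a =>
      rw [← Polynomial.C_mul_X_pow_eq_monomial, C_mul, C_pow, map_mul, map_pow]
      exact S.mul_mem (hc a) (S.pow_mem hx n)
  | add p q hp hq => rw [map_add]; exact S.add_mem hp hq
  | mul_X p i hp =>
    rw [map_mul]
    refine S.mul_mem hp ?_
    fin_cases i
    · exact h0
    · exact h1

/-- three-variable map out of `P2 CX` -/
noncomputable def mk3 {T : Type*} [CommRing T] (c : ℂ →+* T) (x z t : T) : P2 CX →+* T :=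
  eval₂Hom (Polynomial.eval₂RingHom c x) ![z, t]

section
variable {T : Type*} [CommRing T] (c : ℂ →+* T) (x z t : T)
lemma mk3_cc (a : ℂ) : mk3 c x z t (cc a) = c a := by simp [mk3, cc]
lemma mk3_xx : mk3 c x z t (xx ℂ) = x := by simp [mk3, xx]
lemma mk3_X0 : mk3 c x z t (X 0) = z := by simp [mk3]
lemma mk3_X1 : mk3 c x z t (X 1) = t := by simp [mk3]
end

lemma mk3_lau_inj : Function.Injective (mk3 (algebraMap ℂ (Lau ℂ 3)) (lx ℂ 0) (lx ℂ 1) (lx ℂ 2)) := by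
  let h : P2 CX →+* MvPolynomial (Fin 3) ℂ := mk3 C (X 0) (X 1) (X 2)
  let h' : MvPolynomial (Fin 3) ℂ →+* P2 CX := eval₂Hom cc ![xx ℂ, X 0, X 1]
  have e1 : h'.comp h = RingHom.id _ := by
    apply hom_ext
    · intro a; simp [h, h', mk3_cc]
    · simp [h, h', mk3_xx]
    · simp [h, h', mk3_X0]
    · simp [h, h', mk3_X1]
  have e2 : mk3 (algebraMap ℂ (Lau ℂ 3)) (lx ℂ 0) (lx ℂ 1) (lx ℂ 2) = (lau ℂ 3 : _ →+* Lau ℂ 3).comp h := by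
    apply hom_ext
    · intro a; simp [h, mk3_cc, lau]
    · simp [h, mk3_xx, lau]
    · simp [h, mk3_X0, lau]
    · simp [h, mk3_X1, lau]
  rw [e2]
  intro a b hab
  replace hab : h a = h b := lau_injective ℂ 3 hab
  have := congrArg h' hab
  have e := fun f => DFunLike.congr_fun e1 f
  simp only [RingHom.comp_apply, RingHom.id_apply] at e
  rwa [e, e] at this

lemma unit_cc {u : P2 CX} (h : IsUnit u) : ∃ c, c ≠ 0 ∧ u = cc c := by
  rw [MvPolynomial.isUnit_iff_eq_C_of_isReduced] at h
  obtain ⟨r, hr, rfl⟩ := h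
  rw [Polynomial.isUnit_iff] at hr
  obtain ⟨c, hc, rfl⟩ := hr
  exact ⟨c, hc.ne_zero, rfl⟩

lemma xx_prime : Prime (xx ℂ) := by
  rw [xx, MvPolynomial.prime_C_iff]; exact Polynomial.prime_X

lemma xx_ndvd (k l : ℕ) : ¬ xx ℂ ∣ FF k l := by
  rw [x_dvd_iff, ev0_FF]
  intro h
  have := congrArg (eval ![1, 1]) h
  simp at this

namespace Pres
variable {d k l : ℕ} {B : Type*} [CommRing B] [Algebra ℂ B] (P : Pres d k l B)

/-- the coordinate map -/
noncomputable def j : P2 CX →+* B := mk3 (algebraMap ℂ B) P.x P.z P.t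

lemma j_cc (a : ℂ) : P.j (cc a) = algebraMap ℂ B a := mk3_cc _ _ _ _ _
lemma j_xx : P.j (xx ℂ) = P.x := mk3_xx _ _ _ _
lemma j_X0 : P.j (X 0) = P.z := mk3_X0 _ _ _ _
lemma j_X1 : P.j (X 1) = P.t := mk3_X1 _ _ _ _

lemma j_inj : Function.Injective P.j := by
  have : mk3 (algebraMap ℂ (Lau ℂ 3)) (lx ℂ 0) (lx ℂ 1) (lx ℂ 2) = (P.ι : B →+* Lau ℂ 3).comp P.j := by
    apply hom_ext
    · intro a; simp [mk3_cc, j_cc]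
    · simp [mk3_xx, j_xx, P.hx]
    · simp [mk3_X0, j_X0, P.hz]
    · simp [mk3_X1, j_X1, P.ht]
  have h := mk3_lau_inj
  rw [this] at h
  exact Function.Injective.of_comp h

lemma j_FF : P.j (FF k l) = - (P.x ^ d * P.y) := by
  rw [FF, map_add, map_add, map_pow, map_pow, j_X0, j_X1, j_xx]
  linear_combination P.rel

lemma exists_j {f : B} (hf : f ∈ P.R) : ∃ m, P.j m = f := by
  induction hf using Algebra.adjoin_induction with
  | mem b hb =>
    simp only [Set.mem_insert_iff, Set.mem_singleton_iff] at hb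
    rcases hb with rfl | rfl | rfl
    exacts [⟨_, P.j_xx⟩, ⟨_, P.j_X0⟩, ⟨_, P.j_X1⟩]
  | algebraMap r => exact ⟨_, P.j_cc r⟩
  | add a b _ _ ha hb =>
    obtain ⟨u, hu⟩ := ha; obtain ⟨v, hv⟩ := hb
    exact ⟨u + v, by simp [hu, hv]⟩
  | mul a b _ _ ha hb =>
    obtain ⟨u, hu⟩ := ha; obtain ⟨v, hv⟩ := hb
    exact ⟨u * v, by simp [hu, hv]⟩

lemma exists_den (b : B) : ∃ N m, P.x ^ N * b = P.j m := by
  have hb : b ∈ Algebra.adjoin ℂ {P.x, P.y, P.z, P.t} := by rw [P.gen]; trivial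
  induction hb using Algebra.adjoin_induction with
  | mem b hb =>
    simp only [Set.mem_insert_iff, Set.mem_singleton_iff] at hb
    rcases hb with rfl | rfl | rfl | rfl
    · exact ⟨0, xx ℂ, by simp [j_xx]⟩
    · exact ⟨d, -FF k l, by rw [map_neg, j_FF, neg_neg]⟩
    · exact ⟨0, X 0, by simp [j_X0]⟩
    · exact ⟨0, X 1, by simp [j_X1]⟩
  | algebraMap r => exact ⟨0, cc r, by simp [j_cc]⟩
  | add a b _ _ ha hb =>
    obtain ⟨N, u, hu⟩ := ha; obtain ⟨N', v, hv⟩ := hb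
    exact ⟨N + N', xx ℂ ^ N' * u + xx ℂ ^ N * v, by
      simp only [map_add, map_mul, map_pow, j_xx, ← hu, ← hv]; ring⟩
  | mul a b _ _ ha hb =>
    obtain ⟨N, u, hu⟩ := ha; obtain ⟨N', v, hv⟩ := hb
    exact ⟨N + N', u * v, by simp only [map_mul, ← hu, ← hv]; ring⟩

theorem real_coords (P : Pres d k l B) (hd : 2 ≤ d) (hk : 2 ≤ k) (hkl : k < l) (hcop : Nat.Coprime k l)
    (hθ : ∀ m b, P.j m = P.x ^ d * b → m ∈ Ideal.span {xx ℂ ^ d, FF k l})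
    {σ : B →+* B} (hσ : Anti σ) : ∃ x y z t : B, σ x = x ∧ σ y = y ∧ σ z = z ∧ σ t = t ∧
      x ^ d * y + z ^ k + x + t ^ l = 0 ∧ Algebra.adjoin ℂ {x, y, z, t} = ⊤ := by
  have dom := P.dom
  obtain ⟨mx, mz, mt⟩ := hσ.mem P hd hk (by omega) hcop
  obtain ⟨mx, hmx⟩ := P.exists_j mx
  obtain ⟨mz, hmz⟩ := P.exists_j mz
  obtain ⟨mt, hmt⟩ := P.exists_j mt
  let τ : P2 CX →+* P2 CX := mk3 (cc.comp (starRingEnd ℂ)) mx mz mt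
  have jτ : ∀ m, P.j (τ m) = σ (P.j m) := by
    have : P.j.comp τ = σ.comp P.j := by
      apply hom_ext
      · intro a; simp only [RingHom.comp_apply, τ, mk3_cc, j_cc, hσ.c]
      · simp only [RingHom.comp_apply, τ, mk3_xx, j_xx, hmx]
      · simp only [RingHom.comp_apply, τ, mk3_X0, j_X0, hmz]
      · simp only [RingHom.comp_apply, τ, mk3_X1, j_X1, hmt]
    exact fun m => DFunLike.congr_fun this m
  have τc : ∀ a, τ (cc a) = cc (starRingEnd ℂ a) := by intro a; simp only [τ, mk3_cc, RingHom.comp_apply]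
  have τi : ∀ m, τ (τ m) = m := by
    intro m; apply P.j_inj; rw [jτ, jτ, hσ.inv]
  have dτ : ∀ u v, τ u ∣ τ v → u ∣ v := by
    intro u v h; have := map_dvd τ h; rwa [τi, τi] at this
  have hp : Prime (τ (xx ℂ)) := by
    refine ⟨?_, ?_, ?_⟩
    · intro h
      have := congrArg τ h
      rw [τi, map_zero] at this
      exact xx_ne this
    · intro h
      have := h.map τ
      rw [τi] at this
      exact xx_prime.not_isUnit this
    · intro a b h
      have := map_dvd τ h
      rw [τi, map_mul] at this
      rcases xx_prime.dvd_or_dvd this with h | h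
      · left; apply dτ; rwa [τi]
      · right; apply dτ; rwa [τi]
  obtain ⟨N, r, hr⟩ := P.exists_den (σ P.y)
  have hpF : xx ℂ ^ N * τ (FF k l) = - (τ (xx ℂ) ^ d * r) := by
    apply P.j_inj
    rw [map_mul, map_pow, map_neg, map_mul, map_pow, jτ, jτ, j_xx, j_FF, ← hr, map_neg, map_mul, map_pow]
    ring
  have hdv : τ (xx ℂ) ∣ xx ℂ := by
    have h1 : τ (xx ℂ) ∣ xx ℂ ^ N * τ (FF k l) := by
      rw [hpF, dvd_neg]
      exact Dvd.dvd.mul_right (dvd_pow_self _ (by omega)) _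
    rcases hp.dvd_or_dvd h1 with h | h
    · exact hp.dvd_of_dvd_pow h
    · exact absurd (dτ _ _ h) (xx_ndvd k l)
  obtain ⟨u, hu⟩ := (hp.associated_of_dvd xx_prime hdv).symm
  obtain ⟨lam, hlam, hu'⟩ := unit_cc u.isUnit
  have hx : τ (xx ℂ) = cc lam * xx ℂ := by rw [← hu, hu', mul_comm]
  have hτF : τ (FF k l) ∈ Ideal.span {xx ℂ ^ d, FF k l} := by
    apply hθ _ (- (algebraMap ℂ B lam ^ d * σ P.y))
    rw [jτ, j_FF, map_neg, map_mul, map_pow, ← j_xx, ← jτ, hx, map_mul, j_cc, j_xx]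
    ring
  obtain ⟨V, Vs, Vc, ⟨c, hc, Vx⟩, fx, fX, m1, m2⟩ := stepM hd hk hkl hcop τ τc τi lam hx hτF
  obtain ⟨a, b, hab⟩ := Ideal.mem_span_pair.mp m1
  obtain ⟨a', b', hab'⟩ := Ideal.mem_span_pair.mp m2
  have cinv : algebraMap ℂ B c * algebraMap ℂ B c⁻¹ = 1 := by rw [← map_mul, mul_inv_cancel₀ hc, map_one]
  have ex : P.j (V (xx ℂ)) = algebraMap ℂ B c * P.x := by rw [Vx, map_mul, j_cc, j_xx]
  have eF : P.j (V (FF k l)) = P.j (V (X 0)) ^ k + P.j (V (X 1)) ^ l + P.j (V (xx ℂ)) := by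
    simp only [FF, map_add, map_pow]
  have hx0 : P.j (V (xx ℂ)) ≠ 0 := by
    rw [ex]
    intro h
    apply P.x_ne
    linear_combination (algebraMap ℂ B c⁻¹) * h - P.x * cinv
  set ys : B := - (algebraMap ℂ B c⁻¹ ^ d * (P.j a - P.j b * P.y)) with hys
  have hrel : P.j (V (xx ℂ)) ^ d * ys = - P.j (V (FF k l)) := by
    have cd : algebraMap ℂ B c ^ d * algebraMap ℂ B c⁻¹ ^ d = 1 := by rw [← mul_pow, cinv, one_pow]
    rw [← hab, map_add, map_mul, map_mul, map_pow, j_xx, j_FF, ex, hys]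
    linear_combination (-(P.x ^ d * (P.j a - P.j b * P.y))) * cd
  clear_value ys
  have sj : ∀ m, τ m = m → σ (P.j m) = P.j m := by intro m h; rw [← jτ, h]
  have sF : σ (P.j (V (FF k l))) = P.j (V (FF k l)) := by
    rw [eF]; simp only [map_add, map_pow, sj _ fx, sj _ (fX 0), sj _ (fX 1)]
  have hyσ : σ ys = ys := by
    apply mul_left_cancel₀ (pow_ne_zero d hx0)
    have := congrArg σ hrel
    rw [map_mul, map_pow, sj _ fx, map_neg, sF, ← hrel] at this
    exact this
  refine ⟨P.j (V (xx ℂ)), ys, P.j (V (X 0)), P.j (V (X 1)), sj _ fx, hyσ, sj _ (fX 0), sj _ (fX 1), ?_, ?_⟩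
  · rw [hrel, eF]; ring
  · set S := Algebra.adjoin ℂ {P.j (V (xx ℂ)), ys, P.j (V (X 0)), P.j (V (X 1))} with hS
    have hV : ∀ m, P.j m ∈ S := by
      intro m
      obtain ⟨m, rfl⟩ := Vs m
      refine M_ind S (P.j.comp V) ?_ ?_ ?_ ?_ m
      · intro a; rw [RingHom.comp_apply, Vc, j_cc]; exact S.algebraMap_mem a
      all_goals exact Algebra.subset_adjoin (by simp)
    have hys' : ys ∈ S := Algebra.subset_adjoin (by simp)
    have hy : P.y = - (P.j a' - algebraMap ℂ B c ^ d * P.j b' * ys) := by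
      apply mul_left_cancel₀ (pow_ne_zero d P.x_ne)
      have := congrArg P.j hab'
      rw [map_add, map_mul, map_mul, map_pow, j_xx, j_FF, eq_neg_of_add_eq_zero_right
        (show P.j (V (xx ℂ)) ^ d * ys + P.j (V (FF k l)) = 0 by rw [hrel]; ring), ex] at this
      linear_combination this
    rw [eq_top_iff, ← P.gen, Algebra.adjoin_le_iff]
    intro f hf
    simp only [Set.mem_insert_iff, Set.mem_singleton_iff] at hf
    rcases hf with rfl | rfl | rfl | rfl
    · rw [← j_xx]; exact hV _
    · rw [hy]
      exact S.neg_mem (S.sub_mem (hV _) (S.mul_mem (S.mul_mem (S.pow_mem (S.algebraMap_mem c) d) (hV _)) hys'))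
    · rw [← j_X0]; exact hV _
    · rw [← j_X1]; exact hV _
end Pres
end KR

set_option linter.unusedSectionVars false

namespace KR
open MvPolynomial

/-- the equation in four variables -/
noncomputable def F4 (d k l : ℕ) : MvPolynomial (Fin 4) ℂ := X 0 ^ d * X 1 + X 2 ^ k + X 0 + X 3 ^ l

/-- the coordinate ring -/
abbrev B0 (d k l : ℕ) := MvPolynomial (Fin 4) ℂ ⧸ Ideal.span {F4 d k l}

/-- Laurent evaluation -/
noncomputable def ev4 (d k l : ℕ) : MvPolynomial (Fin 4) ℂ →ₐ[ℂ] Lau ℂ 3 :=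
  aeval ![lx ℂ 0, yL d k l, lx ℂ 1, lx ℂ 2]

lemma ev4_F4 (d k l : ℕ) : ev4 d k l (F4 d k l) = 0 := by
  have := yL_rel d k l
  rw [gL] at this
  simp [ev4, F4]
  linear_combination this

lemma X0_ndvd {d k l : ℕ} (hd : 2 ≤ d) : ¬ (X 0 : MvPolynomial (Fin 4) ℂ) ∣ F4 d k l := by
  rintro ⟨q, hq⟩
  have := congrArg (eval ![0, 0, 1, 1]) hq
  simp [F4, show d ≠ 0 by omega] at this

/-- inclusion of the three variable ring -/
noncomputable def r34 : MvPolynomial (Fin 3) ℂ →ₐ[ℂ] MvPolynomial (Fin 4) ℂ := aeval ![X 0, X 2, X 3]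

lemma ev4_r34 (d k l : ℕ) (g : MvPolynomial (Fin 3) ℂ) : ev4 d k l (r34 g) = lau ℂ 3 g := by
  have : (ev4 d k l).comp r34 = lau ℂ 3 := by
    apply MvPolynomial.algHom_ext
    intro i
    fin_cases i <;> simp [ev4, r34, lau]
  exact DFunLike.congr_fun this g

lemma den4 (d k l : ℕ) (f : MvPolynomial (Fin 4) ℂ) : ∃ N g, F4 d k l ∣ X 0 ^ N * f - r34 g := by
  have hX : ∀ i : Fin 4, ∃ N g, F4 d k l ∣ X 0 ^ N * X i - r34 g := by
    intro i
    fin_cases i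
    · exact ⟨0, X 0, by simp [r34]⟩
    · exact ⟨d, -(X 1 ^ k + X 0 + X 2 ^ l), ⟨1, by simp [r34, F4]; ring⟩⟩
    · exact ⟨0, X 1, by simp [r34]⟩
    · exact ⟨0, X 2, by simp [r34]⟩
  induction f using MvPolynomial.induction_on with
  | C a => exact ⟨0, C a, by simp [r34, MvPolynomial.algebraMap_eq]⟩
  | add p q hp hq =>
    obtain ⟨N, u, U, hu⟩ := hp; obtain ⟨N', v, U', hv⟩ := hq
    refine ⟨N + N', X 0 ^ N' * u + X 0 ^ N * v, X 0 ^ N' * U + X 0 ^ N * U', ?_⟩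
    have e : r34 (X 0) = X 0 := by simp [r34]
    simp only [map_add, map_mul, map_pow, e]
    linear_combination X 0 ^ N' * hu + X 0 ^ N * hv
  | mul_X p i hp =>
    obtain ⟨N, u, U, hu⟩ := hp; obtain ⟨N', v, U', hv⟩ := hX i
    refine ⟨N + N', u * v, U * X 0 ^ N' * X i + r34 u * U', ?_⟩
    simp only [map_mul]
    linear_combination X 0 ^ N' * X i * hu + r34 u * hv

lemma ev4_ker {d k l : ℕ} (hd : 2 ≤ d) {f : MvPolynomial (Fin 4) ℂ} (h : ev4 d k l f = 0) : F4 d k l ∣ f := by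
  obtain ⟨N, g, q, hq⟩ := den4 d k l f
  have := congrArg (ev4 d k l) hq
  rw [map_sub, map_mul, h, mul_zero, zero_sub, map_mul, ev4_F4, zero_mul, ev4_r34, neg_eq_zero,
    map_eq_zero_iff _ (lau_injective ℂ 3)] at this
  rw [this, map_zero, sub_zero] at hq
  obtain ⟨q', rfl⟩ := (MvPolynomial.X_prime (i := (0 : Fin 4)) (R := ℂ)).pow_dvd_of_dvd_mul_left N (X0_ndvd hd (k := k) (l := l))
    (show X 0 ^ N ∣ F4 d k l * q from ⟨f, hq.symm⟩)
  refine ⟨q', ?_⟩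
  apply mul_left_cancel₀ (pow_ne_zero N (X_ne_zero (R := ℂ) (0 : Fin 4)))
  rw [hq]; ring

/-- the standard presentation -/
noncomputable def P0 (d k l : ℕ) (hd : 2 ≤ d) : Pres d k l (B0 d k l) where
  ι := Ideal.Quotient.liftₐ _ (ev4 d k l) (by
    intro a ha
    obtain ⟨q, rfl⟩ := Ideal.mem_span_singleton.mp ha
    rw [map_mul, ev4_F4, zero_mul])
  inj := by
    rw [injective_iff_map_eq_zero]
    intro a ha
    obtain ⟨a, rfl⟩ := Ideal.Quotient.mk_surjective a
    rw [Ideal.Quotient.eq_zero_iff_mem, Ideal.mem_span_singleton]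
    exact ev4_ker hd ha
  x := Ideal.Quotient.mk _ (X 0)
  y := Ideal.Quotient.mk _ (X 1)
  z := Ideal.Quotient.mk _ (X 2)
  t := Ideal.Quotient.mk _ (X 3)
  hx := by
    change ev4 d k l (X 0) = _
    simp [ev4]
  hy := by
    change ev4 d k l (X 1) = _
    simp [ev4]
  hz := by
    change ev4 d k l (X 2) = _
    simp [ev4]
  ht := by
    change ev4 d k l (X 3) = _
    simp [ev4]
  gen := by
    rw [eq_top_iff]
    intro a _
    obtain ⟨a, rfl⟩ := Ideal.Quotient.mk_surjective a
    set S := Algebra.adjoin ℂ ({Ideal.Quotient.mk (Ideal.span {F4 d k l}) (X 0), Ideal.Quotient.mk _ (X 1),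
      Ideal.Quotient.mk _ (X 2), Ideal.Quotient.mk _ (X 3)} : Set (B0 d k l)) with hS
    induction a using MvPolynomial.induction_on with
    | C a => exact S.algebraMap_mem a
    | add p q hp hq => rw [map_add]; exact S.add_mem (hp trivial) (hq trivial)
    | mul_X p i hp =>
      rw [map_mul]
      refine S.mul_mem (hp trivial) ?_
      apply Algebra.subset_adjoin
      fin_cases i <;> simp

lemma P0_theta {d k l : ℕ} (hd : 2 ≤ d) (m : P2 CX) (b : B0 d k l) (h : (P0 d k l hd).j m = (P0 d k l hd).x ^ d * b) :
    m ∈ Ideal.span {xx ℂ ^ d, FF k l} := by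
  set I := Ideal.span {xx ℂ ^ d, FF k l} with hI
  let π := Ideal.Quotient.mk I
  let θ0 : MvPolynomial (Fin 4) ℂ →+* P2 CX ⧸ I := eval₂Hom (π.comp cc) ![π (xx ℂ), 0, π (X 0), π (X 1)]
  have h0 : θ0 (F4 d k l) = 0 := by
    have : π (FF k l) = 0 := Ideal.Quotient.eq_zero_iff_mem.mpr (Ideal.subset_span (by simp))
    rw [FF, map_add, map_add, map_pow, map_pow] at this
    simp [θ0, F4]
    linear_combination this
  let θ : B0 d k l →+* P2 CX ⧸ I := Ideal.Quotient.lift _ θ0 (by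
    intro a ha
    obtain ⟨q, rfl⟩ := Ideal.mem_span_singleton.mp ha
    rw [map_mul, h0, zero_mul])
  have hθ : θ.comp (P0 d k l hd).j = π := by
    apply hom_ext
    · intro a; rw [RingHom.comp_apply, Pres.j_cc]
      change θ0 (C a) = _
      simp [θ0]
    · rw [RingHom.comp_apply, Pres.j_xx]
      change θ0 (X 0) = _
      simp [θ0]
    · rw [RingHom.comp_apply, Pres.j_X0]
      change θ0 (X 2) = _
      simp [θ0]
    · rw [RingHom.comp_apply, Pres.j_X1]
      change θ0 (X 3) = _
      simp [θ0]
  have h1 := congrArg θ h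
  have h2 : θ ((P0 d k l hd).j m) = π m := DFunLike.congr_fun hθ m
  have h3 : θ (P0 d k l hd).x = π (xx ℂ) := by
    change θ0 (X 0) = _
    simp [θ0]
  rw [h2, map_mul, map_pow, h3, ← map_pow] at h1
  have h4 : π (xx ℂ ^ d) = 0 := Ideal.Quotient.eq_zero_iff_mem.mpr (Ideal.subset_span (by simp))
  rw [h4, zero_mul] at h1
  exact Ideal.Quotient.eq_zero_iff_mem.mp h1

theorem B0_coords {d k l : ℕ} (hd : 2 ≤ d) (hk : 2 ≤ k) (hkl : k < l) (hcop : Nat.Coprime k l)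
    {σ : B0 d k l →+* B0 d k l} (hσ : Pres.Anti σ) : ∃ x y z t : B0 d k l, σ x = x ∧ σ y = y ∧ σ z = z ∧ σ t = t ∧
      x ^ d * y + z ^ k + x + t ^ l = 0 ∧ Algebra.adjoin ℂ {x, y, z, t} = ⊤ :=
  (P0 d k l hd).real_coords hd hk hkl hcop (P0_theta hd) hσ
end KR

set_option linter.unusedSectionVars false

namespace KR
open MvPolynomial
open scoped TensorProduct

section Descent
variable {A : Type*} [CommRing A] [Algebra ℝ A]

/-- real part -/
noncomputable def reT : ℂ ⊗[ℝ] A →ₗ[ℝ] A := (TensorProduct.lid ℝ A).toLinearMap ∘ₗ LinearMap.rTensor A Complex.reLm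
/-- imaginary part -/
noncomputable def imT : ℂ ⊗[ℝ] A →ₗ[ℝ] A := (TensorProduct.lid ℝ A).toLinearMap ∘ₗ LinearMap.rTensor A Complex.imLm
/-- conjugation -/
noncomputable def cjT : ℂ ⊗[ℝ] A →ₐ[ℝ] ℂ ⊗[ℝ] A :=
  Algebra.TensorProduct.map Complex.conjAe.toAlgHom (AlgHom.id ℝ A)

lemma reT_tmul (z : ℂ) (a : A) : reT (z ⊗ₜ[ℝ] a) = z.re • a := by simp [reT]
lemma imT_tmul (z : ℂ) (a : A) : imT (z ⊗ₜ[ℝ] a) = z.im • a := by simp [imT]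
lemma cjT_tmul (z : ℂ) (a : A) : cjT (z ⊗ₜ[ℝ] a) = (starRingEnd ℂ z) ⊗ₜ[ℝ] a := by simp [cjT]

lemma decomp (w : ℂ ⊗[ℝ] A) : w = 1 ⊗ₜ reT w + Complex.I ⊗ₜ imT w := by
  induction w using TensorProduct.induction_on with
  | zero => simp
  | add u v hu hv =>
    nth_rw 1 [hu, hv]
    rw [map_add, map_add, TensorProduct.tmul_add, TensorProduct.tmul_add]; abel
  | tmul z a =>
    rw [reT_tmul, imT_tmul, ← TensorProduct.smul_tmul, ← TensorProduct.smul_tmul, ← TensorProduct.add_tmul]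
    congr 1
    apply Complex.ext <;> simp

lemma cjT_cjT (w : ℂ ⊗[ℝ] A) : cjT (cjT w) = w := by
  induction w using TensorProduct.induction_on with
  | zero => simp
  | add u v hu hv => rw [map_add, map_add, hu, hv]
  | tmul z a => rw [cjT_tmul, cjT_tmul, Complex.conj_conj]

lemma fixed_real {w : ℂ ⊗[ℝ] A} (h : cjT w = w) : ∃ a : A, w = 1 ⊗ₜ a := by
  have h1 := decomp w
  have h2 := congrArg cjT h1
  rw [h, map_add, cjT_tmul, cjT_tmul] at h2
  have h3 := congrArg imT h2
  rw [map_add, imT_tmul, imT_tmul] at h3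
  simp at h3
  have h4 : imT w = 0 := by
    have : (2:ℝ) • imT w = 0 := by rw [two_smul]; nth_rw 1 [h3]; simp
    simpa using this
  exact ⟨reT w, by rw [h4] at h1; simpa using h1⟩

lemma one_tmul_inj {a b : A} (h : (1 : ℂ) ⊗ₜ[ℝ] a = 1 ⊗ₜ b) : a = b := by
  have := congrArg reT h
  simpa [reT_tmul] using this

lemma descend_mem (S : Subalgebra ℝ A) (s : Set A) (hs : s ⊆ S) {w : ℂ ⊗[ℝ] A}
    (hw : w ∈ Algebra.adjoin ℂ ((fun a : A => (1 : ℂ) ⊗ₜ[ℝ] a) '' s)) :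
    ∃ a ∈ S, ∃ b ∈ S, w = 1 ⊗ₜ a + Complex.I ⊗ₜ b := by
  induction hw using Algebra.adjoin_induction with
  | mem w hw =>
    obtain ⟨a, ha, rfl⟩ := hw
    exact ⟨a, hs ha, 0, S.zero_mem, by simp⟩
  | algebraMap z =>
    refine ⟨algebraMap ℝ A z.re, S.algebraMap_mem _, algebraMap ℝ A z.im, S.algebraMap_mem _, ?_⟩
    rw [Algebra.TensorProduct.algebraMap_apply]
    simp only [Algebra.algebraMap_eq_smul_one (A := A), ← TensorProduct.smul_tmul, ← TensorProduct.add_tmul]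
    congr 1
    apply Complex.ext <;> simp
  | add u v _ _ hu hv =>
    obtain ⟨a, ha, b, hb, rfl⟩ := hu
    obtain ⟨a', ha', b', hb', rfl⟩ := hv
    exact ⟨a + a', S.add_mem ha ha', b + b', S.add_mem hb hb', by
      rw [TensorProduct.tmul_add, TensorProduct.tmul_add]; abel⟩
  | mul u v _ _ hu hv =>
    obtain ⟨a, ha, b, hb, rfl⟩ := hu
    obtain ⟨a', ha', b', hb', rfl⟩ := hv
    refine ⟨a * a' - b * b', S.sub_mem (S.mul_mem ha ha') (S.mul_mem hb hb'), a * b' + b * a',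
      S.add_mem (S.mul_mem ha hb') (S.mul_mem hb ha'), ?_⟩
    simp only [add_mul, mul_add, Algebra.TensorProduct.tmul_mul_tmul, one_mul, mul_one, Complex.I_mul_I,
      TensorProduct.tmul_add, TensorProduct.tmul_sub, TensorProduct.neg_tmul]
    abel
end Descent

/-- real equation -/
noncomputable def F4R (d k l : ℕ) : MvPolynomial (Fin 4) ℝ := X 0 ^ d * X 1 + X 2 ^ k + X 0 + X 3 ^ l

/-- base change -/
noncomputable abbrev cx : MvPolynomial (Fin 4) ℝ →+* MvPolynomial (Fin 4) ℂ := MvPolynomial.map Complex.ofRealHom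
/-- conjugation -/
noncomputable abbrev c4 : MvPolynomial (Fin 4) ℂ →+* MvPolynomial (Fin 4) ℂ := MvPolynomial.map (starRingEnd ℂ)

lemma cx_F4 (d k l : ℕ) : cx (F4R d k l) = F4 d k l := by simp [F4R, F4]
lemma c4_cx (p : MvPolynomial (Fin 4) ℝ) : c4 (cx p) = cx p := by
  rw [MvPolynomial.map_map]
  have : (starRingEnd ℂ).comp Complex.ofRealHom = Complex.ofRealHom := by ext r; simp
  rw [this]

lemma c4_range {q : MvPolynomial (Fin 4) ℂ} (h : c4 q = q) : ∃ p, cx p = q := by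
  have : q ∈ Set.range (MvPolynomial.map (σ := Fin 4) Complex.ofRealHom) := by
    rw [mem_range_map_iff_coeffs_subset]
    intro c hc
    obtain ⟨m, _, rfl⟩ := mem_coeffs_iff.mp (Finset.mem_coe.mp hc)
    have := congrArg (coeff m) h
    rw [coeff_map] at this
    exact ⟨(coeff m q).re, Complex.conj_eq_iff_re.mp this⟩
  exact this

lemma dvd_descend {d k l : ℕ} (hd : 2 ≤ d) {p : MvPolynomial (Fin 4) ℝ} (h : F4 d k l ∣ cx p) : F4R d k l ∣ p := by
  obtain ⟨q, hq⟩ := h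
  have h1 := congrArg c4 hq
  rw [c4_cx, map_mul, ← cx_F4, c4_cx, cx_F4, hq] at h1
  have hne : F4 d k l ≠ 0 := by
    intro h0
    apply X0_ndvd (k := k) (l := l) hd
    rw [h0]; exact dvd_zero _
  obtain ⟨r, rfl⟩ := c4_range (mul_left_cancel₀ hne h1).symm
  refine ⟨r, ?_⟩
  apply MvPolynomial.map_injective _ Complex.ofRealHom.injective
  rw [map_mul]
  change cx p = cx _ * cx r
  rw [hq, cx_F4]

theorem main {d k l : ℕ} (hd : 2 ≤ d) (hk : 2 ≤ k) (hkl : k < l) (hcop : Nat.Coprime k l)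
    (A : Type) [CommRing A] [Algebra ℝ A] (e : (ℂ ⊗[ℝ] A) ≃ₐ[ℂ] B0 d k l) :
    Nonempty (A ≃ₐ[ℝ] (MvPolynomial (Fin 4) ℝ ⧸ Ideal.span {F4R d k l})) := by
  let σ : B0 d k l →+* B0 d k l := e.toAlgHom.toRingHom.comp ((cjT (A := A)).toRingHom.comp e.symm.toAlgHom.toRingHom)
  have hs : ∀ b, σ b = e (cjT (e.symm b)) := fun b => rfl
  have hσ : Pres.Anti σ := by
    constructor
    · intro a
      rw [hs, AlgEquiv.commutes, Algebra.TensorProduct.algebraMap_apply, cjT_tmul]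
      exact e.commutes _
    · intro f
      rw [hs, hs, AlgEquiv.symm_apply_apply, cjT_cjT, AlgEquiv.apply_symm_apply]
  obtain ⟨x, y, z, t, hx, hy, hz, ht, hrel, hgen⟩ := B0_coords hd hk hkl hcop hσ
  have real : ∀ b, σ b = b → ∃ a : A, b = e (1 ⊗ₜ a) := by
    intro b hb
    obtain ⟨a, ha⟩ := fixed_real (w := e.symm b) (by
      apply e.injective; rw [← hs, hb, AlgEquiv.apply_symm_apply])
    exact ⟨a, by rw [← ha, AlgEquiv.apply_symm_apply]⟩
  obtain ⟨x, rfl⟩ := real _ hx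
  obtain ⟨y, rfl⟩ := real _ hy
  obtain ⟨z, rfl⟩ := real _ hz
  obtain ⟨t, rfl⟩ := real _ ht
  let inc : A →+* B0 d k l := e.toAlgHom.toRingHom.comp (Algebra.TensorProduct.includeRight (R := ℝ) (A := ℂ) (B := A)).toRingHom
  have hinc : ∀ a, inc a = e (1 ⊗ₜ a) := fun a => rfl
  have inc_inj : Function.Injective inc := by
    intro a b h
    rw [hinc, hinc] at h
    exact one_tmul_inj (e.injective h)
  simp only [← hinc] at hrel hgen
  have hrelA : x ^ d * y + z ^ k + x + t ^ l = 0 := by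
    apply inc_inj
    simpa using hrel
  let f : MvPolynomial (Fin 4) ℝ →ₐ[ℝ] A := aeval ![x, y, z, t]
  have fF : f (F4R d k l) = 0 := by simpa [f, F4R] using hrelA
  let fC : MvPolynomial (Fin 4) ℂ →ₐ[ℂ] B0 d k l := aeval ![inc x, inc y, inc z, inc t]
  have fCF : fC (F4 d k l) = 0 := by simpa [fC, F4] using hrel
  have fcx : ∀ p, fC (cx p) = inc (f p) := by
    have : (fC : _ →+* B0 d k l).comp cx = inc.comp (f : _ →+* A) := by
      apply MvPolynomial.ringHom_ext
      · intro r
        simp only [RingHom.comp_apply, MvPolynomial.map_C, RingHom.coe_coe, hinc, fC, f, aeval_C,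
          Algebra.algebraMap_eq_smul_one (A := A), ← TensorProduct.smul_tmul]
        rw [← e.commutes, Algebra.TensorProduct.algebraMap_apply]
        congr 2
        simp
      · intro i
        fin_cases i <;> simp [fC, f]
    exact fun p => DFunLike.congr_fun this p
  let gC : B0 d k l →ₐ[ℂ] B0 d k l := Ideal.Quotient.liftₐ _ fC (by
    intro a ha
    obtain ⟨q, rfl⟩ := Ideal.mem_span_singleton.mp ha
    rw [map_mul, fCF, zero_mul])
  have gCs : Function.Surjective gC := by
    rw [← AlgHom.range_eq_top, eq_top_iff, ← hgen, Algebra.adjoin_le_iff]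
    intro b hb
    have hX : ∀ i, fC (X i) ∈ gC.range := fun i => ⟨Ideal.Quotient.mk _ (X i), rfl⟩
    simp only [Set.mem_insert_iff, Set.mem_singleton_iff] at hb
    rcases hb with rfl | rfl | rfl | rfl
    · have := hX 0; simpa [fC] using this
    · have := hX 1; simpa [fC] using this
    · have := hX 2; simpa [fC] using this
    · have := hX 3; simpa [fC] using this
  have gCi : Function.Injective gC := noeth_inj (gC : B0 d k l →+* B0 d k l) gCs
  have kerf : ∀ p, f p = 0 → F4R d k l ∣ p := by
    intro p hp
    apply dvd_descend hd
    have h1 : gC (Ideal.Quotient.mk _ (cx p)) = 0 := by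
      change fC (cx p) = 0
      rw [fcx, hp, map_zero]
    rw [map_eq_zero_iff _ gCi, Ideal.Quotient.eq_zero_iff_mem, Ideal.mem_span_singleton] at h1
    exact h1
  let g : (MvPolynomial (Fin 4) ℝ ⧸ Ideal.span {F4R d k l}) →ₐ[ℝ] A := Ideal.Quotient.liftₐ _ f (by
    intro a ha
    obtain ⟨q, rfl⟩ := Ideal.mem_span_singleton.mp ha
    rw [map_mul, fF, zero_mul])
  refine ⟨(AlgEquiv.ofBijective g ⟨?_, ?_⟩).symm⟩
  · rw [injective_iff_map_eq_zero]
    intro a ha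
    obtain ⟨a, rfl⟩ := Ideal.Quotient.mk_surjective a
    rw [Ideal.Quotient.eq_zero_iff_mem, Ideal.mem_span_singleton]
    exact kerf a ha
  · intro a
    have hsub : ({x, y, z, t} : Set A) ⊆ (g.range : Set A) := by
      have hX : ∀ i, f (X i) ∈ g.range := fun i => ⟨Ideal.Quotient.mk _ (X i), rfl⟩
      intro b hb
      simp only [Set.mem_insert_iff, Set.mem_singleton_iff] at hb
      rcases hb with rfl | rfl | rfl | rfl
      · have := hX 0; simpa [f] using this
      · have := hX 1; simpa [f] using this
      · have := hX 2; simpa [f] using this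
      · have := hX 3; simpa [f] using this
    have hw : (1 : ℂ) ⊗ₜ[ℝ] a ∈ Algebra.adjoin ℂ ((fun a : A => (1 : ℂ) ⊗ₜ[ℝ] a) '' {x, y, z, t}) := by
      have h1 : e ((1 : ℂ) ⊗ₜ[ℝ] a) ∈ Algebra.adjoin ℂ {inc x, inc y, inc z, inc t} := by rw [hgen]; trivial
      have h2 : e.symm.toAlgHom (e ((1 : ℂ) ⊗ₜ[ℝ] a)) ∈
          (Algebra.adjoin ℂ {inc x, inc y, inc z, inc t}).map e.symm.toAlgHom := ⟨_, h1, rfl⟩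
      rw [AlgHom.map_adjoin] at h2
      convert h2 using 2
      · simp only [Set.image_insert_eq, Set.image_singleton, hinc]
        simp
      · simp
    obtain ⟨s, hs, s', hs', h⟩ := descend_mem g.range _ hsub hw
    have := congrArg reT h
    rw [map_add, reT_tmul, reT_tmul, reT_tmul] at this
    simp at this
    rw [this]; exact hs
end KR

open MvPolynomial
open scoped TensorProduct

/-- Every real form of the Koras-Russell threefold `X_{d,k,ℓ}` is isomorphic to the
standard one. -/
theorem koras_russell_unique_real_form (d k l : ℕ) (hd : 2 ≤ d) (hk : 2 ≤ k) (hkl : k < l)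
    (hcop : Nat.Coprime k l)
    (A : Type) [CommRing A] [Algebra ℝ A]
    (h : Nonempty ((ℂ ⊗[ℝ] A) ≃ₐ[ℂ]
      (MvPolynomial (Fin 4) ℂ ⧸ Ideal.span {krPoly ℂ d k l}))) :
    Nonempty (A ≃ₐ[ℝ] (MvPolynomial (Fin 4) ℝ ⧸ Ideal.span {krPoly ℝ d k l})) := by
  obtain ⟨e⟩ := h
  exact KR.main hd hk hkl hcop A e
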